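/- arXiv:2109.10721 — 5 statements merged into one kernel-verified Lean document; each statement's English description precedes it below -/
import Mathlib

section
/- Let μ be a σ-invariant Borel probability measure on Σ_T satisfying the Gibbs property with constant C ≥ 1 and pressure P ∈ ℝ with respect to a submultiplicative word potential φ. Let Ψ : Σ_T → ((Fin q)^{ℤ_{<0}}) × ((Fin q)^{ℤ_{≥0}}) be the map Ψ(x) = ((x_j)_{j<0}, (x_j)_{j≥0}), set ν = Ψ_*μ, and let ν₁ and ν₂ denote the first and second marginals of ν. Then ν(S) ≤ C³·(ν₁ × ν₂)(S) for every Borel set S; in particular, ν is absolutely continuous with respect to the product measure ν₁ × ν₂ of its marginals. -/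
open MeasureTheory Set

namespace Subshift

variable {q : ℕ} (T : Fin q → Fin q → Prop)

/-- The two-sided subshift of finite type determined by the transition matrix `T`. -/
abbrev SigmaT := {x : ℤ → Fin q // ∀ i : ℤ, T (x i) (x (i + 1))}

/-- The left shift map `(σx)_i = x_{i+1}`. -/
def shift (x : SigmaT T) : SigmaT T :=
  ⟨fun i => x.1 (i + 1), fun i => x.2 (i + 1)⟩

/-- A word `w : Fin n → Fin q` is admissible if consecutive symbols are allowed by `T`. -/
def WordAdmissible {n : ℕ} (w : Fin n → Fin q) : Prop :=
  ∀ (j : ℕ) (h : j + 1 < n), T (w ⟨j, Nat.lt_of_succ_lt h⟩) (w ⟨j + 1, h⟩)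

/-- The cylinder set determined by a word `w`. -/
def cylinder {n : ℕ} (w : Fin n → Fin q) : Set (SigmaT T) :=
  {x | ∀ j : Fin n, x.1 ((j : ℕ) : ℤ) = w j}

/-- A word potential `φ` (assigning a positive real to each admissible word) is
submultiplicative if `φ(IJ) ≤ φ(I)·φ(J)` whenever `I`, `J`, `IJ` are admissible. -/
def Submultiplicative (φ : ∀ n : ℕ, (Fin n → Fin q) → ℝ) : Prop :=
  (∀ (n : ℕ), 0 < n → ∀ w : Fin n → Fin q, WordAdmissible T w → 0 < φ n w) ∧
  ∀ (n m : ℕ), 0 < n → 0 < m → ∀ (I : Fin n → Fin q) (J : Fin m → Fin q),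
    WordAdmissible T I → WordAdmissible T J → WordAdmissible T (Fin.append I J) →
      φ (n + m) (Fin.append I J) ≤ φ n I * φ m J

/-- The Gibbs property with constant `C` and pressure `P` with respect to `φ`. -/
def Gibbs (μ : Measure (SigmaT T)) (C P : ℝ) (φ : ∀ n : ℕ, (Fin n → Fin q) → ℝ) : Prop :=
  ∀ (n : ℕ), 0 < n → ∀ w : Fin n → Fin q, WordAdmissible T w →
    C⁻¹ * Real.exp (-(n : ℝ) * P) * φ n w ≤ (μ (cylinder T w)).toReal ∧
    (μ (cylinder T w)).toReal ≤ C * Real.exp (-(n : ℝ) * P) * φ n w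

end Subshift

open Subshift MeasureTheory

/-- The map `Ψ(x) = ((x_j)_{j<0}, (x_j)_{j≥0})` splitting a two-sided sequence into its
strictly negative past and its nonnegative future. -/
def splitMap {q : ℕ} (T : Fin q → Fin q → Prop) (x : Subshift.SigmaT T) :
    ({j : ℤ // j < 0} → Fin q) × ({j : ℤ // 0 ≤ j} → Fin q) :=
  (fun j => x.1 j.1, fun j => x.1 j.1)

theorem aux_shift_iter {q : ℕ} (T : Fin q → Fin q → Prop) (n : ℕ) (x : SigmaT T) (i : ℤ) :
    ((shift T)^[n] x).1 i = x.1 (i + n) := by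
  induction n generalizing x i with
  | zero => simp
  | succ n ih =>
    rw [Function.iterate_succ_apply, ih]
    simp only [shift]
    push_cast
    ring_nf

theorem aux_coord_meas {q : ℕ} (T : Fin q → Fin q → Prop) (i : ℤ) :
    Measurable (fun x : SigmaT T => x.1 i) :=
  (measurable_pi_apply i).comp measurable_subtype_coe

theorem aux_shift_meas {q : ℕ} (T : Fin q → Fin q → Prop) : Measurable (shift T) := by
  apply Measurable.subtype_mk
  exact measurable_pi_lambda _ (fun i => aux_coord_meas T (i + 1))

theorem aux_inv_iter {q : ℕ} (T : Fin q → Fin q → Prop) (μ : Measure (SigmaT T))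
    (hinv : ∀ A : Set (SigmaT T), MeasurableSet A → μ (shift T ⁻¹' A) = μ A) (n : ℕ)
    (A : Set (SigmaT T)) (hA : MeasurableSet A) : μ ((shift T)^[n] ⁻¹' A) = μ A := by
  induction n with
  | zero => simp
  | succ n ih =>
    rw [Function.iterate_succ, Set.preimage_comp, hinv _ ((aux_shift_meas T).iterate n hA), ih]

theorem aux_split_meas {q : ℕ} (T : Fin q → Fin q → Prop) : Measurable (splitMap T) := by
  apply Measurable.prodMk
  · exact measurable_pi_lambda _ (fun i => aux_coord_meas T i.1)
  · exact measurable_pi_lambda _ (fun i => aux_coord_meas T i.1)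

def auxP (q n : ℕ) (z : {j : ℤ // j < 0} → Fin q) : Fin n → Fin q :=
  fun j => z ⟨(j : ℕ) - (n : ℤ), by have := j.2; omega⟩

def auxF (q n : ℕ) (z : {j : ℤ // 0 ≤ j} → Fin q) : Fin n → Fin q :=
  fun j => z ⟨((j : ℕ) : ℤ), by omega⟩

theorem auxP_meas (q n : ℕ) : Measurable (auxP q n) :=
  measurable_pi_lambda _ (fun _ => measurable_pi_apply _)

theorem auxF_meas (q n : ℕ) : Measurable (auxF q n) :=
  measurable_pi_lambda _ (fun _ => measurable_pi_apply _)

theorem aux_cyl {q : ℕ} (T : Fin q → Fin q → Prop)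
    (μ : Measure (SigmaT T)) [IsProbabilityMeasure μ]
    (C P : ℝ) (hC : 1 ≤ C)
    (φ : ∀ n : ℕ, (Fin n → Fin q) → ℝ)
    (hφ : Submultiplicative T φ)
    (hGibbs : Gibbs T μ C P φ) (n : ℕ) (hn : 0 < n) (I J : Fin n → Fin q) :
    μ (cylinder T (Fin.append I J)) ≤
      ENNReal.ofReal (C ^ 3) * (μ (cylinder T I) * μ (cylinder T J)) := by
  rcases Set.eq_empty_or_nonempty (cylinder T (Fin.append I J)) with he | ⟨x, hx⟩
  · simp [he]
  have hxI : ∀ j : Fin n, x.1 ((j : ℕ) : ℤ) = I j := fun j => by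
    have := hx (Fin.castAdd n j)
    simpa using this
  have hxJ : ∀ j : Fin n, x.1 ((n : ℤ) + ((j : ℕ) : ℤ)) = J j := fun j => by
    have := hx (Fin.natAdd n j)
    rw [Fin.append_right] at this
    simpa only [Fin.val_natAdd, Nat.cast_add] using this
  have aIJ : WordAdmissible T (Fin.append I J) := by
    intro j h
    rw [← hx, ← hx]
    have := x.2 j
    simpa using this
  have aI : WordAdmissible T I := by
    intro j h
    rw [← hxI, ← hxI]
    have := x.2 j
    simpa using this
  have aJ : WordAdmissible T J := by
    intro j h
    rw [← hxJ, ← hxJ]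
    have := x.2 (n + j)
    simpa [add_assoc] using this
  have h1 := (hGibbs (n + n) (by omega) _ aIJ).2
  have h2 := (hGibbs n hn _ aI).1
  have h3 := (hGibbs n hn _ aJ).1
  have h4 := hφ.2 n n hn hn I J aI aJ aIJ
  have pI := hφ.1 n hn I aI
  have pJ := hφ.1 n hn J aJ
  have hC0 : 0 < C := by linarith
  have key : (μ (cylinder T (Fin.append I J))).toReal ≤
      C ^ 3 * ((μ (cylinder T I)).toReal * (μ (cylinder T J)).toReal) := by
    have hexp : Real.exp (-((n + n : ℕ) : ℝ) * P)
        = Real.exp (-(n : ℝ) * P) * Real.exp (-(n : ℝ) * P) := by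
      rw [← Real.exp_add]
      congr 1
      push_cast
      ring
    rw [hexp] at h1
    set E := Real.exp (-(n : ℝ) * P) with hE
    have hE0 : 0 < E := Real.exp_pos _
    calc (μ (cylinder T (Fin.append I J))).toReal
        ≤ C * (E * E) * φ (n + n) (Fin.append I J) := h1
      _ ≤ C * (E * E) * (φ n I * φ n J) := by gcongr
      _ = C ^ 3 * ((C⁻¹ * E * φ n I) * (C⁻¹ * E * φ n J)) := by field_simp
      _ ≤ _ := by gcongr
  rw [← ENNReal.ofReal_toReal (measure_ne_top μ (cylinder T (Fin.append I J))),
    ← ENNReal.ofReal_toReal (measure_ne_top μ (cylinder T I)),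
    ← ENNReal.ofReal_toReal (measure_ne_top μ (cylinder T J)),
    ← ENNReal.ofReal_mul ENNReal.toReal_nonneg, ← ENNReal.ofReal_mul (by positivity)]
  exact ENNReal.ofReal_le_ofReal key

def auxPi (q n : ℕ) (z : ({j : ℤ // j < 0} → Fin q) × ({j : ℤ // 0 ≤ j} → Fin q)) :
    (Fin n → Fin q) × (Fin n → Fin q) := (auxP q n z.1, auxF q n z.2)

theorem auxPi_meas (q n : ℕ) : Measurable (auxPi q n) :=
  ((auxP_meas q n).comp measurable_fst).prodMk ((auxF_meas q n).comp measurable_snd)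

theorem aux_fiber {q : ℕ} (T : Fin q → Fin q → Prop)
    (μ : Measure (SigmaT T)) [IsProbabilityMeasure μ]
    (hinv : ∀ A : Set (SigmaT T), MeasurableSet A → μ (shift T ⁻¹' A) = μ A)
    (C P : ℝ) (hC : 1 ≤ C)
    (φ : ∀ n : ℕ, (Fin n → Fin q) → ℝ)
    (hφ : Submultiplicative T φ)
    (hGibbs : Gibbs T μ C P φ) (n : ℕ) (hn : 0 < n) (p : (Fin n → Fin q) × (Fin n → Fin q)) :
    (μ.map (splitMap T)) (auxPi q n ⁻¹' {p}) ≤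
          ENNReal.ofReal (C ^ 3) *
            (((μ.map (splitMap T)).map Prod.fst).prod
              ((μ.map (splitMap T)).map Prod.snd)) (auxPi q n ⁻¹' {p}) := by
  obtain ⟨I, J⟩ := p
  have hm := aux_split_meas T
  have mI : MeasurableSet (auxP q n ⁻¹' {I}) := auxP_meas q n (measurableSet_singleton I)
  have mJ : MeasurableSet (auxF q n ⁻¹' {J}) := auxF_meas q n (measurableSet_singleton J)
  have hset : auxPi q n ⁻¹' {(I, J)} = (auxP q n ⁻¹' {I}) ×ˢ (auxF q n ⁻¹' {J}) := by
    ext z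
    simp [auxPi, Prod.ext_iff]
  have := Measure.isProbabilityMeasure_map (μ := μ) hm.aemeasurable
  have := Measure.isProbabilityMeasure_map (μ := μ.map (splitMap T))
    (measurable_fst (α := {j : ℤ // j < 0} → Fin q) (β := {j : ℤ // 0 ≤ j} → Fin q)).aemeasurable
  have := Measure.isProbabilityMeasure_map (μ := μ.map (splitMap T))
    (measurable_snd (α := {j : ℤ // j < 0} → Fin q) (β := {j : ℤ // 0 ≤ j} → Fin q)).aemeasurable
  rw [hset, Measure.prod_prod, Measure.map_apply hm (mI.prod mJ),
    Measure.map_apply measurable_fst mI, Measure.map_apply measurable_snd mJ,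
    Measure.map_apply hm (measurable_fst mI), Measure.map_apply hm (measurable_snd mJ)]
  rw [← aux_inv_iter T μ hinv n _ (hm (mI.prod mJ)),
    ← aux_inv_iter T μ hinv n _ (hm (measurable_fst mI))]
  have e1 : (shift T)^[n] ⁻¹' (splitMap T ⁻¹' ((auxP q n ⁻¹' {I}) ×ˢ (auxF q n ⁻¹' {J})))
      = cylinder T (Fin.append I J) := by
    ext x
    simp only [Set.mem_preimage, Set.mem_prod, Set.mem_singleton_iff, splitMap, auxP, auxF,
      funext_iff, aux_shift_iter, Subshift.cylinder, Set.mem_ofPred_eq, Fin.forall_fin_add, Fin.append_right,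
      Fin.append_left, Fin.val_natAdd, Fin.val_castAdd]
    simp [add_comm]
  have e2 : (shift T)^[n] ⁻¹' (splitMap T ⁻¹' (Prod.fst ⁻¹' (auxP q n ⁻¹' {I})))
      = cylinder T I := by
    ext x
    simp [splitMap, auxP, funext_iff, aux_shift_iter, Subshift.cylinder]
  have e3 : (splitMap T ⁻¹' (Prod.snd ⁻¹' (auxF q n ⁻¹' {J})))
      = cylinder T J := by
    ext x
    simp [splitMap, auxF, funext_iff, Subshift.cylinder]
  rw [e1, e2, e3]
  exact aux_cyl T μ C P hC φ hφ hGibbs n hn I J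

theorem aux_finite {q : ℕ} (n : ℕ)
    (ν ρ : Measure (({j : ℤ // j < 0} → Fin q) × ({j : ℤ // 0 ≤ j} → Fin q)))
    (h : ∀ p, ν (auxPi q n ⁻¹' {p}) ≤ ρ (auxPi q n ⁻¹' {p}))
    (A : Set ((Fin n → Fin q) × (Fin n → Fin q))) :
    ν (auxPi q n ⁻¹' A) ≤ ρ (auxPi q n ⁻¹' A) := by
  classical
  have hA : A = (A.toFinite.toFinset : Set _) := by simp
  rw [hA, ← sum_measure_preimage_singleton _ (fun y _ => auxPi_meas q n (measurableSet_singleton y)),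
    ← sum_measure_preimage_singleton _ (fun y _ => auxPi_meas q n (measurableSet_singleton y))]
  exact Finset.sum_le_sum (fun p _ => h p)

theorem aux_nhds {q : ℕ} (U : Set (({j : ℤ // j < 0} → Fin q) × ({j : ℤ // 0 ≤ j} → Fin q)))
    (hU : IsOpen U) (z) (hz : z ∈ U) :
    ∃ N : ℕ, auxPi q (N + 1) ⁻¹' {auxPi q (N + 1) z} ⊆ U := by
  obtain ⟨u, v, hu, hv, hzu, hzv, huv⟩ := isOpen_prod_iff.1 hU z.1 z.2 hz
  obtain ⟨I, a, hI, hIu⟩ := isOpen_pi_iff.1 hu _ hzu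
  obtain ⟨J, b, hJ, hJv⟩ := isOpen_pi_iff.1 hv _ hzv
  refine ⟨I.sup (fun j => j.1.natAbs) + J.sup (fun j => j.1.natAbs), ?_⟩
  set N := I.sup (fun j => j.1.natAbs) + J.sup (fun j => j.1.natAbs) with hN
  intro w hw
  have hw' : auxPi q (N + 1) w = auxPi q (N + 1) z := hw
  have hw1 : auxP q (N + 1) w.1 = auxP q (N + 1) z.1 := congrArg Prod.fst hw'
  have hw2 : auxF q (N + 1) w.2 = auxF q (N + 1) z.2 := congrArg Prod.snd hw'
  apply huv
  refine ⟨hIu ?_, hJv ?_⟩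
  · intro j hj
    have hle : j.1.natAbs ≤ I.sup (fun j => j.1.natAbs) :=
      Finset.le_sup (f := fun j : {j : ℤ // j < 0} => j.1.natAbs) hj
    have hj0 := j.2
    have := congrFun hw1 ⟨(j.1 + (N + 1 : ℕ)).toNat, by omega⟩
    simp only [auxP] at this
    have e : (⟨(((j.1 + (N + 1 : ℕ)).toNat : ℕ) : ℤ) - ((N + 1 : ℕ) : ℤ), by omega⟩ :
        {j : ℤ // j < 0}) = j := Subtype.ext (by simp only; omega)
    rw [e] at this
    rw [this]
    exact (hI j hj).2
  · intro j hj
    have hle : j.1.natAbs ≤ J.sup (fun j => j.1.natAbs) :=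
      Finset.le_sup (f := fun j : {j : ℤ // 0 ≤ j} => j.1.natAbs) hj
    have hj0 := j.2
    have := congrFun hw2 ⟨j.1.toNat, by omega⟩
    simp only [auxF] at this
    have e : (⟨((j.1.toNat : ℕ) : ℤ), by omega⟩ :
        {j : ℤ // 0 ≤ j}) = j := Subtype.ext (by simp only; omega)
    rw [e] at this
    rw [this]
    exact (hJ j hj).2

theorem aux_mono {q n m : ℕ} (h : n ≤ m) (z w) (hzw : auxPi q m z = auxPi q m w) :
    auxPi q n z = auxPi q n w := by
  have hw1 : auxP q m z.1 = auxP q m w.1 := congrArg Prod.fst hzw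
  have hw2 : auxF q m z.2 = auxF q m w.2 := congrArg Prod.snd hzw
  refine Prod.ext ?_ ?_
  · funext j
    have := congrFun hw1 ⟨j + (m - n), by omega⟩
    simp only [auxP] at this
    simp only [auxPi, auxP]
    convert this using 3 <;> push_cast [h] <;> ring
  · funext j
    exact congrFun hw2 ⟨j, by omega⟩

theorem aux_le {q : ℕ}
    (ν ρ : Measure (({j : ℤ // j < 0} → Fin q) × ({j : ℤ // 0 ≤ j} → Fin q)))
    [IsFiniteMeasure ρ]
    (h : ∀ n, 0 < n → ∀ p, ν (auxPi q n ⁻¹' {p}) ≤ ρ (auxPi q n ⁻¹' {p})) (S) :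
    ν S ≤ ρ S := by
  have hopen : ∀ U, IsOpen U → ν U ≤ ρ U := by
    intro U hU
    let A : ℕ → Set _ := fun N => auxPi q (N + 1) ⁻¹' {p | auxPi q (N + 1) ⁻¹' {p} ⊆ U}
    have hUA : U = ⋃ N, A N := by
      ext z
      simp only [Set.mem_iUnion]
      constructor
      · exact fun hz => aux_nhds U hU z hz
      · rintro ⟨N, hN⟩
        exact hN rfl
    have hmono : Monotone A := by
      intro N M hNM z hz w hw
      exact hz (aux_mono (by omega) w z hw)
    rw [hUA, hmono.measure_iUnion]
    refine iSup_le fun N => ?_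
    exact (aux_finite (N + 1) ν ρ (h (N + 1) (by omega)) _).trans
      (measure_mono (Set.subset_iUnion A N))
  rw [Set.measure_eq_iInf_isOpen S ρ]
  refine le_iInf fun U => le_iInf fun hSU => le_iInf fun hU => ?_
  exact (measure_mono hSU).trans (hopen U hU)

/-- For a σ-invariant Borel probability measure `μ` on `Σ_T` with the Gibbs
property (constant `C ≥ 1`, pressure `P`) w.r.t. a submultiplicative word potential `φ`,
the pushforward `ν = Ψ_*μ` satisfies `ν(S) ≤ C³·(ν₁ × ν₂)(S)` for every Borel set `S`,
where `ν₁, ν₂` are the marginals of `ν`; in particular `ν ≪ ν₁ × ν₂`. -/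
theorem stmt2 {q : ℕ} (hq : 1 ≤ q) (T : Fin q → Fin q → Prop)
    (hne : Nonempty (SigmaT T))
    (μ : Measure (SigmaT T)) [IsProbabilityMeasure μ]
    (hinv : ∀ A : Set (SigmaT T), MeasurableSet A → μ (shift T ⁻¹' A) = μ A)
    (C P : ℝ) (hC : 1 ≤ C)
    (φ : ∀ n : ℕ, (Fin n → Fin q) → ℝ)
    (hφ : Submultiplicative T φ)
    (hGibbs : Gibbs T μ C P φ) :
    (∀ S : Set (({j : ℤ // j < 0} → Fin q) × ({j : ℤ // 0 ≤ j} → Fin q)),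
      MeasurableSet S →
        (μ.map (splitMap T)) S ≤
          ENNReal.ofReal (C ^ 3) *
            (((μ.map (splitMap T)).map Prod.fst).prod
              ((μ.map (splitMap T)).map Prod.snd)) S) ∧
    μ.map (splitMap T) ≪
      ((μ.map (splitMap T)).map Prod.fst).prod ((μ.map (splitMap T)).map Prod.snd) := by
  have hm := aux_split_meas T
  have := Measure.isProbabilityMeasure_map (μ := μ) hm.aemeasurable
  have := Measure.isProbabilityMeasure_map (μ := μ.map (splitMap T))
    (measurable_fst (α := {j : ℤ // j < 0} → Fin q) (β := {j : ℤ // 0 ≤ j} → Fin q)).aemeasurable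
  have := Measure.isProbabilityMeasure_map (μ := μ.map (splitMap T))
    (measurable_snd (α := {j : ℤ // j < 0} → Fin q) (β := {j : ℤ // 0 ≤ j} → Fin q)).aemeasurable
  have main : ∀ S, (μ.map (splitMap T)) S ≤
          ENNReal.ofReal (C ^ 3) *
            (((μ.map (splitMap T)).map Prod.fst).prod
              ((μ.map (splitMap T)).map Prod.snd)) S := by
    intro S
    have : IsFiniteMeasure (ENNReal.ofReal (C ^ 3) • (((μ.map (splitMap T)).map Prod.fst).prod
              ((μ.map (splitMap T)).map Prod.snd))) :=
      Measure.smul_finite _ ENNReal.ofReal_ne_top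
    exact aux_le (μ.map (splitMap T)) (ENNReal.ofReal (C ^ 3) •
      (((μ.map (splitMap T)).map Prod.fst).prod ((μ.map (splitMap T)).map Prod.snd)))
      (fun n hn p => aux_fiber T μ hinv C P hC φ hφ hGibbs n hn p) S
  refine ⟨fun S _ => main S, fun S hS => ?_⟩
  have := main S
  rw [hS, mul_zero] at this
  exact le_antisymm this zero_le
end

section
/- Let 0 < ε < 1/5. Let X₁ and X₂ be measurable spaces carrying probability measures μ₁, ν₁ on X₁ and μ₂, ν₂ on X₂, and let Y₁ ⊆ X₁ and Y₂ ⊆ X₂ be measurable sets such that: (1) (1−ε)·ν₁(A) ≤ μ₁(A) ≤ (1+ε)·ν₁(A) for every measurable A ⊆ Y₁; (2) (1−ε)·ν₂(A) ≤ μ₂(A) ≤ (1+ε)·ν₂(A) for every measurable A ⊆ Y₂; (3) μ₁(Y₁) ≥ 1 − ε and μ₂(Y₂) ≥ 1 − ε. Suppose θ : X₁ → X₂ is a measurable embedding (injective, measurable, with measurable images of measurable sets) satisfying ν₂(θ(A)) = ν₁(A) for every measurable A ⊆ X₁. Then the set G = Y₁ ∩ θ⁻¹(Y₂) satisfies μ₁(G)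 ≥ 1 − 5ε, and (1 − 5ε)·μ₁(A) ≤ μ₂(θ(A)) ≤ (1 + 5ε)·μ₁(A) for every measurable A ⊆ G; in particular, θ is 5ε-measure-preserving from (X₁, μ₁) to (X₂, μ₂). -/
open MeasureTheory

/-- Let `0 < ε < 1/5`, let `μ₁, ν₁` and `μ₂, ν₂` be probability measures on
`X₁` and `X₂` with measurable sets `Y₁ ⊆ X₁`, `Y₂ ⊆ X₂` such that the densities of `μᵢ`
w.r.t. `νᵢ` lie in `[1−ε, 1+ε]` on `Yᵢ` and `μᵢ(Yᵢ) ≥ 1 − ε`. If `θ : X₁ → X₂` is a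
measurable embedding with `ν₂(θ(A)) = ν₁(A)` for all measurable `A`, then
`G = Y₁ ∩ θ⁻¹(Y₂)` satisfies `μ₁(G) ≥ 1 − 5ε` and
`(1 − 5ε)·μ₁(A) ≤ μ₂(θ(A)) ≤ (1 + 5ε)·μ₁(A)` for every measurable `A ⊆ G`;
in particular `θ` is `5ε`-measure-preserving from `(X₁, μ₁)` to `(X₂, μ₂)`. -/
theorem stmt5 {X₁ X₂ : Type*} [MeasurableSpace X₁] [MeasurableSpace X₂]
    (μ₁ ν₁ : Measure X₁) (μ₂ ν₂ : Measure X₂)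
    [IsProbabilityMeasure μ₁] [IsProbabilityMeasure ν₁]
    [IsProbabilityMeasure μ₂] [IsProbabilityMeasure ν₂]
    (ε : ℝ) (hε : 0 < ε) (hε5 : ε < 1 / 5)
    (Y₁ : Set X₁) (Y₂ : Set X₂) (hY₁ : MeasurableSet Y₁) (hY₂ : MeasurableSet Y₂)
    (h1 : ∀ A : Set X₁, A ⊆ Y₁ → MeasurableSet A →
      (1 - ε) * (ν₁ A).toReal ≤ (μ₁ A).toReal ∧ (μ₁ A).toReal ≤ (1 + ε) * (ν₁ A).toReal)
    (h2 : ∀ A : Set X₂, A ⊆ Y₂ → MeasurableSet A →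
      (1 - ε) * (ν₂ A).toReal ≤ (μ₂ A).toReal ∧ (μ₂ A).toReal ≤ (1 + ε) * (ν₂ A).toReal)
    (h3 : 1 - ε ≤ (μ₁ Y₁).toReal) (h4 : 1 - ε ≤ (μ₂ Y₂).toReal)
    (θ : X₁ → X₂) (hθ : MeasurableEmbedding θ)
    (hmp : ∀ A : Set X₁, MeasurableSet A → ν₂ (θ '' A) = ν₁ A) :
    1 - 5 * ε ≤ (μ₁ (Y₁ ∩ θ ⁻¹' Y₂)).toReal ∧
      ∀ A : Set X₁, A ⊆ Y₁ ∩ θ ⁻¹' Y₂ → MeasurableSet A →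
        (1 - 5 * ε) * (μ₁ A).toReal ≤ (μ₂ (θ '' A)).toReal ∧
        (μ₂ (θ '' A)).toReal ≤ (1 + 5 * ε) * (μ₁ A).toReal := by
  refine ⟨?_, ?_⟩
  · have hT : MeasurableSet (θ ⁻¹' Y₂) := hθ.measurable hY₂
    have hB : MeasurableSet (Y₁ \ θ ⁻¹' Y₂) := hY₁.diff hT
    have e1 : (μ₁ (Y₁ ∩ θ ⁻¹' Y₂)).toReal + (μ₁ (Y₁ \ θ ⁻¹' Y₂)).toReal = (μ₁ Y₁).toReal :=
      measureReal_inter_add_diff hT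
    have e2 := (h1 _ Set.diff_subset hB).2
    have e3 : (ν₁ (Y₁ \ θ ⁻¹' Y₂)).toReal ≤ (ν₂ Y₂ᶜ).toReal := by
      rw [← hmp _ hB]
      apply ENNReal.toReal_mono (measure_ne_top _ _)
      apply measure_mono
      rintro _ ⟨x, hx, rfl⟩
      exact hx.2
    have e4 : (ν₂ Y₂ᶜ).toReal = 1 - (ν₂ Y₂).toReal := probReal_compl_eq_one_sub hY₂
    have e5 := (h2 _ subset_rfl hY₂).2
    rw [e4] at e3
    have e6 := mul_le_mul_of_nonneg_left e3 (by linarith : (0 : ℝ) ≤ 1 + ε)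
    linarith
  · intro A hA hAm
    obtain ⟨a1, a2⟩ := h1 A (fun x hx => (hA hx).1) hAm
    obtain ⟨b1, b2⟩ := h2 (θ '' A) (by rintro _ ⟨x, hx, rfl⟩; exact (hA hx).2)
      (hθ.measurableSet_image.2 hAm)
    rw [hmp A hAm] at b1 b2
    have hn : 0 ≤ (ν₁ A).toReal := ENNReal.toReal_nonneg
    have c1 := mul_le_mul_of_nonneg_left a1 (by linarith : (0 : ℝ) ≤ 1 + 5 * ε)
    have c2 := mul_le_mul_of_nonneg_left a2 (by linarith : (0 : ℝ) ≤ 1 - 5 * ε)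
    have d1 : 0 ≤ ε * (3 - 5 * ε) * (ν₁ A).toReal :=
      mul_nonneg (mul_nonneg hε.le (by linarith)) hn
    have d2 : 0 ≤ ε * (3 + 5 * ε) * (ν₁ A).toReal :=
      mul_nonneg (mul_nonneg hε.le (by linarith)) hn
    constructor <;> nlinarith
end

section
/- Let X be a compact metric space with its Borel σ-algebra, let μ and λ be Borel probability measures on X with μ absolutely continuous with respect to λ, and let 𝒞 be a family of Borel subsets of X with the following approximation property: for every compact K ⊆ X and all δ, β > 0 there exists a finite pairwise-disjoint subfamily 𝒮 ⊆ 𝒞, each member of diameter less than δ, with λ(K △ ⋃𝒮) < β. Then for every ε₀ ∈ (0,1) and every δ > 0 there exist finitely many pairwise disjoint sets R₁, …, Rₙ ∈ 𝒞, each of diameter less than δ and satisfying μ(Rᵢ) > 0 and λ(Rᵢ) > 0, together with Borel sets Gᵢ ⊆ Rᵢ, such that: (1) μ(⋃ᵢ Rᵢ) > 1 − ε₀; (2) μ(Gᵢ) ≥ (1 − ε₀)·μ(Rᵢ) and λ(Gᵢ) ≥ (1 − ε₀)·λ(Rᵢ) for each i; (3) for each i and every Borel S ⊆ Gᵢ,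 (1 − ε₀)·(μ(Rᵢ)/λ(Rᵢ))·λ(S) ≤ μ(S) ≤ (1 + ε₀)·(μ(Rᵢ)/λ(Rᵢ))·λ(S); (4) μ(⋃ᵢ Gᵢ) ≥ 1 − ε₀. -/
open MeasureTheory

lemma aux_abs {X : Type*} [MeasurableSpace X]
    (μ lam : Measure X) [IsProbabilityMeasure μ] [IsProbabilityMeasure lam]
    (habs : μ ≪ lam) (τ : ℝ) (hτ : 0 < τ) :
    ∃ γ : ℝ, 0 < γ ∧ ∀ A : Set X, lam.real A < γ → μ.real A < τ := by
  have h1 : ∫⁻ x, μ.rnDeriv lam x ∂lam ≠ ⊤ := by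
    rw [Measure.lintegral_rnDeriv habs]; simp
  obtain ⟨d, hd, h⟩ := exists_pos_setLIntegral_lt_of_measure_lt h1
    (ε := ENNReal.ofReal τ) (by simpa using hτ)
  refine ⟨(min d 1).toReal, ENNReal.toReal_pos (by simp [hd.ne']) (by simp), fun A hA => ?_⟩
  have h2 : lam A < d := by
    refine lt_of_lt_of_le ?_ (min_le_left d 1)
    exact (ENNReal.toReal_lt_toReal (measure_ne_top _ _) (by simp)).1 hA
  have h3 := h A h2
  rw [Measure.setLIntegral_rnDeriv habs] at h3
  exact (ENNReal.lt_ofReal_iff_toReal_lt (measure_ne_top _ _)).1 h3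

lemma aux_bad {X : Type*} [MeasurableSpace X] (ν : Measure X) [IsFiniteMeasure ν]
    (B : Finset (Set X)) (hB : (B : Set (Set X)).Pairwise Disjoint)
    (hm : ∀ b ∈ B, MeasurableSet b) (K : Set X) (hK : MeasurableSet K) (θ : ℝ)
    (h : ∀ b ∈ B, θ * ν.real b ≤ ν.real (b \ K)) :
    θ * ν.real (⋃₀ ↑B) ≤ ν.real (⋃₀ ↑B \ K) := by
  have e : (⋃₀ (↑B : Set (Set X))) \ K = ⋃ b ∈ B, b \ K := by
    ext x; simp only [Set.mem_diff, Set.mem_sUnion, Set.mem_iUnion, Finset.mem_coe]; grind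
  rw [e, Set.sUnion_eq_biUnion]
  have e2 : (⋃ b ∈ (↑B : Set (Set X)), b) = ⋃ b ∈ B, b := by simp
  rw [e2, measureReal_biUnion_finset (f := fun b => b) hB hm,
    measureReal_biUnion_finset (f := fun b => b \ K)
      (fun a ha b hb hab => (hB ha hb hab).mono Set.diff_subset Set.diff_subset)
      (fun b hb => (hm b hb).diff hK), Finset.mul_sum]
  exact Finset.sum_le_sum h

lemma aux_K {X : Type*} [MetricSpace X] [CompactSpace X]
    [MeasurableSpace X] [BorelSpace X]
    (μ lam : Measure X) [IsProbabilityMeasure μ] [IsProbabilityMeasure lam]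
    (habs : μ ≪ lam) (θ : ℝ) (hθ : 0 < θ) :
    ∃ (K : Set X) (δ : ℝ), IsCompact K ∧ 0 < δ ∧ 1 - θ < μ.real K ∧
      ∀ E : Set X, E ⊆ K → Metric.diam E < δ → E.Nonempty → ∃ t : ℝ, 0 < t ∧
        ∀ S ⊆ E, MeasurableSet S → (1 - θ) * t * lam.real S ≤ μ.real S ∧
          μ.real S ≤ (1 + θ) * t * lam.real S := by
  obtain ⟨γ, hγ, habs'⟩ := aux_abs μ lam habs (θ / 4) (by positivity)
  set f : X → ℝ := fun x => (μ.rnDeriv lam x).toReal with hf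
  have hfm : Measurable f := (Measure.measurable_rnDeriv _ _).ennreal_toReal
  have hfi : Integrable f lam := Measure.integrable_toReal_rnDeriv
  have hfS : ∀ S, ∫ x in S, f x ∂lam = μ.real S := fun S =>
    Measure.setIntegral_toReal_rnDeriv habs S
  set c : ℝ := θ / 4 with hc
  have hc0 : 0 < c := by positivity
  set a : ℝ := θ * c / 3 with ha
  have ha0 : 0 < a := by positivity
  obtain ⟨h, hh, hhi⟩ := hfi.exists_boundedContinuous_integral_sub_le
    (ε := a * γ / 2) (by positivity)
  have hdi : Integrable (fun x => |f x - h x|) lam := (hfi.sub hhi).abs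
  have hm1 : lam.real {x | a ≤ |f x - h x|} < γ := by
    have := mul_meas_ge_le_integral_of_nonneg (μ := lam)
      (Filter.Eventually.of_forall (fun x => abs_nonneg (f x - h x))) hdi a
    have h4 : a * lam.real {x | a ≤ |f x - h x|} ≤ a * γ / 2 := this.trans hh
    nlinarith
  have hm2 := habs' _ hm1
  have hA1 : MeasurableSet {x | f x ≤ c} := hfm measurableSet_Iic
  have hm3 : μ.real {x | f x ≤ c} ≤ c := by
    rw [← hfS]
    calc ∫ x in {x | f x ≤ c}, f x ∂lam ≤ ∫ x in {x | f x ≤ c}, c ∂lam :=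
          setIntegral_mono_on hfi.integrableOn (integrable_const _) hA1 (fun x hx => hx)
      _ = lam.real {x | f x ≤ c} * c := by simp
      _ ≤ 1 * c := by gcongr; exact measureReal_le_one
      _ = c := one_mul c
  have hA2 : MeasurableSet {x | a ≤ |f x - h x|} :=
    measurableSet_le measurable_const (by
      have := h.continuous.measurable
      exact (hfm.sub this).abs)
  set A : Set X := ({x | f x ≤ c} ∪ {x | a ≤ |f x - h x|})ᶜ with hA
  have hAm : MeasurableSet A := (hA1.union hA2).compl
  have hAμ : 1 - θ / 2 < μ.real A := by
    rw [hA, probReal_compl_eq_one_sub (hA1.union hA2)]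
    have := measureReal_union_le (μ := μ) {x | f x ≤ c} {x | a ≤ |f x - h x|}
    linarith
  obtain ⟨K, hKA, hK, hKμ⟩ := hAm.exists_isCompact_lt_add (measure_ne_top μ A)
    (ε := ENNReal.ofReal (θ / 2)) (by simpa using hθ)
  have hKμ' : μ.real A < μ.real K + θ / 2 := by
    have := (ENNReal.toReal_lt_toReal (measure_ne_top _ _) (by simp)).2 hKμ
    rwa [ENNReal.toReal_add (measure_ne_top _ _) (by simp),
      ENNReal.toReal_ofReal (by positivity)] at this
  have huc : UniformContinuous h := CompactSpace.uniformContinuous_of_continuous h.continuous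
  obtain ⟨δ, hδ, hhδ⟩ := Metric.uniformContinuous_iff.1 huc a ha0
  refine ⟨K, δ, hK, hδ, by linarith, fun E hE hEd ⟨x0, hx0⟩ => ?_⟩
  have hAx : ∀ x ∈ E, c < f x ∧ |f x - h x| < a := by
    intro x hx
    have := hKA (hE hx)
    simpa [hA, not_or] using this
  have hbd : ∀ x ∈ E, (1 - θ) * f x0 ≤ f x ∧ f x ≤ (1 + θ) * f x0 := by
    intro x hx
    have h1 := hAx x hx
    have h0 := hAx x0 hx0
    have hd : dist x x0 < δ :=
      (Metric.dist_le_diam_of_mem (Metric.isBounded_of_compactSpace) hx hx0).trans_lt hEd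
    have h2 := hhδ hd
    rw [Real.dist_eq] at h2
    have h3 := abs_lt.1 h2
    have h4 := abs_lt.1 h1.2
    have h5 := abs_lt.1 h0.2
    have h6 : 3 * a ≤ θ * f x0 := by
      rw [ha]; nlinarith [h0.1]
    constructor <;> linarith [h3.1, h3.2, h4.1, h4.2, h5.1, h5.2]
  refine ⟨f x0, hc0.trans (hAx x0 hx0).1, fun S hS hSm => ?_⟩
  rw [← hfS]
  constructor
  · calc (1 - θ) * f x0 * lam.real S = ∫ x in S, (1 - θ) * f x0 ∂lam := by simp [mul_comm]
      _ ≤ _ := setIntegral_mono_on (integrable_const _) hfi.integrableOn hSm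
          (fun x hx => (hbd x (hS hx)).1)
  · calc ∫ x in S, f x ∂lam ≤ ∫ x in S, (1 + θ) * f x0 ∂lam :=
          setIntegral_mono_on hfi.integrableOn (integrable_const _) hSm
          (fun x hx => (hbd x (hS hx)).2)
      _ = _ := by simp [mul_comm]

lemma aux_num (θ t m l mg lg s ms : ℝ) (hθ : 0 < θ) (hθ1 : θ < 1 / 5) (ht : 0 < t)
    (hl : 0 < l) (hs : 0 ≤ s) (hlg : lg ≤ l)
    (hmgm : mg ≤ m) (h1 : (1 - θ) * m ≤ mg) (h2 : (1 - θ) * l ≤ lg)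
    (h3 : (1 - θ) * t * lg ≤ mg) (h4 : mg ≤ (1 + θ) * t * lg)
    (h5 : (1 - θ) * t * s ≤ ms) (h6 : ms ≤ (1 + θ) * t * s) :
    (1 - 5 * θ) * (m / l) * s ≤ ms ∧ ms ≤ (1 + 5 * θ) * (m / l) * s := by
  have hq : m / l * l = m := by field_simp
  set q := m / l
  have hu : (1 - θ) * q ≤ (1 + θ) * t := by
    have : (1 - θ) * q * l ≤ (1 + θ) * t * l := by
      have : (1 + θ) * t * lg ≤ (1 + θ) * t * l := by gcongr
      nlinarith
    exact le_of_mul_le_mul_right this hl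
  have hw : (1 - θ) * (1 - θ) * t ≤ q := by
    have h7 : (1 - θ) * t * ((1 - θ) * l) ≤ (1 - θ) * t * lg := by
      apply mul_le_mul_of_nonneg_left h2
      have : 0 < 1 - θ := by linarith
      positivity
    have : (1 - θ) * (1 - θ) * t * l ≤ q * l := by nlinarith
    exact le_of_mul_le_mul_right this hl
  have hq0 : 0 ≤ q := le_trans (mul_nonneg (mul_self_nonneg _) ht.le) hw
  have a1 : (1 - 5 * θ) * q ≤ (1 - θ) * t := by
    have e1 : (1 - 5 * θ) * ((1 - θ) * q) ≤ (1 - 5 * θ) * ((1 + θ) * t) :=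
      mul_le_mul_of_nonneg_left hu (by linarith)
    have e2 : (1 - 5 * θ) * (1 + θ) * t ≤ (1 - θ) * (1 - θ) * t := by
      apply mul_le_mul_of_nonneg_right _ ht.le
      nlinarith
    have : (1 - θ) * ((1 - 5 * θ) * q) ≤ (1 - θ) * ((1 - θ) * t) := by linarith
    exact le_of_mul_le_mul_left this (by linarith)
  have a2 : (1 + θ) * t ≤ (1 + 5 * θ) * q := by
    have e1 : (1 + 5 * θ) * ((1 - θ) * (1 - θ) * t) ≤ (1 + 5 * θ) * q :=
      mul_le_mul_of_nonneg_left hw (by linarith)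
    have e2 : (1 + θ) * t ≤ (1 + 5 * θ) * ((1 - θ) * (1 - θ)) * t := by
      apply mul_le_mul_of_nonneg_right _ ht.le
      nlinarith [mul_pos hθ hθ, mul_pos hθ (mul_pos hθ hθ), mul_pos hθ (sub_pos.2 hθ1)]
    linarith
  exact ⟨(mul_le_mul_of_nonneg_right a1 hs).trans h5, h6.trans (mul_le_mul_of_nonneg_right a2 hs)⟩

/-- Let `X` be a compact metric space, `μ ≪ lam` Borel probability measures,
and `C` a family of Borel sets such that every compact set can be `β`-approximated in
`lam`-measure by finite disjoint subfamilies of `C` of arbitrarily small diameter. Then for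
every `ε₀ ∈ (0,1)` and `δ > 0` there are finitely many pairwise disjoint `R₁, …, Rₙ ∈ C`
of diameter `< δ`, of positive `μ`- and `lam`-measure, and Borel sets `Gᵢ ⊆ Rᵢ` with:
(1) `μ(⋃ᵢ Rᵢ) > 1 − ε₀`; (2) `μ(Gᵢ) ≥ (1 − ε₀)·μ(Rᵢ)` and `lam(Gᵢ) ≥ (1 − ε₀)·lam(Rᵢ)`;
(3) `(1 − ε₀)·(μ(Rᵢ)/lam(Rᵢ))·lam(S) ≤ μ(S) ≤ (1 + ε₀)·(μ(Rᵢ)/lam(Rᵢ))·lam(S)` for all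
Borel `S ⊆ Gᵢ`; (4) `μ(⋃ᵢ Gᵢ) ≥ 1 − ε₀`. -/
theorem stmt6 {X : Type*} [MetricSpace X] [CompactSpace X]
    [MeasurableSpace X] [BorelSpace X]
    (μ lam : Measure X) [IsProbabilityMeasure μ] [IsProbabilityMeasure lam]
    (habs : μ ≪ lam)
    (C : Set (Set X)) (hC : ∀ c ∈ C, MeasurableSet c)
    (happrox : ∀ K : Set X, IsCompact K → ∀ δ β : ℝ, 0 < δ → 0 < β →
      ∃ S : Finset (Set X), ↑S ⊆ C ∧ (S : Set (Set X)).Pairwise Disjoint ∧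
        (∀ s ∈ S, Metric.diam s < δ) ∧
        (lam (symmDiff K (⋃₀ ↑S))).toReal < β) :
    ∀ ε₀ δ : ℝ, 0 < ε₀ → ε₀ < 1 → 0 < δ →
      ∃ (n : ℕ) (R G : Fin n → Set X),
        (∀ i, R i ∈ C) ∧
        (∀ i j, i ≠ j → Disjoint (R i) (R j)) ∧
        (∀ i, Metric.diam (R i) < δ) ∧
        (∀ i, 0 < μ (R i)) ∧ (∀ i, 0 < lam (R i)) ∧
        (∀ i, MeasurableSet (G i)) ∧ (∀ i, G i ⊆ R i) ∧
        (1 - ε₀ < (μ (⋃ i, R i)).toReal) ∧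
        (∀ i, (1 - ε₀) * (μ (R i)).toReal ≤ (μ (G i)).toReal ∧
              (1 - ε₀) * (lam (R i)).toReal ≤ (lam (G i)).toReal) ∧
        (∀ i, ∀ S : Set X, S ⊆ G i → MeasurableSet S →
          (1 - ε₀) * ((μ (R i)).toReal / (lam (R i)).toReal) * (lam S).toReal ≤
              (μ S).toReal ∧
            (μ S).toReal ≤
              (1 + ε₀) * ((μ (R i)).toReal / (lam (R i)).toReal) * (lam S).toReal) ∧
        (1 - ε₀ ≤ (μ (⋃ i, G i)).toReal) := by
  classical
  intro ε₀ δ hε hε1 hδ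
  obtain ⟨θ, rfl⟩ : ∃ θ, ε₀ = 5 * θ := ⟨ε₀ / 5, by ring⟩
  have hθ : 0 < θ := by linarith
  have hθ1 : θ < 1 / 5 := by linarith
  obtain ⟨K, δ₁, hK, hδ₁, hKμ, hKE⟩ := aux_K μ lam habs θ hθ
  obtain ⟨γ, hγ, hγa⟩ := aux_abs μ lam habs (θ * θ) (by positivity)
  have hKm := hK.measurableSet
  obtain ⟨T, hTC, hTd, hTdiam, hTl⟩ := happrox K hK (min δ δ₁) (θ * γ) (lt_min hδ hδ₁)
    (by positivity)
  change lam.real _ < _ at hTl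
  have hTm : ∀ s ∈ T, MeasurableSet s := fun s hs => hC s (hTC hs)
  set U : Set X := ⋃₀ ↑T with hU
  have hl1 : lam.real (U \ K) < θ * γ :=
    (measureReal_mono (by rw [symmDiff_def]; exact le_sup_right)).trans_lt hTl
  have hl2 : lam.real (K \ U) < θ * γ :=
    (measureReal_mono (by rw [symmDiff_def]; exact le_sup_left)).trans_lt hTl
  have hθγ : θ * γ < γ := by nlinarith
  have hμ1 := hγa _ (hl1.trans hθγ)
  have hμ2 := hγa _ (hl2.trans hθγ)
  -- bad sets
  set B1 := T.filter (fun s => θ * lam.real s < lam.real (s \ K)) with hB1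
  set B2 := T.filter (fun s => θ * μ.real s ≤ μ.real (s \ K)) with hB2
  set F := T.filter (fun s => ¬ (θ * lam.real s < lam.real (s \ K)) ∧
    ¬ (θ * μ.real s ≤ μ.real (s \ K))) with hF
  have hb1 : μ.real (⋃₀ ↑B1) < θ * θ := by
    have h1 := aux_bad lam B1 (hTd.mono (fun _ hz => (Finset.mem_filter.1 (Finset.mem_coe.1 hz)).1))
      (fun b hb => hTm b (Finset.mem_filter.1 hb).1) K hKm θ
      (fun b hb => (Finset.mem_filter.1 hb).2.le)
    have h2 : lam.real (⋃₀ ↑B1 \ K) ≤ lam.real (U \ K) :=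
      measureReal_mono (Set.diff_subset_diff_left (Set.sUnion_subset_sUnion (fun _ hz => (Finset.mem_filter.1 (Finset.mem_coe.1 hz)).1)))
    apply hγa
    have h3 := (h1.trans h2).trans_lt hl1
    exact lt_of_mul_lt_mul_left h3 hθ.le
  have hb2 : μ.real (⋃₀ ↑B2) < θ := by
    have h1 := aux_bad μ B2 (hTd.mono (fun _ hz => (Finset.mem_filter.1 (Finset.mem_coe.1 hz)).1))
      (fun b hb => hTm b (Finset.mem_filter.1 hb).1) K hKm θ
      (fun b hb => (Finset.mem_filter.1 hb).2)
    have h2 : μ.real (⋃₀ ↑B2 \ K) ≤ μ.real (U \ K) :=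
      measureReal_mono (Set.diff_subset_diff_left (Set.sUnion_subset_sUnion (fun _ hz => (Finset.mem_filter.1 (Finset.mem_coe.1 hz)).1)))
    have h3 := (h1.trans h2).trans_lt hμ1
    exact lt_of_mul_lt_mul_left h3 hθ.le
  have hcov : K ⊆ ((⋃₀ ↑F ∩ K) ∪ (K \ U)) ∪ (⋃₀ ↑B1 ∪ ⋃₀ ↑B2) := by
    intro x hx
    by_cases hxU : x ∈ U
    · obtain ⟨s, hs, hxs⟩ := hxU
      have hs' : s ∈ T := hs
      by_cases c1 : θ * lam.real s < lam.real (s \ K)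
      · exact Or.inr (Or.inl ⟨s, by simp [hB1, hs', c1], hxs⟩)
      by_cases c2 : θ * μ.real s ≤ μ.real (s \ K)
      · exact Or.inr (Or.inr ⟨s, by simp [hB2, hs', c2], hxs⟩)
      refine Or.inl (Or.inl ⟨⟨s, ?_, hxs⟩, hx⟩)
      exact Finset.mem_coe.2 (Finset.mem_filter.2 ⟨hs', c1, c2⟩)
    · exact Or.inl (Or.inr ⟨hx, hxU⟩)
  have hmain : 1 - 5 * θ < μ.real (⋃₀ ↑F ∩ K) := by
    have h1 := measureReal_mono (μ := μ) hcov
    have h2 := measureReal_union_le (μ := μ) ((⋃₀ ↑F ∩ K) ∪ (K \ U)) (⋃₀ ↑B1 ∪ ⋃₀ ↑B2)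
    have h3 := measureReal_union_le (μ := μ) (⋃₀ ↑F ∩ K) (K \ U)
    have h4 := measureReal_union_le (μ := μ) (⋃₀ ↑B1) (⋃₀ ↑B2)
    nlinarith
  have hFp : ∀ s ∈ F, s ∈ T ∧ 0 < μ.real s ∧ (1 - θ) * μ.real s ≤ μ.real (s ∩ K) ∧
      (1 - θ) * lam.real s ≤ lam.real (s ∩ K) := by
    intro s hs
    obtain ⟨hsT, c1, c2⟩ := Finset.mem_filter.1 hs
    have e1 := measureReal_inter_add_diff (μ := μ) (s := s) hKm
    have e2 := measureReal_inter_add_diff (μ := lam) (s := s) hKm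
    push Not at c1 c2
    refine ⟨hsT, ?_, by linarith, by linarith⟩
    have : 0 ≤ μ.real (s \ K) := measureReal_nonneg
    by_contra hcon
    nlinarith
  let R : Fin F.card → Set X := fun i => (F.equivFin.symm i : Set X)
  have hR : ∀ i, R i ∈ F := fun i => (F.equivFin.symm i).2
  have hRinj : ∀ i j, i ≠ j → R i ≠ R j := fun i j hij h =>
    hij (F.equivFin.symm.injective (Subtype.ext h))
  have hpos : ∀ i, 0 < μ (R i) := fun i => (ENNReal.toReal_pos_iff.1 (hFp _ (hR i)).2.1).1
  have hlpos : ∀ i, 0 < lam (R i) := fun i => by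
    rw [pos_iff_ne_zero]
    exact fun h => (hpos i).ne' (habs h)
  have hUG : (⋃ i, R i ∩ K) = ⋃₀ ↑F ∩ K := by
    rw [← Set.iUnion_inter]
    congr 1
    ext x
    simp only [Set.mem_iUnion, Set.mem_sUnion]
    constructor
    · rintro ⟨i, hi⟩; exact ⟨R i, hR i, hi⟩
    · rintro ⟨s, hs, hx⟩
      exact ⟨F.equivFin ⟨s, hs⟩, by simpa [R] using hx⟩
  refine ⟨F.card, R, fun i => R i ∩ K, fun i => hTC (hFp _ (hR i)).1,
    fun i j hij => hTd (hFp _ (hR i)).1 (hFp _ (hR j)).1 (hRinj i j hij),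
    fun i => (hTdiam _ (hFp _ (hR i)).1).trans_le (min_le_left _ _), hpos, hlpos,
    fun i => (hTm _ (hFp _ (hR i)).1).inter hKm, fun i => Set.inter_subset_left, ?_, ?_, ?_, ?_⟩
  · change _ < μ.real _
    refine hmain.trans_le ?_
    rw [← hUG]
    exact measureReal_mono (Set.iUnion_mono fun i => Set.inter_subset_left)
  · intro i
    obtain ⟨-, h0, h1, h2⟩ := hFp _ (hR i)
    change _ * μ.real _ ≤ μ.real _ ∧ _ * lam.real _ ≤ lam.real _
    have : 0 ≤ lam.real (R i) := measureReal_nonneg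
    constructor <;> nlinarith
  · intro i S hS hSm
    obtain ⟨hT, h0, h1, h2⟩ := hFp _ (hR i)
    have hne : (R i ∩ K).Nonempty := by
      by_contra hcon
      rw [Set.not_nonempty_iff_eq_empty] at hcon
      rw [hcon] at h1
      simp at h1
      nlinarith
    obtain ⟨t, ht, hts⟩ := hKE (R i ∩ K) Set.inter_subset_right
      ((Metric.diam_mono Set.inter_subset_left Metric.isBounded_of_compactSpace).trans_lt
        ((hTdiam _ hT).trans_le (min_le_right _ _))) hne
    have hg := hts _ subset_rfl ((hTm _ hT).inter hKm)
    have hs := hts S hS hSm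
    exact aux_num θ t (μ.real (R i)) (lam.real (R i)) (μ.real (R i ∩ K)) (lam.real (R i ∩ K))
      (lam.real S) (μ.real S) hθ hθ1 ht (ENNReal.toReal_pos (hlpos i).ne' (measure_ne_top _ _))
      measureReal_nonneg (measureReal_mono Set.inter_subset_left)
      (measureReal_mono Set.inter_subset_left) h1 h2 hg.1 hg.2 hs.1 hs.2
  · change _ ≤ μ.real _
    rw [hUG]
    exact hmain.le
end

section
/- Let ε ∈ (0,1). Let μ be a probability measure on a measurable space X, let R₁, …, Rₙ be pairwise disjoint measurable sets with μ(Rᵢ) > 0 and Σᵢ μ(Rᵢ) ≥ 1 − ε², let λ₁, …, λₙ be probability measures with λᵢ(X ∖ Rᵢ) = 0, and let Gᵢ ⊆ Rᵢ be measurable sets such that for each i and every measurable S ⊆ Gᵢ, (1 − ε²)·λᵢ(S) ≤ μ(S)/μ(Rᵢ) ≤ (1 + ε²)·λᵢ(S). Define G = ⋃ᵢ Gᵢ and λ₀ = (Σᵢ μ(Rᵢ))⁻¹ · Σᵢ μ(Rᵢ)·λᵢ. Then for every measurable set B, (1 − 2ε²)·λ₀(B ∩ G) ≤ μ(B ∩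 G) ≤ (1 + ε²)·λ₀(B ∩ G). -/
open MeasureTheory

/-- The auxiliary measure `λ₀ = (Σᵢ μ(Rᵢ))⁻¹ · Σᵢ μ(Rᵢ)·λᵢ`, the convex combination of the
measures `λᵢ` with weights `μ(Rᵢ)/Σⱼ μ(Rⱼ)`. -/
noncomputable def lamZero {X : Type*} [MeasurableSpace X] (μ : Measure X) {n : ℕ}
    (R : Fin n → Set X) (lam : Fin n → Measure X) : Measure X :=
  (∑ i, μ (R i))⁻¹ • ∑ i, μ (R i) • lam i

/-- Let `μ` be a probability measure, `R₁, …, Rₙ` pairwise disjoint measurable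
sets with `μ(Rᵢ) > 0` and `Σᵢ μ(Rᵢ) ≥ 1 − ε²`, `λᵢ` probability measures concentrated on
`Rᵢ`, and `Gᵢ ⊆ Rᵢ` with `(1 − ε²)·λᵢ(S) ≤ μ(S)/μ(Rᵢ) ≤ (1 + ε²)·λᵢ(S)` for measurable
`S ⊆ Gᵢ`. With `G = ⋃ᵢ Gᵢ` and `λ₀` the convex combination of the `λᵢ`, every measurable
set `B` satisfies `(1 − 2ε²)·λ₀(B ∩ G) ≤ μ(B ∩ G) ≤ (1 + ε²)·λ₀(B ∩ G)`. -/
theorem stmt7 {X : Type*} [MeasurableSpace X] (μ : Measure X) [IsProbabilityMeasure μ]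
    (ε : ℝ) (hε : 0 < ε) (hε1 : ε < 1)
    (n : ℕ) (R : Fin n → Set X) (hRm : ∀ i, MeasurableSet (R i))
    (hdisj : ∀ i j, i ≠ j → Disjoint (R i) (R j))
    (hpos : ∀ i, 0 < μ (R i))
    (hsum : 1 - ε ^ 2 ≤ (∑ i, μ (R i)).toReal)
    (lam : Fin n → Measure X) (hlam : ∀ i, IsProbabilityMeasure (lam i))
    (hconc : ∀ i, lam i ((R i)ᶜ) = 0)
    (G : Fin n → Set X) (hG : ∀ i, MeasurableSet (G i)) (hGR : ∀ i, G i ⊆ R i)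
    (hcomp : ∀ i, ∀ S : Set X, S ⊆ G i → MeasurableSet S →
      (1 - ε ^ 2) * (lam i S).toReal ≤ (μ S).toReal / (μ (R i)).toReal ∧
      (μ S).toReal / (μ (R i)).toReal ≤ (1 + ε ^ 2) * (lam i S).toReal) :
    ∀ B : Set X, MeasurableSet B →
      (1 - 2 * ε ^ 2) * ((lamZero μ R lam) (B ∩ ⋃ i, G i)).toReal ≤
          (μ (B ∩ ⋃ i, G i)).toReal ∧
        (μ (B ∩ ⋃ i, G i)).toReal ≤
          (1 + ε ^ 2) * ((lamZero μ R lam) (B ∩ ⋃ i, G i)).toReal := by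
  intro B hB
  have hRfin : ∀ i, μ (R i) ≠ ⊤ := fun i => measure_ne_top μ _
  have hdG : Pairwise (Function.onFun Disjoint (fun i => B ∩ G i)) := by
    intro i j hij
    exact (hdisj i j hij).mono (Set.inter_subset_right.trans (hGR i))
      (Set.inter_subset_right.trans (hGR j))
  have hm : ∀ i, MeasurableSet (B ∩ G i) := fun i => hB.inter (hG i)
  have hmu : (μ (B ∩ ⋃ i, G i)).toReal = ∑ i, (μ (B ∩ G i)).toReal := by
    rw [Set.inter_iUnion, measure_iUnion hdG hm, tsum_fintype,
      ENNReal.toReal_sum (fun i _ => measure_ne_top μ _)]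
  have hl : ∀ i, lam i (B ∩ ⋃ j, G j) = lam i (B ∩ G i) := by
    intro i
    apply le_antisymm
    · have hsub : (B ∩ ⋃ j, G j) ⊆ (B ∩ G i) ∪ (R i)ᶜ := by
        rintro x ⟨hxB, hx⟩
        obtain ⟨j, hj⟩ := Set.mem_iUnion.1 hx
        by_cases hij : i = j
        · subst hij
          exact Or.inl ⟨hxB, hj⟩
        · exact Or.inr (fun hxi => Set.disjoint_left.1 (hdisj i j hij) hxi (hGR j hj))
      calc lam i (B ∩ ⋃ j, G j) ≤ lam i ((B ∩ G i) ∪ (R i)ᶜ) := measure_mono hsub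
        _ ≤ lam i (B ∩ G i) + lam i ((R i)ᶜ) := measure_union_le _ _
        _ = lam i (B ∩ G i) := by rw [hconc i, add_zero]
    · exact measure_mono (Set.inter_subset_inter_right _ (Set.subset_iUnion G i))
  have hl0 : ((lamZero μ R lam) (B ∩ ⋃ i, G i)).toReal =
      ((∑ i, μ (R i)).toReal)⁻¹ * ∑ i, (μ (R i)).toReal * (lam i (B ∩ G i)).toReal := by
    unfold lamZero
    rw [Measure.smul_apply, Measure.finsetSum_apply, smul_eq_mul, ENNReal.toReal_mul,
      ENNReal.toReal_inv]
    congr 1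
    rw [ENNReal.toReal_sum]
    · refine Finset.sum_congr rfl fun i _ => ?_
      rw [Measure.smul_apply, smul_eq_mul, ENNReal.toReal_mul, hl i]
    · intro i _
      rw [Measure.smul_apply, smul_eq_mul]
      exact ENNReal.mul_ne_top (hRfin i) (measure_ne_top _ _)
  have hs1 : (∑ i, μ (R i)).toReal ≤ 1 := by
    have h : ∑ i, μ (R i) ≤ 1 := by
      have h := measure_iUnion (μ := μ) (fun i j hij => hdisj i j hij) hRm
      rw [tsum_fintype] at h
      rw [← h]
      exact prob_le_one
    exact ENNReal.toReal_le_of_le_ofReal zero_le_one (by simpa using h)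
  have he : ε ^ 2 < 1 := by nlinarith
  set s := (∑ i, μ (R i)).toReal with hs
  set A := ∑ i, (μ (R i)).toReal * (lam i (B ∩ G i)).toReal with hA
  have hA0 : 0 ≤ A := Finset.sum_nonneg fun i _ =>
    mul_nonneg ENNReal.toReal_nonneg ENNReal.toReal_nonneg
  have hs0 : 0 < s := by linarith
  have hr : ∀ i, 0 < (μ (R i)).toReal := fun i => ENNReal.toReal_pos (hpos i).ne' (hRfin i)
  have hlo : (1 - ε ^ 2) * A ≤ (μ (B ∩ ⋃ i, G i)).toReal := by
    rw [hmu, hA, Finset.mul_sum]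
    refine Finset.sum_le_sum fun i _ => ?_
    have h := (hcomp i (B ∩ G i) Set.inter_subset_right (hm i)).1
    rw [le_div_iff₀ (hr i)] at h
    linarith
  have hup : (μ (B ∩ ⋃ i, G i)).toReal ≤ (1 + ε ^ 2) * A := by
    rw [hmu, hA, Finset.mul_sum]
    refine Finset.sum_le_sum fun i _ => ?_
    have h := (hcomp i (B ∩ G i) Set.inter_subset_right (hm i)).2
    rw [div_le_iff₀ (hr i)] at h
    linarith
  rw [hl0]
  have hL0 : 0 ≤ s⁻¹ * A := by positivity
  have hAL : A = s * (s⁻¹ * A) := by field_simp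
  generalize s⁻¹ * A = L at hL0 hAL ⊢
  constructor
  · refine le_trans ?_ hlo
    rw [hAL, ← mul_assoc (1 - ε ^ 2)]
    refine mul_le_mul_of_nonneg_right ?_ hL0
    nlinarith [sq_nonneg (ε ^ 2)]
  · refine hup.trans (mul_le_mul_of_nonneg_left ?_ (by positivity))
    rw [hAL]
    nlinarith
end

section
/- Let μ be a σ-invariant Borel probability measure on Σ_T and ξ a finite Borel partition of Σ_T with the small-boundary property with constant C₀. Assume the K-mixing hypothesis for ξ holds, and assume that for every η ∈ (0,1) and every δ' > 0 there exists a regular covering at scale η by rectangles, each rectangle of diameter less than δ', in which every λᵢ is a non-atomic product measure. Then ξ is Very Weak Bernoulli: for every ε > 0 there exists N₀ ∈ ℕ such that for all m₂ ≥ m₁ ≥ N₀ and every n ≥ 1, for ε-almost every atom E of ⋁_{j=m₁}^{m₂} σ^j ξ, the infimum over all couplings λ of (E, μ|_E) and (Σ_T, μ) of ∫ h_n dλ is at most ε, where h_n(x,y) = (1/n)·#{1 ≤ i ≤ n : ℓ(σ^i x) ≠ ℓ(σ^i y)}. -/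
open MeasureTheory Set

namespace Subshift

variable {q k : ℕ} (T : Fin q → Fin q → Prop)

/-- The inverse shift map `(σ⁻¹x)_i = x_{i-1}`. -/
def shiftInv (x : SigmaT T) : SigmaT T :=
  ⟨fun i => x.1 (i - 1), fun i => by
    have h := x.2 (i - 1)
    have e1 : i - 1 + 1 = i := by ring
    have e2 : i + 1 - 1 = i := by ring
    show T (x.1 (i - 1)) (x.1 (i + 1 - 1))
    rw [e1] at h
    rw [e2]
    exact h⟩

open Classical in
/-- The metric `d(x,y) = 2^{−k}` where `k` is the largest integer such that `x_i = y_i`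
for all `|i| < k` (and `d(x,y) = 0` iff `x = y`). -/
noncomputable def sdist (x y : SigmaT T) : ℝ :=
  if x = y then 0
  else (2 : ℝ) ^ (-((sSup {m : ℕ | ∀ i : ℤ, |i| < (m : ℤ) → x.1 i = y.1 i} : ℕ) : ℤ))

/-- The local stable set `W^s_loc(x) = {y : y_i = x_i for all i ≥ 0}`. -/
def Ws (x : SigmaT T) : Set (SigmaT T) := {y | ∀ i : ℤ, 0 ≤ i → y.1 i = x.1 i}

/-- The local unstable set `W^u_loc(x) = {y : y_i = x_i for all i ≤ 0}`. -/
def Wu (x : SigmaT T) : Set (SigmaT T) := {y | ∀ i : ℤ, i ≤ 0 → y.1 i = x.1 i}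

/-- A rectangle: a subset of a 1-cylinder `[c]` closed under combining futures of one
point with pasts of another. -/
def IsRectangle (R : Set (SigmaT T)) : Prop :=
  ∃ c : Fin q, R ⊆ {x : SigmaT T | x.1 0 = c} ∧
    ∀ x ∈ R, ∀ y ∈ R, ∀ z : SigmaT T,
      (∀ j : ℤ, 0 ≤ j → z.1 j = x.1 j) → (∀ j : ℤ, j ≤ 0 → z.1 j = y.1 j) → z ∈ R

/-- `A` intersects the rectangle `R` layerwise: for every `x ∈ A ∩ R`,
`W^u_loc(x) ∩ R ⊆ A`. -/
def LayerwiseIn (A R : Set (SigmaT T)) : Prop :=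
  ∀ x ∈ A ∩ R, Wu T x ∩ R ⊆ A

/-- The atom of the join `⋁_{j=m₁}^{m₂} σ^j ξ` determined by the labels `a`, for the
finite partition `ξ` with labeling map `ℓ`. -/
def joinAtom (ℓ : SigmaT T → Fin k) (m₁ m₂ : ℕ) (a : ℕ → Fin k) : Set (SigmaT T) :=
  {x | ∀ j : ℕ, m₁ ≤ j → j ≤ m₂ → ℓ ((shiftInv T)^[j] x) = a j}

/-- A property `P` holds for `ε`-almost every atom of the join `⋁_{j=m₁}^{m₂} σ^j ξ`:
the union of the (nonempty) atoms failing `P` has `μ`-measure at most `ε`. -/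
def AeAtoms (μ : Measure (SigmaT T)) (ℓ : SigmaT T → Fin k) (m₁ m₂ : ℕ) (ε : ℝ)
    (P : Set (SigmaT T) → Prop) : Prop :=
  (μ (⋃ a ∈ {a : ℕ → Fin k | (joinAtom T ℓ m₁ m₂ a).Nonempty ∧
      ¬P (joinAtom T ℓ m₁ m₂ a)}, joinAtom T ℓ m₁ m₂ a)).toReal ≤ ε

/-- The union of the topological boundaries of the atoms of the partition given by `ℓ`. -/
def partitionBoundary (ℓ : SigmaT T → Fin k) : Set (SigmaT T) :=
  ⋃ a : Fin k, frontier (ℓ ⁻¹' {a})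

/-- The small-boundary property with constant `C₀`:
`μ(B(∂ξ, r)) ≤ C₀·r` for every `r > 0`. -/
def SmallBoundary (μ : Measure (SigmaT T)) (ℓ : SigmaT T → Fin k) (C₀ : ℝ) : Prop :=
  0 < C₀ ∧ ∀ r : ℝ, 0 < r →
    (μ {x | ∃ y ∈ partitionBoundary T ℓ, sdist T x y < r}).toReal ≤ C₀ * r

/-- The K-mixing hypothesis for the partition given by `ℓ`: for every `ε' > 0` and every
finite collection of Borel sets, atoms of `⋁_{j=m₁}^{m₂} σ^j ξ` with `m₁` large
equidistribute the sets up to `ε'`, except for atoms of total measure `ε'`. -/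
def KMixing (μ : Measure (SigmaT T)) (ℓ : SigmaT T → Fin k) : Prop :=
  ∀ ε' : ℝ, 0 < ε' → ∀ (m : ℕ) (A : Fin m → Set (SigmaT T)),
    (∀ i, MeasurableSet (A i)) →
    ∃ N : ℕ, ∀ m₁ m₂ : ℕ, N ≤ m₁ → m₁ ≤ m₂ →
      AeAtoms T μ ℓ m₁ m₂ ε' fun E =>
        ∀ i, |(μ (E ∩ A i)).toReal / (μ E).toReal - (μ (A i)).toReal| ≤ ε'

/-- A regular covering at scale `η` by rectangles: pairwise disjoint rectangles `Rᵢ` of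
positive `μ`-measure, probability measures `λᵢ` concentrated on `Rᵢ`, and Borel sets
`Gᵢ ⊆ Rᵢ` satisfying the measure estimates of an `η`-regular covering. -/
def IsRegularCovering (μ : Measure (SigmaT T)) (η : ℝ) {n : ℕ}
    (R : Fin n → Set (SigmaT T)) (lam : Fin n → Measure (SigmaT T))
    (G : Fin n → Set (SigmaT T)) : Prop :=
  (∀ i, IsRectangle T (R i)) ∧ (∀ i, MeasurableSet (R i)) ∧
  (∀ i j, i ≠ j → Disjoint (R i) (R j)) ∧
  (∀ i, 0 < μ (R i)) ∧
  (∀ i, IsProbabilityMeasure (lam i)) ∧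
  (∀ i, lam i ((R i)ᶜ) = 0) ∧
  (∀ i, MeasurableSet (G i)) ∧ (∀ i, G i ⊆ R i) ∧
  (1 - η < (μ (⋃ i, R i)).toReal) ∧
  (∀ i, (1 - η) * (μ (R i)).toReal ≤ (μ (G i)).toReal) ∧
  (∀ i, 1 - η ≤ (lam i (G i)).toReal) ∧
  (∀ i, ∀ S : Set (SigmaT T), S ⊆ G i → MeasurableSet S →
      (1 - η) * (lam i S).toReal ≤ (μ S).toReal / (μ (R i)).toReal ∧
      (μ S).toReal / (μ (R i)).toReal ≤ (1 + η) * (lam i S).toReal) ∧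
  (1 - η ≤ (μ (⋃ i, G i)).toReal)

/-- The auxiliary measure `λ₀ = (Σᵢ μ(Rᵢ))⁻¹ · Σᵢ μ(Rᵢ)·λᵢ`. -/
noncomputable def lamZero (μ : Measure (SigmaT T)) {n : ℕ}
    (R : Fin n → Set (SigmaT T)) (lam : Fin n → Measure (SigmaT T)) :
    Measure (SigmaT T) :=
  (∑ i, μ (R i))⁻¹ • ∑ i, μ (R i) • lam i

/-- The bijection `x ↦ (x⁻, x⁺)` sending a point to its past `(x_j)_{j ≤ 0}` and its
future `(x_j)_{j ≥ 0}`. -/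
def pastFuture (x : SigmaT T) :
    ({j : ℤ // j ≤ 0} → Fin q) × ({j : ℤ // 0 ≤ j} → Fin q) :=
  (fun j => x.1 j.1, fun j => x.1 j.1)

/-- `lam` is a non-atomic product measure on the rectangle `R`: under `x ↦ (x⁻, x⁺)`, `R`
corresponds to a product set `S × U` and the pushforward of `lam` is a product `ρ × ν` of
two non-atomic Borel probability measures. -/
def IsNonatomicProduct (lam : Measure (SigmaT T)) (R : Set (SigmaT T)) : Prop :=
  ∃ (S : Set ({j : ℤ // j ≤ 0} → Fin q)) (U : Set ({j : ℤ // 0 ≤ j} → Fin q))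
    (ρ : Measure ({j : ℤ // j ≤ 0} → Fin q)) (ν : Measure ({j : ℤ // 0 ≤ j} → Fin q)),
    IsProbabilityMeasure ρ ∧ IsProbabilityMeasure ν ∧
    (∀ p, ρ {p} = 0) ∧ (∀ u, ν {u} = 0) ∧
    pastFuture T '' R = S ×ˢ U ∧
    lam.map (pastFuture T) = ρ.prod ν

/-- The normalized restriction `μ|_E(S) = μ(S ∩ E)/μ(E)`. -/
noncomputable def normRestrict {X : Type*} [MeasurableSpace X]
    (μ : Measure X) (E : Set X) : Measure X :=
  (μ E)⁻¹ • μ.restrict E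

/-- `θ` is `ε`-measure-preserving from `(dom, μ)` to `ν`: there is a measurable
`G' ⊆ dom` with `μ(G') > 1 − ε` such that `θ(A)` is measurable and
`(1−ε)·μ(A) ≤ ν(θ(A)) ≤ (1+ε)·μ(A)` for every measurable `A ⊆ G'`. -/
def IsEpsMP {X Y : Type*} [MeasurableSpace X] [MeasurableSpace Y] (ε : ℝ)
    (μ : Measure X) (ν : Measure Y) (dom : Set X) (θ : X → Y) : Prop :=
  ∃ G' : Set X, G' ⊆ dom ∧ MeasurableSet G' ∧ 1 - ε < (μ G').toReal ∧
    ∀ A : Set X, A ⊆ G' → MeasurableSet A →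
      MeasurableSet (θ '' A) ∧
      (1 - ε) * (μ A).toReal ≤ (ν (θ '' A)).toReal ∧
      (ν (θ '' A)).toReal ≤ (1 + ε) * (μ A).toReal

/-- `h_n(x,y) = (1/n)·#{1 ≤ i ≤ n : ℓ(fⁱx) ≠ ℓ(fⁱy)}`. -/
noncomputable def hFreq {X : Type*} (ℓ : X → Fin k) (f : X → X) (n : ℕ) (x y : X) : ℝ :=
  (n : ℝ)⁻¹ *
    (((Finset.Icc 1 n).filter fun i => ℓ (f^[i] x) ≠ ℓ (f^[i] y)).card : ℝ)

end Subshift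

namespace VWB
open Finset

/-- coupling closeness of two mass functions -/
def Cl {A B : Type*} [Fintype A] [Fintype B] (c : A → B → ℝ) (p : A → ℝ) (q : B → ℝ)
    (e : ℝ) : Prop :=
  ∃ π : A → B → ℝ, (∀ a b, 0 ≤ π a b) ∧ (∀ a, ∑ b, π a b = p a) ∧
    (∀ b, ∑ a, π a b = q b) ∧ ∑ a, ∑ b, π a b * c a b ≤ e

section Coup
variable {A B C S : Type*} [Fintype A] [Fintype B] [Fintype C] [Fintype S]

lemma Cl.trans {c₁ : A → B → ℝ} {c₂ : B → C → ℝ} {c₃ : A → C → ℝ} {p : A → ℝ} {q : B → ℝ}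
    {r : C → ℝ} {e₁ e₂ : ℝ} (h₁ : Cl c₁ p q e₁) (h₂ : Cl c₂ q r e₂)
    (hc : ∀ a b d, c₃ a d ≤ c₁ a b + c₂ b d) : Cl c₃ p r (e₁ + e₂) := by
  obtain ⟨π₁, n₁, l₁, r₁, k₁⟩ := h₁
  obtain ⟨π₂, n₂, l₂, r₂, k₂⟩ := h₂
  have hq : ∀ b, 0 ≤ q b := fun b => by rw [← r₁ b]; exact sum_nonneg fun a _ => n₁ a b
  have z₁ : ∀ a b, q b = 0 → π₁ a b = 0 := fun a b h => by
    rw [← r₁ b] at h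
    exact (sum_eq_zero_iff_of_nonneg fun a _ => n₁ a b).1 h a (Finset.mem_univ _)
  have z₂ : ∀ b d, q b = 0 → π₂ b d = 0 := fun b d h => by
    rw [← l₂ b] at h
    exact (sum_eq_zero_iff_of_nonneg fun d _ => n₂ b d).1 h d (Finset.mem_univ _)
  have s₁ : ∀ a b, ∑ d, π₁ a b * π₂ b d / q b = π₁ a b := fun a b => by
    rw [← sum_div, ← mul_sum, l₂]
    by_cases h : q b = 0
    · simp [h, z₁ a b h]
    · field_simp
  have s₂ : ∀ b d, ∑ a, π₁ a b * π₂ b d / q b = π₂ b d := fun b d => by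
    rw [← sum_div, ← sum_mul, r₁]
    by_cases h : q b = 0
    · simp [h, z₂ b d h]
    · field_simp
  have hn : ∀ a b d, 0 ≤ π₁ a b * π₂ b d / q b := fun a b d =>
    div_nonneg (mul_nonneg (n₁ a b) (n₂ b d)) (hq b)
  refine ⟨fun a d => ∑ b, π₁ a b * π₂ b d / q b, fun a d => sum_nonneg fun b _ => hn a b d,
    fun a => ?_, fun d => ?_, ?_⟩
  · rw [sum_comm]; simp_rw [s₁, l₁]
  · rw [sum_comm]; simp_rw [s₂, r₂]
  · calc ∑ a, ∑ d, (∑ b, π₁ a b * π₂ b d / q b) * c₃ a d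
        ≤ ∑ a, ∑ d, ∑ b, (π₁ a b * π₂ b d / q b * c₁ a b + π₁ a b * π₂ b d / q b * c₂ b d) := by
          refine sum_le_sum fun a _ => sum_le_sum fun d _ => ?_
          rw [sum_mul]
          refine sum_le_sum fun b _ => ?_
          rw [← mul_add]
          exact mul_le_mul_of_nonneg_left (hc a b d) (hn a b d)
      _ = ∑ a, ∑ b, π₁ a b * c₁ a b + ∑ b, ∑ d, π₂ b d * c₂ b d := by
          simp_rw [sum_add_distrib]
          congr 1
          · refine sum_congr rfl fun a _ => ?_
            rw [sum_comm]
            refine sum_congr rfl fun b _ => ?_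
            rw [← sum_mul, s₁]
          · rw [sum_comm' (t' := Finset.univ) (s' := fun _ => Finset.univ) (by simp)]
            rw [sum_comm' (t' := Finset.univ) (s' := fun _ => Finset.univ) (by simp)]
            have : ∀ a, ∑ d, ∑ b, π₁ a b * π₂ b d / q b * c₂ b d
              = ∑ b, ∑ d, π₁ a b * π₂ b d / q b * c₂ b d := fun a => sum_comm
            simp_rw [this]
            rw [sum_comm]
            refine sum_congr rfl fun b _ => ?_
            rw [sum_comm]
            refine sum_congr rfl fun d _ => ?_
            rw [← sum_mul, s₂]
      _ ≤ e₁ + e₂ := add_le_add k₁ k₂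

lemma Cl.mono {c c' : A → B → ℝ} {p : A → ℝ} {q : B → ℝ} {e e' : ℝ} (h : Cl c p q e)
    (hc : ∀ a b, c' a b ≤ c a b) (he : e ≤ e') : Cl c' p q e' := by
  obtain ⟨π, n, l, r, k⟩ := h
  exact ⟨π, n, l, r, (sum_le_sum fun a _ => sum_le_sum fun b _ =>
    mul_le_mul_of_nonneg_left (hc a b) (n a b)).trans (k.trans he)⟩

lemma Cl.symm {c : A → B → ℝ} {p : A → ℝ} {q : B → ℝ} {e : ℝ} (h : Cl c p q e) :
    Cl (fun b a => c a b) q p e := by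
  obtain ⟨π, n, l, r, k⟩ := h
  exact ⟨fun b a => π a b, fun b a => n a b, r, l, by rw [sum_comm]; exact k⟩

lemma Cl.nonneg {c : A → B → ℝ} {p : A → ℝ} {q : B → ℝ} {e : ℝ} (h : Cl c p q e)
    (hc : ∀ a b, 0 ≤ c a b) : 0 ≤ e := by
  obtain ⟨π, n, l, r, k⟩ := h
  exact le_trans (sum_nonneg fun a _ => sum_nonneg fun b _ => mul_nonneg (n a b) (hc a b)) k

lemma Cl.sum {ι : Type*} (s : Finset ι) {c : A → B → ℝ} {p : ι → A → ℝ} {q : ι → B → ℝ}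
    {e : ι → ℝ} (h : ∀ i, Cl c (p i) (q i) (e i)) :
    Cl c (fun a => ∑ i ∈ s, p i a) (fun b => ∑ i ∈ s, q i b) (∑ i ∈ s, e i) := by
  choose π n l r k using h
  refine ⟨fun a b => ∑ i ∈ s, π i a b, fun a b => sum_nonneg fun i _ => n i a b,
    fun a => ?_, fun b => ?_, ?_⟩
  · rw [sum_comm]; simp_rw [l]
  · rw [sum_comm]; simp_rw [r]
  · refine le_trans (le_of_eq ?_) (sum_le_sum fun i _ => k i)
    rw [sum_comm (s := s)]
    simp_rw [sum_mul]
    refine sum_congr rfl fun a _ => ?_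
    rw [sum_comm]

lemma Cl.smul {c : A → B → ℝ} {p : A → ℝ} {q : B → ℝ} {e : ℝ} (h : Cl c p q e) {r : ℝ}
    (hr : 0 ≤ r) : Cl c (fun a => r * p a) (fun b => r * q b) (r * e) := by
  obtain ⟨π, n, l, r', k⟩ := h
  refine ⟨fun a b => r * π a b, fun a b => mul_nonneg hr (n a b), fun a => ?_, fun b => ?_, ?_⟩
  · rw [← mul_sum, l]
  · rw [← mul_sum, r']
  · simp_rw [mul_assoc, ← mul_sum]; exact mul_le_mul_of_nonneg_left k hr

lemma Cl.equiv {A' B' : Type*} [Fintype A'] [Fintype B'] {c : A → B → ℝ} {p : A → ℝ} {q : B → ℝ}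
    {e : ℝ} (h : Cl c p q e) (f : A' ≃ A) (g : B' ≃ B) :
    Cl (fun a b => c (f a) (g b)) (fun a => p (f a)) (fun b => q (g b)) e := by
  obtain ⟨π, n, l, r, k⟩ := h
  refine ⟨fun a b => π (f a) (g b), fun a b => n _ _, fun a => ?_, fun b => ?_, ?_⟩
  · rw [g.sum_comp (fun b => π (f a) b), l]
  · rw [f.sum_comp (fun a => π a (g b)), r]
  · refine le_trans (le_of_eq ?_) k
    rw [← f.sum_comp]
    refine sum_congr rfl fun a _ => ?_
    rw [← g.sum_comp]

open Classical in
lemma Cl.slice {c : S → A → B → ℝ} {p : S → A → ℝ} {q : S → B → ℝ} {e : S → ℝ}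
    {c' : S × A → S × B → ℝ}
    (h : ∀ s, Cl (c s) (p s) (q s) (e s)) (hc : ∀ s a b, c' (s, a) (s, b) ≤ c s a b) :
    Cl c' (fun x => p x.1 x.2) (fun x => q x.1 x.2) (∑ s, e s) := by
  choose π n l r k using h
  refine ⟨fun x y => if x.1 = y.1 then π x.1 x.2 y.2 else 0, fun x y => ?_,
    fun x => ?_, fun y => ?_, ?_⟩
  · dsimp only; split_ifs; exacts [n _ _ _, le_rfl]
  · rw [Fintype.sum_prod_type]
    rw [sum_eq_single x.1]
    · simp [l]
    · intro s _ hs; simp [hs.symm]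
    · simp
  · rw [Fintype.sum_prod_type]
    rw [sum_eq_single y.1]
    · simp [r]
    · intro s _ hs; simp [hs]
    · simp
  · rw [Fintype.sum_prod_type]
    refine sum_le_sum fun s _ => le_trans ?_ (k s)
    refine sum_le_sum fun a _ => ?_
    rw [Fintype.sum_prod_type, sum_eq_single s]
    · refine sum_le_sum fun b _ => ?_
      simp only [if_true]
      exact mul_le_mul_of_nonneg_left (hc _ _ _) (n _ _ _)
    · intro s' _ hs; simp [hs.symm]
    · simp

lemma Cl.slice' {c : S → A → B → ℝ} {p : S → A → ℝ} {q : S → B → ℝ} {e : S → ℝ}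
    {c' : A × S → B × S → ℝ}
    (h : ∀ s, Cl (c s) (p s) (q s) (e s)) (hc : ∀ s a b, c' (a, s) (b, s) ≤ c s a b) :
    Cl c' (fun x => p x.2 x.1) (fun x => q x.2 x.1) (∑ s, e s) :=
  (Cl.slice (c' := fun x y => c' x.swap y.swap) h hc).equiv
    (Equiv.prodComm A S) (Equiv.prodComm B S)

open Classical in
lemma Cl.tv {c : A → A → ℝ} {p q : A → ℝ} (hp : ∀ a, 0 ≤ p a) (hq : ∀ a, 0 ≤ q a)
    (hpq : ∑ a, p a = ∑ a, q a) (hc0 : ∀ a, c a a = 0) (hc1 : ∀ a b, c a b ≤ 1) :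
    Cl c p q (∑ a, |p a - q a|) := by
  set P : A → ℝ := fun a => max (p a - q a) 0
  set Q : A → ℝ := fun a => max (q a - p a) 0
  have hP : ∀ a, 0 ≤ P a := fun a => le_max_right _ _
  have hQ : ∀ a, 0 ≤ Q a := fun a => le_max_right _ _
  have hPQ : ∀ a, P a - Q a = p a - q a := fun a => by
    simp only [P, Q]; rcases le_total (p a) (q a) with h | h
    · rw [max_eq_right (by linarith), max_eq_left (by linarith)]; ring
    · rw [max_eq_left (by linarith), max_eq_right (by linarith)]; ring
  have hle : ∀ a, P a ≤ |p a - q a| := fun a => max_le (le_abs_self _) (abs_nonneg _)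
  have hmin : ∀ a, min (p a) (q a) + P a = p a := fun a => by
    simp only [P]; rcases le_total (p a) (q a) with h | h
    · rw [max_eq_right (by linarith), min_eq_left h]; ring
    · rw [max_eq_left (by linarith), min_eq_right h]; ring
  have hmin' : ∀ a, min (p a) (q a) + Q a = q a := fun a => by
    linarith [hmin a, hPQ a]
  set t := ∑ a, P a with ht
  have ht' : ∑ a, Q a = t := by
    have : ∑ a, (P a - Q a) = 0 := by simp_rw [hPQ, sum_sub_distrib]; linarith
    rw [sum_sub_distrib] at this; linarith
  have ht0 : 0 ≤ t := sum_nonneg fun a _ => hP a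
  have zP : ∀ a, t = 0 → P a = 0 := fun a h =>
    (sum_eq_zero_iff_of_nonneg fun a _ => hP a).1 h a (Finset.mem_univ _)
  have zQ : ∀ a, t = 0 → Q a = 0 := fun a h =>
    (sum_eq_zero_iff_of_nonneg fun a _ => hQ a).1 (ht'.trans h) a (Finset.mem_univ _)
  have s1 : ∀ a, ∑ b, P a * Q b / t = P a := fun a => by
    rw [← sum_div, ← mul_sum, ht']
    by_cases h : t = 0
    · simp [h, zP a h]
    · field_simp
  have s2 : ∀ b, ∑ a, P a * Q b / t = Q b := fun b => by
    rw [← sum_div, ← sum_mul, ← ht]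
    by_cases h : t = 0
    · simp [h, zQ b h]
    · field_simp
  have n2 : ∀ a b, 0 ≤ P a * Q b / t := fun a b => div_nonneg (mul_nonneg (hP a) (hQ b)) ht0
  refine ⟨fun a b => (if a = b then min (p a) (q a) else 0) + P a * Q b / t, fun a b => ?_,
    fun a => ?_, fun b => ?_, ?_⟩
  · have := n2 a b
    dsimp only
    split_ifs
    · linarith [le_min (hp a) (hq a)]
    · linarith
  · rw [sum_add_distrib, s1]; simp [hmin]
  · rw [sum_add_distrib, s2]; simp [hmin']
  · calc _ ≤ ∑ a, ∑ b, P a * Q b / t := by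
          refine sum_le_sum fun a _ => sum_le_sum fun b _ => ?_
          by_cases h : a = b
          · subst h; simp [hc0]; exact n2 a a
          · simp only [h, if_false, zero_add]
            exact mul_le_of_le_one_right (n2 a b) (hc1 a b)
      _ ≤ _ := by simp_rw [s1]; exact sum_le_sum fun a _ => hle a

end Coup

/-! ### information -/
section Info
variable {A B C S : Type*} [Fintype A] [Fintype B] [Fintype C] [Fintype S]

/-- mutual information -/
noncomputable def MI (P : S → A → ℝ) : ℝ :=
  ∑ s, ∑ a, P s a * (Real.log (P s a) - Real.log (∑ a', P s a') - Real.log (∑ s', P s' a))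

lemma gibbs_pt {p q : ℝ} (hp : 0 ≤ p) (hq : 0 ≤ q) (h : q = 0 → p = 0) :
    p - q + (√p - √q) ^ 2 ≤ p * (Real.log p - Real.log q) := by
  rcases hq.eq_or_lt with rfl | hq'
  · simp [h rfl]
  rcases hp.eq_or_lt with rfl | hp'
  · simp [Real.sq_sqrt hq]
  have h1 : Real.log (√q / √p) ≤ √q / √p - 1 := Real.log_le_sub_one_of_pos (by positivity)
  rw [Real.log_div (by positivity) (by positivity), Real.log_sqrt hq, Real.log_sqrt hp] at h1
  have h2 : p * (√q / √p) = √p * √q := by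
    rw [mul_div_assoc', div_eq_iff (by positivity)]
    linear_combination (-√q) * Real.mul_self_sqrt hp
  have h3 : p * (Real.log q / 2 - Real.log p / 2) ≤ p * (√q / √p - 1) :=
    mul_le_mul_of_nonneg_left h1 hp
  nlinarith [Real.sq_sqrt hp, Real.sq_sqrt hq]

lemma abs_pt {p q t : ℝ} (hp : 0 ≤ p) (hq : 0 ≤ q) (ht : 0 < t) :
    |p - q| ≤ (√p - √q) ^ 2 / t + t * (p + q) / 2 := by
  have h1 : |p - q| = |√p - √q| * (√p + √q) := by
    rw [← abs_of_nonneg (a := √p + √q) (by positivity), ← abs_mul]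
    congr 1
    nlinarith [Real.sq_sqrt hp, Real.sq_sqrt hq]
  rw [h1, ← sq_abs (√p - √q)]
  set u := |√p - √q|
  have h2 : (√p + √q) ^ 2 ≤ 2 * (p + q) := by
    nlinarith [Real.sq_sqrt hp, Real.sq_sqrt hq, sq_nonneg (√p - √q)]
  have h3 : u * (√p + √q) ≤ u ^ 2 / t + t * (√p + √q) ^ 2 / 4 := by
    have : u ^ 2 / t + t * (√p + √q) ^ 2 / 4 - u * (√p + √q)
      = (u - t * (√p + √q) / 2) ^ 2 / t := by field_simp; ring
    have h4 : 0 ≤ (u - t * (√p + √q) / 2) ^ 2 / t := by positivity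
    linarith
  nlinarith

lemma MI_abs {P : S → A → ℝ} (hP : ∀ s a, 0 ≤ P s a) {s : S} {a : A}
    (h : (∑ a', P s a') * (∑ s', P s' a) = 0) : P s a = 0 := by
  rcases mul_eq_zero.1 h with h | h
  · exact (sum_eq_zero_iff_of_nonneg fun a _ => hP s a).1 h a (Finset.mem_univ _)
  · exact (sum_eq_zero_iff_of_nonneg fun s _ => hP s a).1 h s (Finset.mem_univ _)

lemma MI_hell {P : S → A → ℝ} (hP : ∀ s a, 0 ≤ P s a) (h1 : ∑ s, ∑ a, P s a = 1) :
    ∑ s, ∑ a, (√(P s a) - √((∑ a', P s a') * (∑ s', P s' a))) ^ 2 ≤ MI P := by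
  have key : ∀ s a, P s a - (∑ a', P s a') * (∑ s', P s' a) +
      (√(P s a) - √((∑ a', P s a') * (∑ s', P s' a))) ^ 2 ≤
      P s a * (Real.log (P s a) - Real.log (∑ a', P s a') - Real.log (∑ s', P s' a)) := by
    intro s a
    have hs : 0 ≤ ∑ a', P s a' := sum_nonneg fun a _ => hP s a
    have ha : 0 ≤ ∑ s', P s' a := sum_nonneg fun s _ => hP s a
    have := gibbs_pt (hP s a) (mul_nonneg hs ha) (fun h => MI_abs hP h)
    by_cases h : (∑ a', P s a') * (∑ s', P s' a) = 0
    · rw [MI_abs hP h] at this ⊢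
      simpa using this
    · rw [Real.log_mul (left_ne_zero_of_mul h) (right_ne_zero_of_mul h)] at this
      linarith
  have := sum_le_sum fun s (_ : s ∈ Finset.univ) => sum_le_sum fun a (_ : a ∈ Finset.univ) => key s a
  simp only [sum_add_distrib, sum_sub_distrib] at this
  have h2 : ∑ s, ∑ a, (∑ a', P s a') * (∑ s', P s' a) = 1 := by
    simp_rw [← mul_sum, ← sum_mul]
    rw [sum_comm (f := fun a s' => P s' a), h1]; ring
  rw [h1, h2] at this
  unfold MI
  simp only [sub_self, zero_add] at this
  exact this

lemma MI_nonneg {P : S → A → ℝ} (hP : ∀ s a, 0 ≤ P s a) (h1 : ∑ s, ∑ a, P s a = 1) :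
    0 ≤ MI P :=
  le_trans (sum_nonneg fun s _ => sum_nonneg fun a _ => sq_nonneg _) (MI_hell hP h1)

lemma pinsker {P : S → A → ℝ} (hP : ∀ s a, 0 ≤ P s a) (h1 : ∑ s, ∑ a, P s a = 1)
    {t : ℝ} (ht : 0 < t) :
    ∑ s, ∑ a, |P s a - (∑ a', P s a') * (∑ s', P s' a)| ≤ t + MI P / t := by
  have h2 : ∑ s, ∑ a, (∑ a', P s a') * (∑ s', P s' a) = 1 := by
    simp_rw [← mul_sum, ← sum_mul]
    rw [sum_comm (f := fun a s' => P s' a), h1]; ring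
  have h3 := MI_hell hP h1
  have h4 : ∀ s a, 0 ≤ (∑ a', P s a') * (∑ s', P s' a) := fun s a =>
    mul_nonneg (sum_nonneg fun a _ => hP s a) (sum_nonneg fun s _ => hP s a)
  generalize hQ : (fun s a => (∑ a', P s a') * (∑ s', P s' a)) = Q
  have hQ' : ∀ s a, (∑ a', P s a') * (∑ s', P s' a) = Q s a := fun s a => by rw [← hQ]
  simp only [hQ'] at h2 h3 h4 ⊢
  calc _ ≤ ∑ s, ∑ a, ((√(P s a) - √(Q s a)) ^ 2 / t + t * (P s a + Q s a) / 2) :=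
        sum_le_sum fun s _ => sum_le_sum fun a _ => abs_pt (hP s a) (h4 s a) ht
    _ = (∑ s, ∑ a, (√(P s a) - √(Q s a)) ^ 2) / t + t := by
        simp only [sum_add_distrib, ← sum_div, ← mul_sum, h1, h2]
        ring
    _ ≤ _ := by
        have := div_le_div_of_nonneg_right h3 ht.le
        linarith

end Info
end VWB

namespace VWB
open Finset

section Info2
variable {A B C S : Type*} [Fintype A] [Fintype B] [Fintype C] [Fintype S]

lemma MI_equiv {A' : Type*} [Fintype A'] (P : S → A → ℝ) (f : A' ≃ A) :
    MI (fun s a => P s (f a)) = MI P := by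
  unfold MI
  refine sum_congr rfl fun s _ => ?_
  rw [← f.sum_comp]
  refine sum_congr rfl fun a _ => ?_
  rw [f.sum_comp (fun a' => P s a')]

lemma MI_chain {P : S → A × C → ℝ} (hP : ∀ s x, 0 ≤ P s x) {p : A → ℝ} {r : C → ℝ}
    (hp1 : ∑ a, p a = 1) (hr1 : ∑ u, r u = 1) (hm : ∀ a u, ∑ s, P s (a, u) = p a * r u) :
    MI P = MI (fun s a => ∑ u, P s (a, u)) + MI (fun (x : S × A) u => P x.1 (x.2, u)) := by
  unfold MI
  simp only [Fintype.sum_prod_type]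
  rw [← sum_add_distrib]
  refine sum_congr rfl fun s _ => ?_
  rw [← sum_add_distrib]
  refine sum_congr rfl fun a _ => ?_
  rw [sum_mul, ← sum_add_distrib]
  refine sum_congr rfl fun u _ => ?_
  have e1 : ∑ s', ∑ u', P s' (a, u') = p a := by
    rw [sum_comm]; simp_rw [hm, ← mul_sum, hr1, mul_one]
  have e2 : ∑ s', ∑ a', P s' (a', u) = r u := by
    rw [sum_comm]; simp_rw [hm, ← sum_mul, hp1, one_mul]
  rw [hm, e1, e2]
  by_cases h : P s (a, u) = 0
  · simp [h]
  · have : p a * r u ≠ 0 := by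
      rw [← hm]
      intro h'
      exact h ((sum_eq_zero_iff_of_nonneg fun s _ => hP s _).1 h' s (Finset.mem_univ _))
    rw [Real.log_mul (left_ne_zero_of_mul this) (right_ne_zero_of_mul this)]
    ring

lemma Cl.refl' {c : A → A → ℝ} {p : A → ℝ} (hp : ∀ a, 0 ≤ p a) (hc0 : ∀ a, c a a = 0) :
    Cl c p p 0 := by
  classical
  refine ⟨fun a b => if a = b then p a else 0, fun a b => ?_, fun a => ?_, fun b => ?_, ?_⟩
  · dsimp only; split_ifs; exacts [hp a, le_rfl]
  · simp
  · simp
  · simp [hc0]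

lemma prodmass_one {p : A → ℝ} (h1 : ∑ a, p a = 1) (n : ℕ) :
    ∑ y : Fin n → A, ∏ b, p (y b) = 1 := by
  rw [← Fintype.piFinset_univ, ← Finset.prod_univ_sum]; simp [h1]

lemma marton {A : Type} [Fintype A] {p : A → ℝ} (hp : ∀ a, 0 ≤ p a) (h1 : ∑ a, p a = 1)
    {c : A → A → ℝ}
    (hc0 : ∀ a, c a a = 0) (hc1 : ∀ a b, c a b ≤ 1) (hct : ∀ a b d, c a d ≤ c a b + c b d)
    {t : ℝ} (ht : 0 < t) (n : ℕ) :
    ∀ {S : Type} [Fintype S] (P : S → (Fin n → A) → ℝ), (∀ s y, 0 ≤ P s y) →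
      (∀ y, ∑ s, P s y = ∏ b, p (y b)) →
      ∃ e : S → ℝ, ∑ s, e s ≤ n * t + MI P / t ∧
        ∀ s, Cl (fun y y' : Fin n → A => ∑ b, c (y b) (y' b)) (P s)
          (fun y => (∑ y', P s y') * ∏ b, p (y b)) (e s) := by
  induction n with
  | zero =>
    intro S _ P hP hm
    refine ⟨fun _ => 0, ?_, fun s => ?_⟩
    · have : ∑ s, ∑ y, P s y = 1 := by
        rw [sum_comm]; simp_rw [hm]; exact prodmass_one h1 0
      have := MI_nonneg hP this
      simp only [sum_const_zero, Nat.cast_zero, zero_mul, zero_add]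
      positivity
    · have h := Cl.refl' (c := fun y y' : Fin 0 → A => ∑ b, c (y b) (y' b)) (hP s) (by simp)
      convert h using 1
      ext y
      simp only [Finset.univ_eq_empty, Finset.prod_empty, mul_one, Finset.univ_unique, Finset.sum_singleton]
      congr 1
      exact Subsingleton.elim _ _
  | succ n ih =>
    intro S _ P hP hm
    let E : A × (Fin n → A) ≃ (Fin (n + 1) → A) := Fin.consEquiv fun _ => A
    have hE : ∀ a u, E (a, u) = Fin.cons a u := fun a u => rfl
    have hprod : ∀ a u, ∏ b, p (E (a, u) b) = p a * ∏ b, p (u b) := fun a u => by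
      rw [hE, Fin.prod_univ_succ]; simp
    let Q : S → A × (Fin n → A) → ℝ := fun s x => P s (E x)
    have hQ : ∀ s x, 0 ≤ Q s x := fun s x => hP s _
    have hQm : ∀ a u, ∑ s, Q s (a, u) = p a * ∏ b, p (u b) := fun a u => by
      simp only [Q]; rw [hm, hprod]
    have htot : ∑ s, ∑ x, Q s x = 1 := by
      rw [sum_comm, Fintype.sum_prod_type]
      simp_rw [hQm, ← mul_sum, prodmass_one h1, mul_one, h1]
    have hMI : MI P = MI (fun s a => ∑ u, Q s (a, u)) +
        MI (fun (x : S × A) u => Q x.1 (x.2, u)) := by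
      rw [← MI_equiv P E]
      exact MI_chain hQ h1 (prodmass_one h1 n) hQm
    obtain ⟨e, he, hcl⟩ := ih (fun (x : S × A) u => Q x.1 (x.2, u)) (fun x u => hQ _ _)
      (fun u => by
        rw [Fintype.sum_prod_type, sum_comm]
        simp_rw [hQm, ← sum_mul, h1, one_mul])
    set M : S → A → ℝ := fun s a => ∑ u, Q s (a, u) with hM
    have hM0 : ∀ s a, 0 ≤ M s a := fun s a => sum_nonneg fun u _ => hQ _ _
    have hMm : ∀ a, ∑ s, M s a = p a := fun a => by
      simp only [hM]; rw [sum_comm]; simp_rw [hQm, ← mul_sum, prodmass_one h1, mul_one]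
    have hMs : ∀ s, ∑ a, M s a = ∑ y, P s y := fun s => by
      simp only [hM, Q]; rw [← E.sum_comp, Fintype.sum_prod_type]
    have hpin := pinsker hM0 (by rw [sum_comm]; simp_rw [hMm, h1]) ht
    simp_rw [hMm] at hpin
    refine ⟨fun s => ∑ a, e (s, a) + ∑ a, |M s a - (∑ a', M s a') * p a|, ?_, fun s => ?_⟩
    · rw [sum_add_distrib, ← Fintype.sum_prod_type (f := e), hMI]
      push_cast
      rw [add_div]
      linarith
    · have c1 : Cl (fun x y : A × (Fin n → A) => c x.1 y.1 + ∑ b, c (x.2 b) (y.2 b))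
          (Q s) (fun x => M s x.1 * ∏ b, p (x.2 b)) (∑ a, e (s, a)) :=
        Cl.slice (S := A) (A := Fin n → A) (B := Fin n → A)
          (c := fun _ y y' => ∑ b, c (y b) (y' b)) (p := fun a u => Q s (a, u))
          (q := fun a u => M s a * ∏ b, p (u b))
          (fun a => hcl (s, a)) (fun a u u' => by simp [hc0])
      have c0 : Cl c (M s) (fun a => (∑ a', M s a') * p a)
          (∑ a, |M s a - (∑ a', M s a') * p a|) :=
        Cl.tv (hM0 s) (fun a => mul_nonneg (sum_nonneg fun a _ => hM0 s a) (hp a))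
          (by rw [← mul_sum, h1, mul_one]) hc0 hc1
      have c2 : Cl (fun x y : A × (Fin n → A) => c x.1 y.1 + ∑ b, c (x.2 b) (y.2 b))
          (fun x => M s x.1 * ∏ b, p (x.2 b))
          (fun x => ((∑ a', M s a') * p x.1) * ∏ b, p (x.2 b))
          (∑ u : Fin n → A, (∏ b, p (u b)) * (∑ a, |M s a - (∑ a', M s a') * p a|)) := by
        have := Cl.slice' (S := Fin n → A) (c := fun _ => c)
          (p := fun u a => (∏ b, p (u b)) * M s a)
          (q := fun u a => (∏ b, p (u b)) * ((∑ a', M s a') * p a))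
          (c' := fun x y : A × (Fin n → A) => c x.1 y.1 + ∑ b, c (x.2 b) (y.2 b))
          (fun u => c0.smul (prod_nonneg fun b _ => hp (u b)))
          (fun u a b => by simp [hc0])
        convert this using 1
        · ext x; ring
        · ext x; ring
      rw [← sum_mul, prodmass_one h1, one_mul] at c2
      have c3 := c1.trans (c₃ := fun x y : A × (Fin n → A) =>
        c x.1 y.1 + ∑ b, c (x.2 b) (y.2 b)) c2 (fun x y z => by
          have := sum_le_sum fun b (_ : b ∈ Finset.univ) => hct (x.2 b) (y.2 b) (z.2 b)
          rw [sum_add_distrib] at this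
          linarith [hct x.1 y.1 z.1])
      have c4 := c3.equiv E.symm E.symm
      convert c4 using 1
      · ext y y'
        rw [Fin.sum_univ_succ]; rfl
      · ext y; simp only [Q, Equiv.apply_symm_apply]
      · ext y
        rw [hMs, mul_assoc]
        congr 1
        rw [← hprod]; simp

lemma glue_dp0 {P : S → A → ℝ} (hP : ∀ s a, 0 ≤ P s a) (h1 : ∑ s, ∑ a, P s a = 1)
    {c : A → B → ℝ} {q : B → ℝ} {e : ℝ} (π : A → B → ℝ) (n : ∀ a b, 0 ≤ π a b)
    (l : ∀ a, ∑ b, π a b = ∑ s, P s a)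
    (r : ∀ b, ∑ a, π a b = q b) (k : ∑ a, ∑ b, π a b * c a b ≤ e)
    (R : S → B → ℝ) (hR : R = fun s b => ∑ a, P s a * π a b / ∑ s', P s' a) :
      (∀ s b, 0 ≤ R s b) ∧ (∀ s, ∑ b, R s b = ∑ a, P s a) ∧
      (∀ b, ∑ s, R s b = q b) ∧ MI R ≤ MI P ∧
      ∃ e' : S → ℝ, ∑ s, e' s ≤ e ∧ ∀ s, Cl c (P s) (R s) (e' s) := by
  set p : A → ℝ := fun a => ∑ s, P s a with hp
  replace l : ∀ a, ∑ b, π a b = p a := l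
  have hp0 : ∀ a, 0 ≤ p a := fun a => sum_nonneg fun s _ => hP s a
  have zP : ∀ s a, p a = 0 → P s a = 0 := fun s a h =>
    (sum_eq_zero_iff_of_nonneg fun s _ => hP s a).1 h s (Finset.mem_univ _)
  have zπ : ∀ a b, p a = 0 → π a b = 0 := fun a b h => by
    rw [← l a] at h
    exact (sum_eq_zero_iff_of_nonneg fun b _ => n a b).1 h b (Finset.mem_univ _)
  have zq : ∀ a b, q b = 0 → π a b = 0 := fun a b h => by
    rw [← r b] at h
    exact (sum_eq_zero_iff_of_nonneg fun a _ => n a b).1 h a (Finset.mem_univ _)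
  set T : S → A → B → ℝ := fun s a b => P s a * π a b / p a with hT
  have T0 : ∀ s a b, 0 ≤ T s a b := fun s a b => div_nonneg (mul_nonneg (hP s a) (n a b)) (hp0 a)
  have Tb : ∀ s a, ∑ b, T s a b = P s a := fun s a => by
    simp only [hT]; rw [← sum_div, ← mul_sum, l]
    by_cases h : p a = 0
    · simp [h, zP s a h]
    · field_simp
  have Ts : ∀ a b, ∑ s, T s a b = π a b := fun a b => by
    simp only [hT]; rw [← sum_div, ← sum_mul]
    change p a * π a b / p a = _
    by_cases h : p a = 0
    · simp [h, zπ a b h]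
    · field_simp
  replace hR : R = fun s b => ∑ a, T s a b := hR
  have R0 : ∀ s b, 0 ≤ R s b := fun s b => by
    rw [hR]; exact sum_nonneg fun a _ => T0 s a b
  have Rb : ∀ s, ∑ b, R s b = ∑ a, P s a := fun s => by
    simp only [hR]; rw [sum_comm]; simp_rw [Tb]
  have Rs : ∀ b, ∑ s, R s b = q b := fun b => by
    simp only [hR]; rw [sum_comm]; simp_rw [Ts, r]
  refine ⟨R0, Rb, Rs, ?_, fun s => ∑ a, ∑ b, T s a b * c a b, ?_, fun s => ?_⟩
  · have m1 : MI P = ∑ s, ∑ a, ∑ b, T s a b * (Real.log (P s a) - Real.log (∑ a', P s a') -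
        Real.log (p a)) := by
      unfold MI
      simp_rw [← sum_mul, Tb]; rfl
    have m2 : MI R = ∑ s, ∑ a, ∑ b, T s a b * (Real.log (R s b) - Real.log (∑ a', P s a') -
        Real.log (q b)) := by
      unfold MI
      refine sum_congr rfl fun s _ => ?_
      rw [Rb s]
      conv_rhs => rw [sum_comm]
      refine sum_congr rfl fun b _ => ?_
      rw [Rs, ← sum_mul, hR]
    have key : ∀ s a b, T s a b - π a b * R s b / q b ≤
        T s a b * (Real.log (P s a) - Real.log (∑ a', P s a') - Real.log (p a)) -
        T s a b * (Real.log (R s b) - Real.log (∑ a', P s a') - Real.log (q b)) := by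
      intro s a b
      have hq0 : 0 ≤ q b := by rw [← r b]; exact sum_nonneg fun a _ => n a b
      rcases (T0 s a b).eq_or_lt with h | h
      · rw [← h]
        have : 0 ≤ π a b * R s b / q b := div_nonneg (mul_nonneg (n a b) (R0 s b)) hq0
        linarith
      · have hpa : 0 < p a := (hp0 a).lt_of_ne fun h' => by
          simp [hT, ← h'] at h
        have hPa : 0 < P s a := (hP s a).lt_of_ne fun h' => by
          simp [hT, ← h'] at h
        have hπ : 0 < π a b := (n a b).lt_of_ne fun h' => by
          simp [hT, ← h'] at h
        have hq : 0 < q b := hq0.lt_of_ne fun h' => hπ.ne' (zq a b h'.symm)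
        have hRR : 0 < R s b := by
          rw [hR]
          exact h.trans_le (single_le_sum (f := fun a => T s a b) (fun a _ => T0 s a b) (Finset.mem_univ a))
        have h2 : Real.log ((p a * R s b) / (P s a * q b)) ≤ (p a * R s b) / (P s a * q b) - 1 :=
          Real.log_le_sub_one_of_pos (by positivity)
        rw [Real.log_div (by positivity) (by positivity), Real.log_mul hpa.ne' hRR.ne',
          Real.log_mul hPa.ne' hq.ne'] at h2
        have h3 := mul_le_mul_of_nonneg_left h2 h.le
        have h4 : T s a b * ((p a * R s b) / (P s a * q b)) = π a b * R s b / q b := by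
          simp only [hT]; field_simp
        nlinarith
    have := sum_le_sum fun s (_ : s ∈ Finset.univ) => sum_le_sum fun a (_ : a ∈ Finset.univ) =>
      sum_le_sum fun b (_ : b ∈ Finset.univ) => key s a b
    simp only [sum_sub_distrib] at this
    rw [← m1, ← m2] at this
    have t1 : ∑ s, ∑ a, ∑ b, T s a b = 1 := by simp_rw [Tb, h1]
    have t2 : ∑ s, ∑ a, ∑ b, π a b * R s b / q b = 1 := by
      rw [← h1]
      refine sum_congr rfl fun s _ => ?_
      rw [← Rb s, sum_comm]
      refine sum_congr rfl fun b _ => ?_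
      rw [← sum_div, ← sum_mul, r]
      by_cases h : q b = 0
      · rw [h, zero_mul, zero_div]
        rw [← Rs b] at h
        exact ((sum_eq_zero_iff_of_nonneg fun s _ => R0 s b).1 h s (Finset.mem_univ _)).symm
      · field_simp
    rw [t1, t2] at this
    linarith
  · refine le_trans (le_of_eq ?_) k
    rw [sum_comm]
    refine sum_congr rfl fun a _ => ?_
    rw [sum_comm]
    refine sum_congr rfl fun b _ => ?_
    rw [← sum_mul, Ts]
  · exact ⟨T s, T0 s, Tb s, fun b => by rw [hR], le_rfl⟩

lemma glue_dp {P : S → A → ℝ} (hP : ∀ s a, 0 ≤ P s a) (h1 : ∑ s, ∑ a, P s a = 1)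
    {c : A → B → ℝ} {q : B → ℝ} {e : ℝ} (h : Cl c (fun a => ∑ s, P s a) q e) :
    ∃ R : S → B → ℝ, (∀ s b, 0 ≤ R s b) ∧ (∀ s, ∑ b, R s b = ∑ a, P s a) ∧
      (∀ b, ∑ s, R s b = q b) ∧ MI R ≤ MI P ∧
      ∃ e' : S → ℝ, ∑ s, e' s ≤ e ∧ ∀ s, Cl c (P s) (R s) (e' s) := by
  obtain ⟨π, n, l, r, k⟩ := h
  exact ⟨_, glue_dp0 hP h1 π n l r k _ rfl⟩

lemma MI_symm (P : S → A → ℝ) : MI (fun a s => P s a) = MI P := by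
  unfold MI
  rw [sum_comm]
  refine sum_congr rfl fun s _ => sum_congr rfl fun a _ => ?_
  ring

open Classical in
lemma MI_mono {P : S → A → ℝ} (hP : ∀ s a, 0 ≤ P s a) (h1 : ∑ s, ∑ a, P s a = 1) (φ : A → B) :
    MI (fun s b => ∑ a, if φ a = b then P s a else 0) ≤ MI P := by
  refine (glue_dp0 hP h1 (c := fun _ _ => 0) (e := 0)
    (q := fun b => ∑ a, if φ a = b then ∑ s, P s a else 0)
    (fun a b => if φ a = b then ∑ s, P s a else 0) ?_ ?_ ?_ ?_ _ ?_).2.2.2.1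
  · intro a b; split_ifs; exacts [sum_nonneg fun s _ => hP s a, le_rfl]
  · intro a; simp
  · intro b; rfl
  · simp
  · ext s b
    refine sum_congr rfl fun a _ => ?_
    split_ifs with h
    · by_cases h0 : ∑ s', P s' a = 0
      · rw [h0]
        simp [(sum_eq_zero_iff_of_nonneg fun s _ => hP s a).1 h0 s (Finset.mem_univ _)]
      · field_simp
    · simp

/-- extremality: a law close to i.i.d. is nearly insensitive to low-information conditioning -/
lemma extremal {A S : Type} [Fintype A] [Fintype S] {p : A → ℝ} (hp : ∀ a, 0 ≤ p a)
    (h1 : ∑ a, p a = 1) {c : A → A → ℝ}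
    (hc0 : ∀ a, c a a = 0) (hc1 : ∀ a b, c a b ≤ 1) (hct : ∀ a b d, c a d ≤ c a b + c b d)
    (hcs : ∀ a b, c a b = c b a)
    {t : ℝ} (ht : 0 < t) {n : ℕ} {P : S → (Fin n → A) → ℝ} (hP : ∀ s y, 0 ≤ P s y)
    (hP1 : ∑ s, ∑ y, P s y = 1) {e₀ : ℝ}
    (hcl : Cl (fun y y' : Fin n → A => ∑ b, c (y b) (y' b)) (fun y => ∑ s, P s y)
      (fun y => ∏ b, p (y b)) e₀) :
    ∃ e : S → ℝ, ∑ s, e s ≤ 2 * e₀ + n * t + MI P / t ∧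
      ∀ s, Cl (fun y y' : Fin n → A => ∑ b, c (y b) (y' b)) (P s)
          (fun y => (∑ y', P s y') * ∑ s', P s' y) (e s) := by
  obtain ⟨R, R0, Rb, Rs, hMI, e', he', hcl'⟩ := glue_dp hP hP1 hcl
  obtain ⟨e, he, hcl2⟩ := marton hp h1 hc0 hc1 hct ht n R R0 Rs
  have htri : ∀ y y' y'' : Fin n → A, ∑ b, c (y b) (y'' b) ≤
      ∑ b, c (y b) (y' b) + ∑ b, c (y' b) (y'' b) := fun y y' y'' => by
    rw [← sum_add_distrib]; exact sum_le_sum fun b _ => hct _ _ _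
  refine ⟨fun s => e' s + e s + (∑ y', P s y') * e₀, ?_, fun s => ?_⟩
  · rw [sum_add_distrib, sum_add_distrib, ← sum_mul, hP1]
    have := div_le_div_of_nonneg_right hMI ht.le
    linarith
  · have a1 := (hcl' s).trans (hcl2 s) htri
    have a2 := hcl.symm.smul (r := ∑ y', P s y') (sum_nonneg fun y _ => hP s y)
    rw [Rb] at a1
    exact a1.trans a2 (fun a b d => by
      refine (htri a b d).trans (le_of_eq ?_)
      congr 1
      exact sum_congr rfl fun i _ => hcs _ _)
end Info2
end VWB

namespace VWB
open Finset MeasureTheory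

section Law
variable {Ω : Type*} [MeasurableSpace Ω] {A B C : Type*} [Fintype A] [Fintype B] [Fintype C]
  [MeasurableSpace A] [MeasurableSingletonClass A] [MeasurableSpace B] [MeasurableSingletonClass B]
  [MeasurableSpace C] [MeasurableSingletonClass C]

/-- the law of a finite-valued random variable -/
noncomputable def lw (μ : Measure Ω) (f : Ω → A) (a : A) : ℝ := μ.real (f ⁻¹' {a})

lemma lw_nonneg (μ : Measure Ω) (f : Ω → A) (a : A) : 0 ≤ lw μ f a := measureReal_nonneg

lemma sum_lw_mul (μ : Measure Ω) [IsFiniteMeasure μ] {f : Ω → A} (hf : Measurable f)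
    (F : A → ℝ) : ∑ a, lw μ f a * F a = ∫ x, F (f x) ∂μ := by
  have : ∫ x, F (f x) ∂μ = ∫ a, F a ∂(μ.map f) := by
    rw [integral_map hf.aemeasurable]
    exact (measurable_of_countable F).aestronglyMeasurable
  rw [this, integral_fintype (Integrable.of_finite)]
  refine sum_congr rfl fun a _ => ?_
  rw [lw, map_measureReal_apply hf (measurableSet_singleton a), smul_eq_mul]

lemma sum_lw (μ : Measure Ω) [IsFiniteMeasure μ] {f : Ω → A} (hf : Measurable f) :
    ∑ a, lw μ f a = μ.real Set.univ := by
  simpa using sum_lw_mul μ hf (fun _ => 1)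

open Classical in
lemma lw_comp (μ : Measure Ω) [IsFiniteMeasure μ] {f : Ω → A} (hf : Measurable f) (φ : A → B)
    (b : B) : lw μ (fun x => φ (f x)) b = ∑ a, if φ a = b then lw μ f a else 0 := by
  have := sum_lw_mul μ hf (fun a => if φ a = b then 1 else 0)
  simp only [mul_ite, mul_one, mul_zero] at this
  rw [this]
  have h2 : (fun x => if φ (f x) = b then (1 : ℝ) else 0) =
      Set.indicator ((fun x => φ (f x)) ⁻¹' {b}) 1 := by
    ext x; simp [Set.indicator]
  rw [h2, integral_indicator_one]
  · rfl
  · exact ((measurable_of_countable φ).comp hf) (measurableSet_singleton b)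

lemma lw_fst (μ : Measure Ω) [IsFiniteMeasure μ] {f : Ω → A} {g : Ω → B} (hf : Measurable f)
    (hg : Measurable g) (a : A) : ∑ b, lw μ (fun x => (f x, g x)) (a, b) = lw μ f a := by
  classical
  have := lw_comp μ (hf.prodMk hg) Prod.fst a
  simp only at this
  rw [this, Fintype.sum_prod_type, sum_eq_single a]
  · simp
  · intro b _ hb; simp [hb]
  · simp

lemma lw_snd (μ : Measure Ω) [IsFiniteMeasure μ] {f : Ω → A} {g : Ω → B} (hf : Measurable f)
    (hg : Measurable g) (b : B) : ∑ a, lw μ (fun x => (f x, g x)) (a, b) = lw μ g b := by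
  classical
  have := lw_comp μ (hf.prodMk hg) Prod.snd b
  simp only at this
  rw [this, Fintype.sum_prod_type]
  simp

lemma Cl.law (μ : Measure Ω) [IsFiniteMeasure μ] {f : Ω → A} {g : Ω → B} (hf : Measurable f)
    (hg : Measurable g) {c : A → B → ℝ} {e : ℝ} (h : ∫ x, c (f x) (g x) ∂μ ≤ e) :
    Cl c (lw μ f) (lw μ g) e := by
  refine ⟨fun a b => lw μ (fun x => (f x, g x)) (a, b), fun a b => lw_nonneg _ _ _,
    lw_fst μ hf hg, lw_snd μ hf hg, ?_⟩
  have := sum_lw_mul μ (hf.prodMk hg) (fun x => c x.1 x.2)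
  rw [Fintype.sum_prod_type] at this
  rw [this]; exact h

/-- entropy -/
noncomputable def Ent (μ : Measure Ω) (f : Ω → A) : ℝ := ∑ a, Real.negMulLog (lw μ f a)

lemma Ent_inj (μ : Measure Ω) [IsFiniteMeasure μ] {f : Ω → A} (φ : A → B)
    (hφ : Function.Injective φ) : Ent μ (fun x => φ (f x)) = Ent μ f := by
  classical
  unfold Ent
  symm
  have h1 : ∀ a, lw μ f a = lw μ (fun x => φ (f x)) (φ a) := fun a => by
    unfold lw; congr 1; ext x; simp [hφ.eq_iff]
  simp_rw [h1]
  rw [← sum_image (s := Finset.univ) (g := φ) (f := fun b => Real.negMulLog (lw μ (fun x => φ (f x)) b))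
    (fun a _ b _ h => hφ h)]
  refine sum_subset (subset_univ _) fun b _ hb => ?_
  have : (fun x => φ (f x)) ⁻¹' {b} = ∅ := by
    ext x
    simp only [Set.mem_preimage, Set.mem_singleton_iff, Set.mem_empty_iff_false, iff_false]
    rintro rfl
    exact hb (mem_image_of_mem _ (Finset.mem_univ _))
  simp [lw, this]

lemma MI_Ent (μ : Measure Ω) [IsFiniteMeasure μ] {f : Ω → A} {g : Ω → B} (hf : Measurable f)
    (hg : Measurable g) : MI (fun a b => lw μ (fun x => (f x, g x)) (a, b)) =
      Ent μ f + Ent μ g - Ent μ (fun x => (f x, g x)) := by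
  unfold MI Ent
  simp_rw [lw_fst μ hf hg, lw_snd μ hf hg, mul_sub, sum_sub_distrib]
  rw [sum_comm (f := fun a b => lw μ (fun x => (f x, g x)) (a, b) * Real.log (lw μ g b))]
  simp_rw [← sum_mul, lw_fst μ hf hg, lw_snd μ hf hg]
  rw [Fintype.sum_prod_type]
  simp only [Real.negMulLog, neg_mul, sum_neg_distrib]
  ring

lemma Ent_le_pair (μ : Measure Ω) [IsFiniteMeasure μ] {f : Ω → A} {g : Ω → B} (hf : Measurable f)
    (hg : Measurable g) : Ent μ f ≤ Ent μ (fun x => (f x, g x)) := by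
  unfold Ent
  rw [Fintype.sum_prod_type]
  refine sum_le_sum fun a _ => ?_
  rw [Real.negMulLog]
  nth_rw 1 [← lw_fst μ hf hg]
  rw [neg_mul, sum_mul, ← sum_neg_distrib]
  refine sum_le_sum fun b _ => ?_
  rw [Real.negMulLog, neg_mul, neg_le_neg_iff]
  rcases (lw_nonneg μ (fun x => (f x, g x)) (a, b)).eq_or_lt with h | h
  · simp [← h]
  · refine mul_le_mul_of_nonneg_left (Real.log_le_log h ?_) h.le
    rw [← lw_fst μ hf hg a]
    exact single_le_sum (f := fun b => lw μ (fun x => (f x, g x)) (a, b))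
      (fun b _ => lw_nonneg _ _ _) (Finset.mem_univ b)

lemma MI_law_mono (μ : Measure Ω) [IsProbabilityMeasure μ] {f : Ω → A} {g : Ω → B}
    (hf : Measurable f) (hg : Measurable g) (φ : B → C) :
    MI (fun a b => lw μ (fun x => (f x, φ (g x))) (a, b)) ≤
    MI (fun a b => lw μ (fun x => (f x, g x)) (a, b)) := by
  classical
  have h := MI_mono (P := fun a b => lw μ (fun x => (f x, g x)) (a, b))
    (fun a b => lw_nonneg _ _ _) (by
      rw [← Fintype.sum_prod_type (f := fun x => lw μ (fun x => (f x, g x)) x),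
        sum_lw μ (hf.prodMk hg)]; simp) φ
  convert h using 2
  ext a b
  have := lw_comp μ (hf.prodMk hg) (fun x : A × B => (x.1, φ x.2)) (a, b)
  simp only [Prod.mk.injEq] at this
  rw [this, Fintype.sum_prod_type, sum_eq_single a]
  · simp
  · intro a' _ h; simp [h]
  · simp

lemma MI_law_symm (μ : Measure Ω) [IsFiniteMeasure μ] {f : Ω → A} {g : Ω → B}
    (hf : Measurable f) (hg : Measurable g) :
    MI (fun a b => lw μ (fun x => (f x, g x)) (a, b)) =
    MI (fun a b => lw μ (fun x => (g x, f x)) (a, b)) := by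
  rw [MI_Ent μ hf hg, MI_Ent μ hg hf]
  have := Ent_inj μ (f := fun x => (f x, g x)) Prod.swap Prod.swap_injective
  simp only [Prod.swap] at this
  rw [this]; ring

end Law

lemma seq_lemma {a : ℕ → ℝ} (h0 : a 0 = 0) (hconc : ∀ n, a (n + 2) + a n ≤ 2 * a (n + 1))
    (hmono : ∀ n, a n ≤ a (n + 1)) {κ : ℝ} (hκ : 0 < κ) :
    ∃ n₁, ∀ n, n₁ ≤ n → ∀ m, a m + a n - a (m + n) ≤ κ * n := by
  set d : ℕ → ℝ := fun n => a (n + 1) - a n with hd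
  have hanti : Antitone d := antitone_nat_of_succ_le fun n => by
    simp only [hd]; linarith [hconc n]
  have hbdd : BddBelow (Set.range d) := ⟨0, by rintro _ ⟨n, rfl⟩; simp only [hd]; linarith [hmono n]⟩
  have hlim := tendsto_atTop_ciInf hanti hbdd
  set h := ⨅ i, d i
  have hle : ∀ n, h ≤ d n := fun n => ciInf_le hbdd n
  have hces := hlim.cesaro
  have hsum : ∀ n, ∑ i ∈ Finset.range n, d i = a n := fun n => by
    simp only [hd]; rw [sum_range_sub, h0, sub_zero]
  have hlow : ∀ m n : ℕ, n * h ≤ a (m + n) - a m := fun m n => by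
    induction n with
    | zero => simp
    | succ n ih =>
      have := hle (m + n)
      simp only [hd] at this
      push_cast
      rw [← add_assoc]
      linarith
  have := (hces.eventually (gt_mem_nhds (show h < h + κ by linarith))).and
    (Filter.eventually_gt_atTop 0)
  obtain ⟨n₁, hn₁⟩ := Filter.eventually_atTop.1 this
  refine ⟨n₁, fun n hn m => ?_⟩
  obtain ⟨h3, h4⟩ := hn₁ n hn
  rw [hsum] at h3
  have hn0 : (0 : ℝ) < n := by exact_mod_cast h4
  have h5 : a n < n * (h + κ) := by
    rw [inv_mul_lt_iff₀ hn0] at h3; exact h3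
  nlinarith [hlow m n]
end VWB

namespace VWB
open Finset MeasureTheory

/-- a measure preserving action of the integers -/
structure Flow {Ω : Type*} [MeasurableSpace Ω] (μ : Measure Ω) (S : ℤ → Ω → Ω) : Prop where
  add : ∀ s t x, S s (S t x) = S (s + t) x
  mp : ∀ t, MeasurePreserving (S t) μ μ

/-- normalized Hamming distance -/
noncomputable def ham {k : ℕ} (L : ℕ) (a b : Fin L → Fin k) : ℝ :=
  (L : ℝ)⁻¹ * ∑ r, if a r = b r then 0 else 1

lemma ham_self {k L : ℕ} (a : Fin L → Fin k) : ham L a a = 0 := by simp [ham]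
lemma ham_nonneg {k L : ℕ} (a b : Fin L → Fin k) : 0 ≤ ham L a b :=
  mul_nonneg (by positivity) (sum_nonneg fun r _ => by split_ifs <;> simp)
lemma ham_le_one {k L : ℕ} (a b : Fin L → Fin k) : ham L a b ≤ 1 := by
  unfold ham
  have : (∑ r, if a r = b r then (0 : ℝ) else 1) ≤ L := by
    calc _ ≤ ∑ r : Fin L, (1 : ℝ) := sum_le_sum fun r _ => by split_ifs <;> simp
      _ = L := by simp
  rcases Nat.eq_zero_or_pos L with rfl | h
  · simp
  · rw [inv_mul_le_iff₀ (by exact_mod_cast h)]; simpa using this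
lemma ham_comm {k L : ℕ} (a b : Fin L → Fin k) : ham L a b = ham L b a := by
  unfold ham; simp_rw [eq_comm]
lemma ham_tri {k L : ℕ} (a b d : Fin L → Fin k) : ham L a d ≤ ham L a b + ham L b d := by
  unfold ham
  rw [← mul_add, ← sum_add_distrib]
  refine mul_le_mul_of_nonneg_left (sum_le_sum fun r _ => ?_) (by positivity)
  split_ifs <;> simp_all

section Dyn
variable {Ω : Type*} [MeasurableSpace Ω] {μ : Measure Ω} {S : ℤ → Ω → Ω} {k : ℕ}

/-- the word of length `n` starting at time `t` -/
def wd (S : ℤ → Ω → Ω) (g : Ω → Fin k) (t : ℤ) (n : ℕ) (x : Ω) : Fin n → Fin k :=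
  fun r => g (S (t + (r : ℕ)) x)

/-- consecutive words of length `L` -/
def blks (S : ℤ → Ω → Ω) (g : Ω → Fin k) (L : ℕ) (t : ℤ) (B : ℕ) (x : Ω) :
    Fin B → Fin L → Fin k :=
  fun b => wd S g (t + (b : ℕ) * (L : ℤ)) L x

lemma Flow.measurable_wd (hS : Flow μ S) {g : Ω → Fin k} (hg : Measurable g) (t : ℤ) (n : ℕ) :
    Measurable (wd S g t n) :=
  measurable_pi_lambda _ fun r => hg.comp (hS.mp _).measurable

lemma Flow.measurable_blks (hS : Flow μ S) {g : Ω → Fin k} (hg : Measurable g) (L : ℕ) (t : ℤ)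
    (B : ℕ) : Measurable (blks S g L t B) :=
  measurable_pi_lambda _ fun b => hS.measurable_wd hg _ _

lemma Flow.wd_shift (hS : Flow μ S) (g : Ω → Fin k) (s t : ℤ) (n : ℕ) (x : Ω) :
    wd S g t n (S s x) = wd S g (t + s) n x := by
  ext r; simp only [wd, hS.add]; congr 3; ring

lemma Flow.blks_shift (hS : Flow μ S) (g : Ω → Fin k) (L : ℕ) (s t : ℤ) (n : ℕ) (x : Ω) :
    blks S g L t n (S s x) = blks S g L (t + s) n x := by
  ext b : 1; simp only [blks, hS.wd_shift]; congr 1; ring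

lemma Flow.lw_shift {A : Type*} [Fintype A] [MeasurableSpace A] [MeasurableSingletonClass A]
    (hS : Flow μ S) {F : Ω → A} (hF : Measurable F) (t : ℤ) :
    lw μ (fun x => F (S t x)) = lw μ F := by
  ext a
  unfold lw
  exact (hS.mp t).measureReal_preimage (hF (measurableSet_singleton a)).nullMeasurableSet

lemma Flow.Ent_wd (hS : Flow μ S) {g : Ω → Fin k} (hg : Measurable g) (t : ℤ) (n : ℕ) :
    Ent μ (wd S g t n) = Ent μ (wd S g 0 n) := by
  unfold Ent
  rw [← hS.lw_shift (hS.measurable_wd hg 0 n) t]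
  simp_rw [hS.wd_shift, zero_add]

lemma wd_append (g : Ω → Fin k) (t : ℤ) (m n : ℕ) (x : Ω) :
    wd S g t (m + n) x = Fin.append (wd S g t m x) (wd S g (t + m) n x) := by
  ext r
  refine Fin.addCases (fun i => ?_) (fun i => ?_) r
  · simp [wd]
  · simp [wd, add_assoc]

lemma Flow.Ent_pair (hS : Flow μ S) [IsFiniteMeasure μ] {g : Ω → Fin k} (hg : Measurable g)
    (t : ℤ) (m n : ℕ) :
    Ent μ (fun x => (wd S g t m x, wd S g (t + m) n x)) = Ent μ (wd S g 0 (m + n)) := by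
  rw [← hS.Ent_wd hg t (m + n)]
  have := Ent_inj μ (f := fun x => (wd S g t m x, wd S g (t + m) n x))
    (fun y : (Fin m → Fin k) × (Fin n → Fin k) => Fin.append y.1 y.2)
    (Fin.appendEquiv m n).injective
  rw [← this]
  congr 1
  ext x : 1
  rw [wd_append]

lemma Flow.MI_wd (hS : Flow μ S) [IsFiniteMeasure μ] {g : Ω → Fin k} (hg : Measurable g)
    (t : ℤ) (m n : ℕ) :
    MI (fun a b => lw μ (fun x => (wd S g t m x, wd S g (t + m) n x)) (a, b)) =
      Ent μ (wd S g 0 m) + Ent μ (wd S g 0 n) - Ent μ (wd S g 0 (m + n)) := by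
  rw [MI_Ent μ (hS.measurable_wd hg _ _) (hS.measurable_wd hg _ _), hS.Ent_pair hg,
    hS.Ent_wd hg t, hS.Ent_wd hg (t + m)]

lemma Flow.ent_bound (hS : Flow μ S) [IsProbabilityMeasure μ] {g : Ω → Fin k} (hg : Measurable g)
    {κ : ℝ} (hκ : 0 < κ) :
    ∃ n₁ : ℕ, ∀ n, n₁ ≤ n → ∀ (m : ℕ) (t : ℤ),
      MI (fun a b => lw μ (fun x => (wd S g t m x, wd S g (t + m) n x)) (a, b)) ≤ κ * n := by
  have := seq_lemma (a := fun n => Ent μ (wd S g 0 n)) ?_ ?_ ?_ hκ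
  · obtain ⟨n₁, h⟩ := this
    refine ⟨n₁, fun n hn m t => ?_⟩
    rw [hS.MI_wd hg]; exact h n hn m
  · have : ∀ a : Fin 0 → Fin k, wd S g 0 0 ⁻¹' {a} = Set.univ := fun a => by
      ext x; simp [Subsingleton.elim (wd S g 0 0 x) a]
    simp [Ent, lw, this]
  · intro n
    have h := MI_law_mono μ (hS.measurable_wd hg 0 1) (hS.measurable_wd hg (0 + (1 : ℕ)) (n + 1))
      (fun w : Fin (n + 1) → Fin k => fun r : Fin n => w r.castSucc)
    have e : ∀ x, (fun r : Fin n => wd S g (0 + (1 : ℕ)) (n + 1) x r.castSucc) =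
      wd S g (0 + (1 : ℕ)) n x := fun x => rfl
    simp_rw [e] at h
    rw [hS.MI_wd hg, hS.MI_wd hg] at h
    have e2 : 1 + (n + 1) = n + 2 := by ring
    rw [e2, add_comm 1 n] at h
    linarith
  · intro n
    have := Ent_le_pair μ (hS.measurable_wd hg 0 n) (hS.measurable_wd hg (0 + (n : ℕ)) 1)
    rwa [hS.Ent_pair hg] at this

lemma blks_succ (g : Ω → Fin k) (L : ℕ) (t : ℤ) (B : ℕ) (x : Ω) :
    blks S g L t (B + 1) x = Fin.cons (wd S g t L x) (blks S g L (t + L) B x) := by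
  ext b : 1
  refine Fin.cases ?_ (fun i => ?_) b
  · simp [blks]
  · simp only [blks, Fin.cons_succ, Fin.val_succ]; congr 1; push_cast; ring

/-- sum of Hamming costs on a first block and the rest -/
noncomputable def ccost (L B k : ℕ) (x y : (Fin L → Fin k) × (Fin B → Fin L → Fin k)) : ℝ :=
  ham L x.1 y.1 + ∑ b, ham L (x.2 b) (y.2 b)

lemma ccost_tri {L B k : ℕ} (x y z : (Fin L → Fin k) × (Fin B → Fin L → Fin k)) :
    ccost L B k x z ≤ ccost L B k x y + ccost L B k y z := by
  have h : ∑ b, ham L (x.2 b) (z.2 b) ≤ ∑ b, (ham L (x.2 b) (y.2 b) + ham L (y.2 b) (z.2 b)) :=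
    sum_le_sum fun b _ => ham_tri _ _ _
  rw [sum_add_distrib] at h
  have := ham_tri x.1 y.1 z.1
  unfold ccost
  linarith

lemma Flow.FB (hS : Flow μ S) [IsProbabilityMeasure μ] {g : Ω → Fin k} (hg : Measurable g)
    {L : ℕ} {ε : ℝ}
    (hA : ∀ B, ∃ e : (Fin B → Fin L → Fin k) → ℝ, ∑ φ, e φ ≤ ε ∧ ∀ φ, Cl (ham L)
      (fun a => lw μ (fun x => (wd S g 0 L x, blks S g L L B x)) (a, φ))
      (fun a => lw μ (wd S g 0 L) a * lw μ (blks S g L L B) φ) (e φ)) (B : ℕ) :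
    Cl (fun y y' : Fin B → Fin L → Fin k => ∑ b, ham L (y b) (y' b)) (lw μ (blks S g L 0 B))
      (fun y => ∏ b, lw μ (wd S g 0 L) (y b)) (B * ε) := by
  induction B with
  | zero =>
    have h := Cl.refl' (c := fun y y' : Fin 0 → Fin L → Fin k => ∑ b, ham L (y b) (y' b))
      (lw_nonneg μ (blks S g L 0 0)) (by simp)
    convert h using 1
    · ext y
      have : blks S g L 0 0 ⁻¹' {y} = Set.univ := by
        ext x; simp [Subsingleton.elim (blks S g L 0 0 x) y]
      simp [lw, this]
    · simp
  | succ B ih =>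
    obtain ⟨e, he, hcl⟩ := hA B
    set p := lw μ (wd S g 0 L) with hp
    have hp0 : ∀ a, 0 ≤ p a := lw_nonneg _ _
    have hp1 : ∑ a, p a = 1 := by rw [sum_lw μ (hS.measurable_wd hg 0 L)]; simp
    let E : (Fin L → Fin k) × (Fin B → Fin L → Fin k) ≃ (Fin (B + 1) → Fin L → Fin k) :=
      Fin.consEquiv fun _ => Fin L → Fin k
    have c1 : Cl (ccost L B k) (fun x => lw μ (fun x => (wd S g 0 L x, blks S g L L B x)) (x.1, x.2))
        (fun x => p x.1 * lw μ (blks S g L L B) x.2) (∑ φ, e φ) :=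
      Cl.slice' (S := Fin B → Fin L → Fin k) (c := fun _ => ham L) hcl
        (fun u a b => by simp [ccost, ham_self])
    have hst : lw μ (blks S g L L B) = lw μ (blks S g L 0 B) := by
      rw [← hS.lw_shift (hS.measurable_blks hg L 0 B) L]
      simp_rw [hS.blks_shift, zero_add]
    rw [hst] at c1
    have ihs : ∀ a, Cl (fun y y' : Fin B → Fin L → Fin k => ∑ b, ham L (y b) (y' b))
        (fun u => p a * lw μ (blks S g L 0 B) u) (fun u => p a * ∏ b, p (u b))
        (p a * (B * ε)) := fun a => by
      have := ih.smul (hp0 a)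
      exact this
    have c2 : Cl (ccost L B k) (fun x => p x.1 * lw μ (blks S g L 0 B) x.2)
        (fun x => p x.1 * ∏ b, p (x.2 b)) (∑ a, p a * (B * ε)) :=
      Cl.slice (S := Fin L → Fin k) (A := Fin B → Fin L → Fin k)
        (B := Fin B → Fin L → Fin k) (c := fun _ y y' => ∑ b, ham L (y b) (y' b))
        (p := fun a u => p a * lw μ (blks S g L 0 B) u) (q := fun a u => p a * ∏ b, p (u b))
        (e := fun a => p a * (B * ε))
        ihs (fun u a b => le_of_eq (by unfold ccost; simp only [ham_self, zero_add]))
    rw [← sum_mul, hp1, one_mul] at c2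
    have c3 := c1.trans (c₃ := ccost L B k) c2 ccost_tri
    have hle : ∑ φ, e φ + B * ε ≤ ((B + 1 : ℕ) : ℝ) * ε := by
      rw [Nat.cast_add, Nat.cast_one, add_mul, one_mul, add_comm]
      exact add_le_add le_rfl he
    have c4 := (c3.mono (fun _ _ => le_rfl) hle).equiv E.symm E.symm
    convert c4 using 1
    · ext y y'
      rw [Fin.sum_univ_succ]; rfl
    · ext y
      unfold lw
      congr 1
      ext x
      simp only [Set.mem_preimage, Set.mem_singleton_iff, blks_succ]
      rw [zero_add]
      have h := E.apply_eq_iff_eq_symm_apply (x := (wd S g 0 L x, blks S g L L B x)) (y := y)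
      exact h
    · ext y
      rw [Fin.prod_univ_succ]; rfl
end Dyn
end VWB

namespace VWB
open Finset MeasureTheory

section Dyn2
variable {Ω : Type*} [MeasurableSpace Ω] {μ : Measure Ω} {S : ℤ → Ω → Ω} {k : ℕ}

lemma int_ham [IsFiniteMeasure μ] {L : ℕ} {f f' : Ω → Fin L → Fin k} (hf : Measurable f)
    (hf' : Measurable f') {ε : ℝ} (hε : 0 ≤ ε) (h : ∀ r, μ.real {x | f x r ≠ f' x r} ≤ ε) :
    ∫ x, ham L (f x) (f' x) ∂μ ≤ ε := by
  unfold ham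
  rw [integral_const_mul]
  have hm : ∀ r, MeasurableSet {x | f x r ≠ f' x r} := fun r =>
    (measurableSet_eq_fun ((measurable_pi_apply r).comp hf)
      ((measurable_pi_apply r).comp hf')).compl
  have e : ∀ r, (fun x => if f x r = f' x r then (0 : ℝ) else 1) =
      Set.indicator {x | f x r ≠ f' x r} 1 := fun r => by
    ext x; by_cases h : f x r = f' x r <;> simp [Set.indicator, h]
  have hi : ∀ r, Integrable (fun x => if f x r = f' x r then (0 : ℝ) else 1) μ := fun r => by
    rw [e]; exact (integrable_indicator_iff (hm r)).2 (integrable_const (1 : ℝ)).integrableOn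
  rw [integral_finsetSum _ fun r _ => hi r]
  have : ∑ r, ∫ x, (if f x r = f' x r then (0 : ℝ) else 1) ∂μ ≤ L * ε := by
    calc _ ≤ ∑ r : Fin L, ε := sum_le_sum fun r _ => by
          rw [e, integral_indicator_one (hm r)]; exact h r
      _ = L * ε := by simp
  rcases Nat.eq_zero_or_pos L with rfl | hL
  · simpa using hε
  · rw [inv_mul_le_iff₀ (by exact_mod_cast hL)]; exact this

lemma Flow.diff (hS : Flow μ S) {g gm : Ω → Fin k} (hg : Measurable g)
    (hgm : Measurable gm) (t : ℤ) :
    μ.real {x | g (S t x) ≠ gm (S t x)} = μ.real {x | g x ≠ gm x} :=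
  (hS.mp t).measureReal_preimage (measurableSet_eq_fun hg hgm).compl.nullMeasurableSet

lemma Flow.blks_diff (hS : Flow μ S) [IsProbabilityMeasure μ] {g gm : Ω → Fin k}
    (hg : Measurable g) (hgm : Measurable gm) {ε : ℝ} (h : μ.real {x | g x ≠ gm x} ≤ ε)
    (L : ℕ) (t : ℤ) (B : ℕ) :
    ∫ x, ∑ b, ham L (blks S g L t B x b) (blks S gm L t B x b) ∂μ ≤ B * ε := by
  have hi : ∀ b, Integrable (fun x => ham L (blks S g L t B x b) (blks S gm L t B x b)) μ := by
    intro b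
    refine Integrable.of_bound (C := 1) ?_ (Filter.Eventually.of_forall fun x => ?_)
    · have : Measurable (fun x : (Fin L → Fin k) × (Fin L → Fin k) => ham L x.1 x.2) :=
        measurable_of_countable _
      exact (this.comp ((hS.measurable_wd hg _ _).prodMk
        (hS.measurable_wd hgm _ _))).aestronglyMeasurable
    · rw [Real.norm_of_nonneg (ham_nonneg _ _)]; exact ham_le_one _ _
  rw [integral_finsetSum _ fun b _ => hi b]
  calc _ ≤ ∑ b : Fin B, ε := sum_le_sum fun b _ => by
        refine int_ham (hS.measurable_wd hg _ _) (hS.measurable_wd hgm _ _)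
          (measureReal_nonneg.trans h) fun r => ?_
        exact (hS.diff hg hgm _).trans_le h
    _ = B * ε := by simp

lemma blks_eq (g : Ω → Fin k) (L : ℕ) (t : ℤ) (B : ℕ) (x : Ω) :
    blks S g L t B x = fun b r => wd S g t (B * L) x (finProdFinEquiv (b, r)) := by
  ext b r
  simp only [blks, wd, finProdFinEquiv_apply_val]
  congr 3; push_cast; ring

lemma Flow.main_large (hS : Flow μ S) [IsProbabilityMeasure μ] {g : Ω → Fin k} (hg : Measurable g)
    (hclaim : ∀ ε : ℝ, 0 < ε → ∃ gm : Ω → Fin k, Measurable gm ∧ μ.real {x | g x ≠ gm x} ≤ ε ∧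
      ∃ L : ℕ, 1 ≤ L ∧ ∀ B, ∃ e : (Fin B → Fin L → Fin k) → ℝ, ∑ φ, e φ ≤ ε ∧ ∀ φ, Cl (ham L)
      (fun a => lw μ (fun x => (wd S gm 0 L x, blks S gm L L B x)) (a, φ))
      (fun a => lw μ (wd S gm 0 L) a * lw μ (blks S gm L L B) φ) (e φ))
    {ε : ℝ} (hε : 0 < ε) :
    ∃ L : ℕ, 1 ≤ L ∧ ∃ n₀ : ℕ, ∀ n, n₀ ≤ n → 1 ≤ n / L ∧ (L : ℝ) / n ≤ ε ∧
      ∀ (m : ℕ) {Z : Type} [Fintype Z] [MeasurableSpace Z] [MeasurableSingletonClass Z]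
        (ψ : (Fin m → Fin k) → Z), ∃ e : Z → ℝ, ∑ z, e z ≤ ε ∧ ∀ z,
        Cl (fun y y' => ((n / L : ℕ) : ℝ)⁻¹ * ∑ b, ham L (y b) (y' b))
          (fun y => lw μ (fun x => (ψ (wd S g (1 - m) m x), blks S g L 1 (n / L) x)) (z, y))
          (fun y => lw μ (fun x => ψ (wd S g (1 - m) m x)) z * lw μ (blks S g L 1 (n / L)) y)
          (e z) := by
  obtain ⟨gm, hgm, hd, L, hL, hA⟩ := hclaim (ε / 12) (by positivity)
  have hL0 : (0 : ℝ) < L := by exact_mod_cast hL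
  obtain ⟨n₁, hn₁⟩ := hS.ent_bound hg (κ := ε / 3 * (ε / 3) / L) (by positivity)
  refine ⟨L, hL, L * (n₁ + 1) + ⌈L / ε⌉₊, fun n hn => ?_⟩
  have hB : n₁ + 1 ≤ n / L := by
    rw [Nat.le_div_iff_mul_le hL, mul_comm]; omega
  set B := n / L with hBdef
  have hB0 : (0 : ℝ) < B := by
    have : 0 < B := by omega
    exact_mod_cast this
  refine ⟨by omega, ?_, fun m Z _ _ _ ψ => ?_⟩
  · have h1 : (L : ℝ) / ε ≤ n := (Nat.le_ceil _).trans (by exact_mod_cast (by omega))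
    have hn0 : (0 : ℝ) < n := lt_of_lt_of_le (by positivity) h1
    rw [div_le_iff₀ hn0]
    rw [div_le_iff₀ hε] at h1
    linarith
  have hψ : Measurable (fun x => ψ (wd S g (1 - m) m x)) :=
    (measurable_of_countable ψ).comp (hS.measurable_wd hg _ _)
  have hX := hS.measurable_blks hg L 1 B
  have hZX := hψ.prodMk hX
  -- closeness to i.i.d.
  have f1 := hS.FB hgm hA B
  have hst : lw μ (blks S gm L 0 B) = lw μ (blks S gm L 1 B) := by
    rw [← hS.lw_shift (hS.measurable_blks hgm L 0 B) 1]
    simp_rw [hS.blks_shift, zero_add]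
  rw [hst] at f1
  have f2 := Cl.law μ hX (hS.measurable_blks hgm L 1 B)
    (c := fun y y' : Fin B → Fin L → Fin k => ∑ b, ham L (y b) (y' b)) (hS.blks_diff hg hgm hd L 1 B)
  have f3 := f2.trans f1 (c₃ := fun y y' : Fin B → Fin L → Fin k => ∑ b, ham L (y b) (y' b))
    fun a b d => by rw [← sum_add_distrib]; exact sum_le_sum fun b _ => ham_tri _ _ _
  -- information
  have hMI : MI (fun z y => lw μ (fun x => (ψ (wd S g (1 - m) m x), blks S g L 1 B x)) (z, y)) ≤
      ε / 3 * (ε / 3) * B := by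
    have g1 := hn₁ (B * L) (by nlinarith) m (1 - m)
    rw [sub_add_cancel] at g1
    have g2 := MI_law_mono μ (hS.measurable_wd hg (1 - m) m) (hS.measurable_wd hg 1 (B * L))
      (fun w => fun (b : Fin B) (r : Fin L) => w (finProdFinEquiv (b, r)))
    simp_rw [← blks_eq] at g2
    have g3 := MI_law_mono μ hX (hS.measurable_wd hg (1 - m) m) ψ
    rw [MI_law_symm μ hX hψ, MI_law_symm μ hX (hS.measurable_wd hg _ _)] at g3
    refine (g3.trans (g2.trans g1)).trans (le_of_eq ?_)
    push_cast
    field_simp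
  obtain ⟨e, he, hcl⟩ := extremal (c := ham L) (lw_nonneg μ (wd S gm 0 L))
    (by rw [sum_lw μ (hS.measurable_wd hgm 0 L)]; simp) ham_self ham_le_one ham_tri ham_comm
    (t := ε / 3) (by positivity) (n := B)
    (P := fun z y => lw μ (fun x => (ψ (wd S g (1 - m) m x), blks S g L 1 B x)) (z, y))
    (fun z y => lw_nonneg _ _ _)
    (by
      rw [← Fintype.sum_prod_type
        (f := fun y => lw μ (fun x => (ψ (wd S g (1 - m) m x), blks S g L 1 B x)) y),
        sum_lw μ hZX]; simp)
    (by simp_rw [lw_snd μ hψ hX]; exact f3)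
  simp_rw [lw_snd μ hψ hX, lw_fst μ hψ hX] at hcl
  refine ⟨fun z => (B : ℝ)⁻¹ * e z, ?_, fun z => ?_⟩
  · rw [← mul_sum, inv_mul_le_iff₀ hB0]
    refine he.trans ?_
    have := div_le_div_of_nonneg_right hMI (show 0 ≤ ε / 3 by positivity)
    have h2 : ε / 3 * (ε / 3) * B / (ε / 3) = ε / 3 * B := by field_simp
    rw [h2] at this
    linarith
  · obtain ⟨π, n, l, r, kk⟩ := hcl z
    refine ⟨π, n, l, r, ?_⟩
    have : ∀ a b, π a b * ((B : ℝ)⁻¹ * ∑ i, ham L (a i) (b i)) =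
      (B : ℝ)⁻¹ * (π a b * ∑ i, ham L (a i) (b i)) := fun a b => by ring
    simp_rw [this, ← mul_sum]
    exact mul_le_mul_of_nonneg_left kk (by positivity)
end Dyn2
end VWB

namespace VWB
open Finset MeasureTheory

section Rect
variable {Ω : Type*} [MeasurableSpace Ω] {A D ι : Type*} [Fintype A] [Fintype D] [Fintype ι]
  [MeasurableSpace A] [MeasurableSingletonClass A] [MeasurableSpace D] [MeasurableSingletonClass D]

lemma lw_restrict (μ : Measure Ω) {f : Ω → A} (hf : Measurable f) (Q : Set Ω) (a : A) :
    lw (μ.restrict Q) f a = μ.real (f ⁻¹' {a} ∩ Q) := by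
  unfold lw
  rw [measureReal_restrict_apply (hf (measurableSet_singleton a))]

lemma lw_pair_slice (μ : Measure Ω) {f : Ω → A} (hf : Measurable f) (g : Ω → D) (a : A) (d : D) :
    lw μ (fun x => (f x, g x)) (a, d) = lw (μ.restrict (g ⁻¹' {d})) f a := by
  rw [lw_restrict μ hf]
  unfold lw
  congr 1
  ext x; simp

lemma lw_pair_slice' (μ : Measure Ω) {f : Ω → A} (g : Ω → D) (hg : Measurable g) (a : A) (d : D) :
    lw μ (fun x => (f x, g x)) (a, d) = lw (μ.restrict (f ⁻¹' {a})) g d := by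
  rw [lw_restrict μ hg]
  unfold lw
  congr 1
  ext x; simp [and_comm]

lemma claimA2 (μ : Measure Ω) [IsProbabilityMeasure μ] {c : A → A → ℝ} (hc : ∀ a b, 0 ≤ c a b)
    (hc0 : ∀ a, c a a = 0) (hc1 : ∀ a b, c a b ≤ 1) (hct : ∀ a b d, c a d ≤ c a b + c b d)
    (hcs : ∀ a b, c a b = c b a)
    {V V' W' : Ω → A} {Φ : Ω → D} (hV : Measurable V) (hV' : Measurable V') (hW' : Measurable W')
    (hΦ : Measurable Φ) {Q : ι → Set Ω}
    (hQ : ∀ s, MeasurableSet s → ∑ i, μ.real (s ∩ Q i) = μ.real s)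
    {α δ η' ε'' : ℝ} (h1 : ∀ x, c (V x) (V' x) ≤ α) (h2 : ∫ x, c (V' x) (W' x) ∂μ ≤ δ)
    (h3 : ∑ i, ∑ a, ∑ φ, |lw (μ.restrict (Q i)) (fun x => (V' x, Φ x)) (a, φ) -
      lw (μ.restrict (Q i)) V' a * (lw (μ.restrict (Q i)) Φ φ / μ.real (Q i))| ≤ η')
    (h4 : ∑ i, ∑ a, |lw (μ.restrict (Q i)) W' a - lw μ W' a * μ.real (Q i)| ≤ ε'') :
    ∃ e : D → ℝ, ∑ φ, e φ ≤ 2 * α + 2 * δ + η' + ε'' ∧ ∀ φ, Cl c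
      (fun a => lw μ (fun x => (V x, Φ x)) (a, φ)) (fun a => lw μ V a * lw μ Φ φ) (e φ) := by
  classical
  have hsumD : ∀ b, ∑ i, lw (μ.restrict (Q i)) Φ b = lw μ Φ b := by
    intro b
    simp_rw [lw_restrict μ hΦ]
    exact hQ _ (hΦ (measurableSet_singleton b))
  have hsumP : ∀ b, ∑ i, lw (μ.restrict (Q i)) (fun x => (V' x, Φ x)) b =
      lw μ (fun x => (V' x, Φ x)) b := by
    intro b
    simp_rw [lw_restrict μ (hV'.prodMk hΦ)]
    exact hQ _ ((hV'.prodMk hΦ) (measurableSet_singleton b))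
  set w : ι → D → ℝ := fun i φ => lw (μ.restrict (Q i)) Φ φ / μ.real (Q i) with hw
  have hw0 : ∀ i φ, 0 ≤ w i φ := fun i φ => div_nonneg (lw_nonneg _ _ _) measureReal_nonneg
  have hmass : ∀ {B : Type _} [Fintype B] [MeasurableSpace B] [MeasurableSingletonClass B]
      (f : Ω → B) (_ : Measurable f) (i : ι), ∑ a, lw (μ.restrict (Q i)) f a = μ.real (Q i) := by
    intro B _ _ _ f hf i
    rw [sum_lw _ hf, measureReal_restrict_apply_univ]
  have hmassD : ∀ i, ∑ a, lw (μ.restrict (Q i)) Φ a = μ.real (Q i) := by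
    intro i
    rw [sum_lw _ hΦ, measureReal_restrict_apply_univ]
  have hwm : ∀ i φ, μ.real (Q i) * w i φ = lw (μ.restrict (Q i)) Φ φ := by
    intro i φ
    by_cases h : μ.real (Q i) = 0
    · rw [h, zero_mul]
      have := (sum_eq_zero_iff_of_nonneg fun a _ => lw_nonneg _ _ _).1 ((hmassD i).trans h) φ
        (Finset.mem_univ _)
      exact this.symm
    · simp only [hw]; field_simp
  have hw1 : ∀ i, ∑ φ, w i φ ≤ 1 := by
    intro i
    simp only [hw]
    rw [← sum_div, hmassD]; exact div_self_le_one _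
  have hΦ1 : ∑ φ, lw μ Φ φ = 1 := by rw [sum_lw μ hΦ]; simp
  set I : ι → ℝ := fun i => ∫ x, c (V' x) (W' x) ∂(μ.restrict (Q i)) with hI
  have hI0 : ∀ i, 0 ≤ I i := fun i => integral_nonneg fun x => hc _ _
  have hIs : ∑ i, I i ≤ δ := by
    refine le_trans (le_of_eq ?_) h2
    have : ∀ i, I i = ∑ y, lw (μ.restrict (Q i)) (fun x => (V' x, W' x)) y * c y.1 y.2 := fun i =>
      (sum_lw_mul _ (hV'.prodMk hW') (fun y => c y.1 y.2)).symm
    simp_rw [this]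
    rw [sum_comm]
    simp_rw [← sum_mul]
    have hs2 : ∀ y, ∑ i, lw (μ.restrict (Q i)) (fun x => (V' x, W' x)) y =
        lw μ (fun x => (V' x, W' x)) y := by
      intro b
      simp_rw [lw_restrict μ (hV'.prodMk hW')]
      exact hQ _ ((hV'.prodMk hW') (measurableSet_singleton b))
    simp_rw [hs2]
    exact sum_lw_mul _ (hV'.prodMk hW') (fun y => c y.1 y.2)
  have hα : ∀ (s : Set Ω), ∫ x, c (V x) (V' x) ∂(μ.restrict s) ≤ α * μ.real s := by
    intro s
    refine (integral_mono_of_nonneg (Filter.Eventually.of_forall fun x => hc _ _)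
      (integrable_const α) (Filter.Eventually.of_forall fun x => h1 x)).trans (le_of_eq ?_)
    simp [mul_comm]
  refine ⟨fun φ => α * lw μ Φ φ +
    (∑ i, ∑ a, |lw (μ.restrict (Q i)) (fun x => (V' x, Φ x)) (a, φ) -
      lw (μ.restrict (Q i)) V' a * w i φ|) + (∑ i, w i φ * I i) +
    (∑ i, w i φ * ∑ a, |lw (μ.restrict (Q i)) W' a - lw μ W' a * μ.real (Q i)|) +
    lw μ Φ φ * (δ + α), ?_, fun φ => ?_⟩
  · simp only [sum_add_distrib]
    rw [← mul_sum, ← sum_mul, hΦ1]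
    have k1 : ∑ φ, ∑ i, ∑ a, |lw (μ.restrict (Q i)) (fun x => (V' x, Φ x)) (a, φ) -
      lw (μ.restrict (Q i)) V' a * w i φ| ≤ η' := by
      refine le_trans (le_of_eq ?_) h3
      rw [sum_comm]
      exact sum_congr rfl fun i _ => sum_comm
    have k2 : ∀ (F : ι → ℝ), (∀ i, 0 ≤ F i) → ∑ φ, ∑ i, w i φ * F i ≤ ∑ i, F i := by
      intro F hF
      rw [sum_comm]
      refine sum_le_sum fun i _ => ?_
      rw [← sum_mul]
      exact mul_le_of_le_one_left (hF i) (hw1 i)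
    have k3 := k2 I hI0
    have k4 := k2 (fun i => ∑ a, |lw (μ.restrict (Q i)) W' a - lw μ W' a * μ.real (Q i)|)
      (fun i => sum_nonneg fun a _ => abs_nonneg _)
    linarith
  · have s0 : Cl c (fun a => lw μ (fun x => (V x, Φ x)) (a, φ))
        (fun a => lw μ (fun x => (V' x, Φ x)) (a, φ)) (α * lw μ Φ φ) := by
      simp_rw [lw_pair_slice μ hV, lw_pair_slice μ hV']
      exact Cl.law _ hV hV' (hα _)
    have s1 : Cl c (fun a => lw μ (fun x => (V' x, Φ x)) (a, φ))
        (fun a => ∑ i, lw (μ.restrict (Q i)) V' a * w i φ)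
        (∑ i, ∑ a, |lw (μ.restrict (Q i)) (fun x => (V' x, Φ x)) (a, φ) -
          lw (μ.restrict (Q i)) V' a * w i φ|) := by
      simp_rw [← hsumP]
      refine Cl.sum Finset.univ fun i => Cl.tv (fun a => lw_nonneg _ _ _)
        (fun a => mul_nonneg (lw_nonneg _ _ _) (hw0 i φ)) ?_ hc0 hc1
      rw [lw_snd _ hV' hΦ, ← sum_mul, hmass _ hV', hwm]
    have s2 : Cl c (fun a => ∑ i, lw (μ.restrict (Q i)) V' a * w i φ)
        (fun a => ∑ i, lw (μ.restrict (Q i)) W' a * w i φ) (∑ i, w i φ * I i) := by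
      have : ∀ i, Cl c (fun a => lw (μ.restrict (Q i)) V' a * w i φ)
        (fun a => lw (μ.restrict (Q i)) W' a * w i φ) (w i φ * I i) := fun i => by
        have := (Cl.law (μ.restrict (Q i)) hV' hW' (c := c) le_rfl).smul (hw0 i φ)
        simpa only [mul_comm (w i φ)] using this
      exact Cl.sum Finset.univ this
    have s3 : Cl c (fun a => ∑ i, lw (μ.restrict (Q i)) W' a * w i φ)
        (fun a => lw μ W' a * lw μ Φ φ)
        (∑ i, w i φ * ∑ a, |lw (μ.restrict (Q i)) W' a - lw μ W' a * μ.real (Q i)|) := by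
      have : ∀ i, Cl c (fun a => lw (μ.restrict (Q i)) W' a * w i φ)
        (fun a => lw μ W' a * μ.real (Q i) * w i φ)
        (w i φ * ∑ a, |lw (μ.restrict (Q i)) W' a - lw μ W' a * μ.real (Q i)|) := fun i => by
        have := (Cl.tv (c := c) (p := fun a => lw (μ.restrict (Q i)) W' a)
          (q := fun a => lw μ W' a * μ.real (Q i)) (fun a => lw_nonneg _ _ _)
          (fun a => mul_nonneg (lw_nonneg _ _ _) measureReal_nonneg)
          (by rw [hmass _ hW', ← sum_mul, sum_lw μ hW']; simp) hc0 hc1).smul (hw0 i φ)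
        convert this using 1
        · ext a; ring
        · ext a; ring
      have h := Cl.sum Finset.univ this
      convert h using 1
      ext a
      simp_rw [mul_assoc, hwm, ← mul_sum, hsumD]
    have s4 : Cl c (fun a => lw μ W' a * lw μ Φ φ) (fun a => lw μ V a * lw μ Φ φ)
        (lw μ Φ φ * (δ + α)) := by
      have a1 := Cl.law μ hV' hW' h2
      have a2 := Cl.law μ hV hV' (c := c) (e := α) (by simpa using hα Set.univ)
      have a3 := (a1.symm.trans (c₃ := c) a2.symm (fun a b d => by
        have := hct a b d; rw [hcs a b, hcs b d] at this; exact this)).smul (lw_nonneg μ Φ φ)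
      simpa only [mul_comm (lw μ Φ φ) (lw μ _ _)] using a3
    exact (((s0.trans s1 hct).trans s2 hct).trans s3 hct).trans s4 hct

lemma L1 (μ lam : Measure Ω) [IsProbabilityMeasure μ] [IsProbabilityMeasure lam] {R G : Set Ω}
    {η : ℝ} (hη : 0 < η) (hR : MeasurableSet R)
    (hG : MeasurableSet G) (hGR : G ⊆ R) (hR0 : 0 < μ.real R)
    (h1 : (1 - η) * μ.real R ≤ μ.real G) (h2 : 1 - η ≤ lam.real G)
    (h3 : ∀ S : Set Ω, S ⊆ G → MeasurableSet S → (1 - η) * lam.real S ≤ μ.real S / μ.real R ∧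
      μ.real S / μ.real R ≤ (1 + η) * lam.real S) {Y : Ω → A} (hY : Measurable Y) :
    ∑ a, |lw (μ.restrict R) Y a / μ.real R - lw lam Y a| ≤ 3 * η := by
  have hpt : ∀ a, |lw (μ.restrict R) Y a / μ.real R - lw lam Y a| ≤
      lw (μ.restrict (R \ G)) Y a / μ.real R + η * lw lam Y a + lw (lam.restrict Gᶜ) Y a := by
    intro a
    have hYa : MeasurableSet (Y ⁻¹' {a}) := hY (measurableSet_singleton a)
    obtain ⟨k1, k2⟩ := h3 (Y ⁻¹' {a} ∩ G) Set.inter_subset_right (hYa.inter hG)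
    rw [lw_restrict μ hY, lw_restrict μ hY, lw_restrict lam hY]
    have e1 : μ.real (Y ⁻¹' {a} ∩ R) = μ.real (Y ⁻¹' {a} ∩ G) + μ.real (Y ⁻¹' {a} ∩ (R \ G)) := by
      rw [← measureReal_union _ (hYa.inter (hR.diff hG))]
      · congr 1
        ext x
        have := @hGR x
        simp only [Set.mem_inter_iff, Set.mem_union, Set.mem_sdiff]
        tauto
      · rw [Set.disjoint_left]
        rintro x ⟨_, h⟩ ⟨_, _, h'⟩
        exact h' h
    have e2 : lw lam Y a = lam.real (Y ⁻¹' {a} ∩ G) + lam.real (Y ⁻¹' {a} ∩ Gᶜ) := by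
      unfold lw
      rw [← Set.sdiff_eq, measureReal_inter_add_sdiff hG]
    have n1 : 0 ≤ lam.real (Y ⁻¹' {a} ∩ G) := measureReal_nonneg
    have n2 : 0 ≤ lam.real (Y ⁻¹' {a} ∩ Gᶜ) := measureReal_nonneg
    have n3 : 0 ≤ μ.real (Y ⁻¹' {a} ∩ (R \ G)) / μ.real R := div_nonneg measureReal_nonneg hR0.le
    rw [e1, e2, add_div, abs_le]
    constructor <;> nlinarith
  refine (sum_le_sum fun a _ => hpt a).trans ?_
  rw [sum_add_distrib, sum_add_distrib, ← sum_div, ← mul_sum, sum_lw _ hY, sum_lw _ hY, sum_lw _ hY,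
    measureReal_restrict_apply_univ, measureReal_restrict_apply_univ, probReal_compl_eq_one_sub hG,
    measureReal_sdiff hGR hG]
  have : (μ.real R - μ.real G) / μ.real R ≤ η := by
    rw [div_le_iff₀ hR0]; linarith
  simp
  linarith

lemma L2 {J : A → D → ℝ} (hJ : ∀ a d, 0 ≤ J a d) (hJ1 : ∑ a, ∑ d, J a d = 1) {p : A → ℝ}
    {r : D → ℝ} (hp : ∀ a, 0 ≤ p a) (hp1 : ∑ a, p a = 1) (hr1 : ∑ d, r d = 1)
    {τ : ℝ} (h : ∑ a, ∑ d, |J a d - p a * r d| ≤ τ) :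
    ∑ a, ∑ d, |J a d - (∑ d', J a d') * ∑ a', J a' d| ≤ 3 * τ := by
  have b1 : ∑ a, |∑ d, J a d - p a| ≤ τ := by
    refine le_trans (sum_le_sum fun a _ => ?_) h
    have : ∑ d, J a d - p a = ∑ d, (J a d - p a * r d) := by
      rw [sum_sub_distrib, ← mul_sum, hr1, mul_one]
    rw [this]; exact abs_sum_le_sum_abs _ _
  have b2 : ∑ d, |∑ a, J a d - r d| ≤ τ := by
    rw [sum_comm] at h
    refine le_trans (sum_le_sum fun d _ => ?_) h
    have : ∑ a, J a d - r d = ∑ a, (J a d - p a * r d) := by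
      rw [sum_sub_distrib, ← sum_mul, hp1, one_mul]
    rw [this]; exact abs_sum_le_sum_abs _ _
  have hpt : ∀ a d, |J a d - (∑ d', J a d') * ∑ a', J a' d| ≤ |J a d - p a * r d| +
      |∑ d', J a d' - p a| * (∑ a', J a' d) + p a * |∑ a', J a' d - r d| := by
    intro a d
    have n1 : 0 ≤ ∑ a', J a' d := sum_nonneg fun a _ => hJ a d
    have : J a d - (∑ d', J a d') * ∑ a', J a' d = (J a d - p a * r d) +
      -((∑ d', J a d' - p a) * (∑ a', J a' d)) + -(p a * (∑ a', J a' d - r d)) := by ring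
    rw [this]
    refine (abs_add_three _ _ _).trans (le_of_eq ?_)
    rw [abs_neg, abs_neg, abs_mul, abs_mul, abs_of_nonneg n1, abs_of_nonneg (hp a)]
  refine (sum_le_sum fun a _ => sum_le_sum fun d _ => hpt a d).trans ?_
  simp_rw [sum_add_distrib, ← mul_sum, ← sum_mul, hp1]
  rw [sum_comm (f := fun i j => J j i), hJ1]
  linarith

lemma rect (μ lam : Measure Ω) [IsProbabilityMeasure μ] [IsProbabilityMeasure lam] {R G : Set Ω}
    {η : ℝ} (hη : 0 < η) (hR : MeasurableSet R)
    (hG : MeasurableSet G) (hGR : G ⊆ R) (hR0 : 0 < μ.real R)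
    (h1 : (1 - η) * μ.real R ≤ μ.real G) (h2 : 1 - η ≤ lam.real G)
    (h3 : ∀ S : Set Ω, S ⊆ G → MeasurableSet S → (1 - η) * lam.real S ≤ μ.real S / μ.real R ∧
      μ.real S / μ.real R ≤ (1 + η) * lam.real S) {V : Ω → A} {Φ : Ω → D} (hV : Measurable V)
    (hΦ : Measurable Φ)
    (hprod : ∀ a φ, lw lam (fun x => (V x, Φ x)) (a, φ) = lw lam V a * lw lam Φ φ) :
    ∑ a, ∑ φ, |lw (μ.restrict R) (fun x => (V x, Φ x)) (a, φ) -
      lw (μ.restrict R) V a * (lw (μ.restrict R) Φ φ / μ.real R)| ≤ 9 * η * μ.real R := by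
  have k1 := L1 μ lam hη hR hG hGR hR0 h1 h2 h3 (hV.prodMk hΦ)
  rw [Fintype.sum_prod_type] at k1
  simp_rw [hprod] at k1
  have k2 := L2 (J := fun a φ => lw (μ.restrict R) (fun x => (V x, Φ x)) (a, φ) / μ.real R)
    (fun a φ => div_nonneg (lw_nonneg _ _ _) hR0.le)
    (by
      simp_rw [← sum_div]
      rw [← Fintype.sum_prod_type (f := lw (μ.restrict R) (fun x => (V x, Φ x))),
        sum_lw _ (hV.prodMk hΦ), measureReal_restrict_apply_univ, div_self hR0.ne'])
    (p := lw lam V) (r := lw lam Φ) (lw_nonneg _ _) (by rw [sum_lw _ hV]; simp)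
    (by rw [sum_lw _ hΦ]; simp) k1
  simp_rw [← sum_div, lw_fst _ hV hΦ, lw_snd _ hV hΦ] at k2
  have k3 := mul_le_mul_of_nonneg_right k2 hR0.le
  simp_rw [sum_mul] at k3
  refine le_trans (le_of_eq ?_) (k3.trans (le_of_eq (by ring)))
  refine sum_congr rfl fun a _ => sum_congr rfl fun φ _ => ?_
  rw [← abs_of_pos hR0, ← abs_mul, abs_of_pos hR0]
  congr 1
  field_simp

lemma rest_le (μ : Measure Ω) [IsProbabilityMeasure μ] (Q : Set Ω) {V : Ω → A} {Φ : Ω → D}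
    (hV : Measurable V) (hΦ : Measurable Φ) :
    ∑ a, ∑ φ, |lw (μ.restrict Q) (fun x => (V x, Φ x)) (a, φ) -
      lw (μ.restrict Q) V a * (lw (μ.restrict Q) Φ φ / μ.real Q)| ≤ 2 * μ.real Q := by
  have : ∀ a φ, |lw (μ.restrict Q) (fun x => (V x, Φ x)) (a, φ) -
      lw (μ.restrict Q) V a * (lw (μ.restrict Q) Φ φ / μ.real Q)| ≤
      lw (μ.restrict Q) (fun x => (V x, Φ x)) (a, φ) +
      lw (μ.restrict Q) V a * (lw (μ.restrict Q) Φ φ / μ.real Q) := fun a φ => by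
    have n1 := lw_nonneg (μ.restrict Q) (fun x => (V x, Φ x)) (a, φ)
    have n2 : 0 ≤ lw (μ.restrict Q) V a * (lw (μ.restrict Q) Φ φ / μ.real Q) :=
      mul_nonneg (lw_nonneg _ _ _) (div_nonneg (lw_nonneg _ _ _) measureReal_nonneg)
    rw [abs_le]; constructor <;> linarith
  refine (sum_le_sum fun a _ => sum_le_sum fun φ _ => this a φ).trans ?_
  simp_rw [sum_add_distrib, ← mul_sum, ← sum_mul, ← sum_div, lw_fst _ hV hΦ]
  rw [sum_lw _ hV, sum_lw _ hΦ, measureReal_restrict_apply_univ]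
  have h0 : 0 ≤ μ.real Q := measureReal_nonneg
  have := mul_le_of_le_one_right h0 (div_self_le_one (μ.real Q))
  linarith
end Rect
end VWB

namespace VWB
open Finset MeasureTheory Subshift

section Conc
variable {q k : ℕ} (T : Fin q → Fin q → Prop)

/-- integer powers of the shift -/
def sh (t : ℤ) (x : SigmaT T) : SigmaT T :=
  ⟨fun i => x.1 (i + t), fun i => by
    have := x.2 (i + t)
    show T (x.1 (i + t)) (x.1 (i + 1 + t))
    rw [show i + 1 + t = i + t + 1 by ring]
    exact this⟩

lemma sh_add (s t : ℤ) (x : SigmaT T) : sh T s (sh T t x) = sh T (s + t) x := by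
  apply Subtype.ext; funext i; simp only [sh]; ring_nf

lemma sh_zero (x : SigmaT T) : sh T 0 x = x := by
  apply Subtype.ext; funext i; simp [sh]

lemma shift_eq : shift T = sh T 1 := rfl
lemma shiftInv_eq : shiftInv T = sh T (-1) := rfl

lemma sh_iter (t : ℤ) (n : ℕ) (x : SigmaT T) : (sh T t)^[n] x = sh T (n * t) x := by
  induction n generalizing x with
  | zero => simp [sh_zero]
  | succ n ih => rw [Function.iterate_succ_apply, ih, sh_add]; congr 1; push_cast; ring

lemma measurable_coord (i : ℤ) : Measurable (fun x : SigmaT T => x.1 i) :=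
  (measurable_pi_apply i).comp measurable_subtype_coe

lemma measurable_sh (t : ℤ) : Measurable (sh T t) :=
  Measurable.subtype_mk (measurable_pi_lambda _ fun i => measurable_coord T (i + t))

lemma flow_sh (μ : Measure (SigmaT T))
    (hinv : ∀ A : Set (SigmaT T), MeasurableSet A → μ (shift T ⁻¹' A) = μ A) :
    Flow μ (sh T) := by
  have h1 : MeasurePreserving (sh T 1) μ μ := ⟨measurable_sh T 1, by
    ext A hA; rw [Measure.map_apply (measurable_sh T 1) hA]; exact hinv A hA⟩
  have hn : ∀ n : ℕ, MeasurePreserving (sh T n) μ μ := fun n => by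
    have := h1.iterate n
    convert this using 1
    ext1 x; rw [sh_iter]; simp
  have hneg : ∀ n : ℕ, MeasurePreserving (sh T (-n)) μ μ := fun n => ⟨measurable_sh T _, by
    ext A hA
    rw [Measure.map_apply (measurable_sh T _) hA,
      ← (hn n).measure_preimage (measurable_sh T _ hA).nullMeasurableSet]
    congr 1
    ext x
    simp [sh_add, sh_zero]⟩
  refine ⟨sh_add T, fun t => ?_⟩
  rcases Int.eq_nat_or_neg t with ⟨n, rfl | rfl⟩
  exacts [hn n, hneg n]

/-- names of the atoms of the join -/
def Zmap (ℓ : SigmaT T → Fin k) (m₁ m₂ : ℕ) (x : SigmaT T) : ↥(Finset.Icc m₁ m₂) → Fin k :=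
  fun j => ℓ (sh T (-((j : ℕ) : ℤ)) x)

lemma measurable_Zmap {ℓ : SigmaT T → Fin k} (hℓ : Measurable ℓ) (m₁ m₂ : ℕ) :
    Measurable (Zmap T ℓ m₁ m₂) :=
  measurable_pi_lambda _ fun _ => hℓ.comp (measurable_sh T _)

lemma joinAtom_eq (ℓ : SigmaT T → Fin k) (m₁ m₂ : ℕ) (a : ℕ → Fin k) :
    joinAtom T ℓ m₁ m₂ a = Zmap T ℓ m₁ m₂ ⁻¹' {fun j : ↥(Finset.Icc m₁ m₂) => a j} := by
  ext x
  simp only [joinAtom, Set.mem_setOf_eq, Set.mem_preimage, Set.mem_singleton_iff, Zmap,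
    shiftInv_eq, sh_iter, mul_neg, mul_one]
  constructor
  · intro h; funext j
    exact h j (Finset.mem_Icc.1 j.2).1 (Finset.mem_Icc.1 j.2).2
  · intro h j h1 h2
    exact congrFun h ⟨j, Finset.mem_Icc.2 ⟨h1, h2⟩⟩

open Classical in
lemma aeAtoms_iff (μ : Measure (SigmaT T)) [IsProbabilityMeasure μ] {ℓ : SigmaT T → Fin k}
    (hℓ : Measurable ℓ) (m₁ m₂ : ℕ) (ε : ℝ) (P : Set (SigmaT T) → Prop) :
    AeAtoms T μ ℓ m₁ m₂ ε P ↔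
      ∑ z, (if P (Zmap T ℓ m₁ m₂ ⁻¹' {z}) then 0 else lw μ (Zmap T ℓ m₁ m₂) z) ≤ ε := by
  have hset : (⋃ a ∈ {a : ℕ → Fin k | (joinAtom T ℓ m₁ m₂ a).Nonempty ∧
      ¬P (joinAtom T ℓ m₁ m₂ a)}, joinAtom T ℓ m₁ m₂ a) =
      ⋃ z ∈ Finset.univ.filter (fun z => ¬ P (Zmap T ℓ m₁ m₂ ⁻¹' {z})), Zmap T ℓ m₁ m₂ ⁻¹' {z} := by
    ext x
    simp only [Set.mem_iUnion, Set.mem_setOf_eq, Finset.mem_filter, Finset.mem_univ, true_and]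
    constructor
    · rintro ⟨a, ⟨_, h⟩, hx⟩
      rw [joinAtom_eq] at h hx
      exact ⟨_, h, hx⟩
    · rintro ⟨z, h, hx⟩
      have hz : z = Zmap T ℓ m₁ m₂ x := by simpa using hx.symm
      subst hz
      have e := joinAtom_eq T ℓ m₁ m₂ (fun j => ℓ (sh T (-(j : ℤ)) x))
      have e2 : joinAtom T ℓ m₁ m₂ (fun j => ℓ (sh T (-(j : ℤ)) x)) =
        Zmap T ℓ m₁ m₂ ⁻¹' {Zmap T ℓ m₁ m₂ x} := e
      refine ⟨fun j => ℓ (sh T (-(j : ℤ)) x), ⟨?_, ?_⟩, ?_⟩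
      · rw [e2]; exact ⟨x, hx⟩
      · rw [e2]; exact h
      · rw [e2]; exact hx
  unfold AeAtoms
  rw [hset]
  have := measureReal_biUnion_finset (μ := μ)
    (s := Finset.univ.filter (fun z => ¬ P (Zmap T ℓ m₁ m₂ ⁻¹' {z})))
    (f := fun z => Zmap T ℓ m₁ m₂ ⁻¹' {z})
    (fun z _ w _ hzw => Disjoint.preimage _ (by simpa using hzw))
    (fun z _ => measurable_Zmap T hℓ m₁ m₂ (measurableSet_singleton z))
  change μ.real _ ≤ ε ↔ _
  rw [this, Finset.sum_filter]
  simp only [ite_not]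
  rfl

lemma KM (μ : Measure (SigmaT T)) [IsProbabilityMeasure μ] {ℓ : SigmaT T → Fin k}
    (hℓ : Measurable ℓ) (hK : KMixing T μ ℓ) {ε' : ℝ} (hε : 0 < ε') {n : ℕ}
    {Q : Fin n → Set (SigmaT T)} (hQ : ∀ i, MeasurableSet (Q i)) :
    ∃ N : ℕ, ∀ m₁ m₂ : ℕ, N ≤ m₁ → m₁ ≤ m₂ → ∀ i,
      ∑ z, |lw (μ.restrict (Q i)) (Zmap T ℓ m₁ m₂) z - lw μ (Zmap T ℓ m₁ m₂) z * μ.real (Q i)|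
        ≤ 2 * ε' := by
  classical
  obtain ⟨N, hN⟩ := hK ε' hε n Q hQ
  refine ⟨N, fun m₁ m₂ h1 h2 i => ?_⟩
  have h := hN m₁ m₂ h1 h2
  rw [aeAtoms_iff T μ hℓ] at h
  have hZ := measurable_Zmap T hℓ m₁ m₂
  set Z := Zmap T ℓ m₁ m₂
  have hpt : ∀ z, |lw (μ.restrict (Q i)) Z z - lw μ Z z * μ.real (Q i)| ≤ ε' * lw μ Z z +
      (if ∀ i, |(μ (Z ⁻¹' {z} ∩ Q i)).toReal / (μ (Z ⁻¹' {z})).toReal - (μ (Q i)).toReal| ≤ ε'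
        then 0 else lw μ Z z) := by
    intro z
    rw [lw_restrict μ hZ]
    have n0 : 0 ≤ lw μ Z z := lw_nonneg _ _ _
    have n1 : μ.real (Z ⁻¹' {z} ∩ Q i) ≤ lw μ Z z := measureReal_mono Set.inter_subset_left
    have n2 : 0 ≤ μ.real (Z ⁻¹' {z} ∩ Q i) := measureReal_nonneg
    have n3 : μ.real (Q i) ≤ 1 := measureReal_le_one
    have n4 : 0 ≤ μ.real (Q i) := measureReal_nonneg
    split_ifs with hh
    · have hi := hh i
      change |μ.real (Z ⁻¹' {z} ∩ Q i) / lw μ Z z - μ.real (Q i)| ≤ ε' at hi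
      rcases n0.eq_or_lt with h0 | h0
      · rw [← h0] at n1 ⊢
        have : μ.real (Z ⁻¹' {z} ∩ Q i) = 0 := le_antisymm n1 n2
        simp [this]
      · have h5 := mul_le_mul_of_nonneg_right hi n0
        rw [← abs_of_nonneg n0, ← abs_mul, abs_of_nonneg n0, sub_mul, div_mul_cancel₀ _ h0.ne'] at h5
        rw [mul_comm (lw μ Z z) (μ.real (Q i)), add_zero]; exact h5
    · have h6 : 0 ≤ ε' * lw μ Z z := by positivity
      have h7 : lw μ Z z * μ.real (Q i) ≤ lw μ Z z := mul_le_of_le_one_right n0 n3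
      have h8 : 0 ≤ lw μ Z z * μ.real (Q i) := by positivity
      rw [abs_le]; constructor <;> linarith
  refine (sum_le_sum fun z _ => hpt z).trans ?_
  rw [sum_add_distrib, ← mul_sum, sum_lw μ hZ]
  simp only [probReal_univ, mul_one]
  have h' : ∑ z, (if ∀ i, |(μ (Z ⁻¹' {z} ∩ Q i)).toReal / (μ (Z ⁻¹' {z})).toReal - (μ (Q i)).toReal| ≤ ε'
        then 0 else lw μ Z z) ≤ ε' := by convert h
  linarith

lemma tv_comp {Ω A B : Type*} [MeasurableSpace Ω] [Fintype A] [Fintype B]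
    [MeasurableSpace A] [MeasurableSingletonClass A] [MeasurableSpace B]
    [MeasurableSingletonClass B] (μ ν : Measure Ω) [IsFiniteMeasure μ] [IsFiniteMeasure ν] (c : ℝ)
    {Z : Ω → A} (hZ : Measurable Z) (ψ : A → B) :
    ∑ b, |lw ν (fun x => ψ (Z x)) b - lw μ (fun x => ψ (Z x)) b * c| ≤
      ∑ a, |lw ν Z a - lw μ Z a * c| := by
  classical
  simp_rw [lw_comp _ hZ ψ]
  calc _ ≤ ∑ b, ∑ a, if ψ a = b then |lw ν Z a - lw μ Z a * c| else 0 := by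
        refine sum_le_sum fun b _ => ?_
        rw [sum_mul, ← sum_sub_distrib]
        refine (abs_sum_le_sum_abs _ _).trans (sum_le_sum fun a _ => ?_)
        split_ifs <;> simp
    _ = _ := by rw [sum_comm]; simp

/-- the central window of radius `m` -/
def win (m : ℕ) (x : SigmaT T) : Fin (2 * m + 1) → Fin q := fun i => x.1 ((i : ℕ) - (m : ℤ))

lemma measurable_win (m : ℕ) : Measurable (win T m) :=
  measurable_pi_lambda _ fun _ => measurable_coord T _

lemma win_eq {m : ℕ} {x y : SigmaT T} (h : win T m x = win T m y) {i : ℤ} (hi : |i| ≤ m) :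
    x.1 i = y.1 i := by
  rw [abs_le] at hi
  have := congrFun h ⟨(i + m).toNat, by omega⟩
  simp only [win] at this
  rwa [show (((i + m).toNat : ℕ) : ℤ) - m = i by omega] at this

lemma win_nhds {x : SigmaT T} {U : Set (SigmaT T)} (hU : U ∈ nhds x) :
    ∃ m, ∀ y, win T m y = win T m x → y ∈ U := by
  rw [nhds_induced, Filter.mem_comap] at hU
  obtain ⟨u, hu, huU⟩ := hU
  obtain ⟨v, hvu, hv, hxv⟩ := mem_nhds_iff.1 hu
  obtain ⟨I, w, hw, hIv⟩ := isOpen_pi_iff.1 hv _ hxv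
  refine ⟨I.sup Int.natAbs, fun y hy => huU (hvu (hIv fun i hi => ?_))⟩
  have : y.1 i = x.1 i := win_eq T hy (by
    have : i.natAbs ≤ I.sup Int.natAbs := Finset.le_sup (f := Int.natAbs) hi
    rw [abs_le]; constructor <;> omega)
  rw [this]; exact (hw i hi).2

lemma approx (μ : Measure (SigmaT T)) [IsProbabilityMeasure μ] {ℓ : SigmaT T → Fin k}
    (hℓ : Measurable ℓ) (d0 : Fin k) {C₀ : ℝ} (hsb : SmallBoundary T μ ℓ C₀) {δ : ℝ} (hδ : 0 < δ) :
    ∃ (m : ℕ) (Gf : (Fin (2 * m + 1) → Fin q) → Fin k),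
      μ.real {x | ℓ x ≠ Gf (win T m x)} ≤ δ := by
  classical
  have hb : μ (partitionBoundary T ℓ) = 0 := by
    have h1 : ∀ r : ℝ, 0 < r → μ.real (partitionBoundary T ℓ) ≤ C₀ * r := fun r hr =>
      (measureReal_mono (s₂ := {x | ∃ y ∈ partitionBoundary T ℓ, sdist T x y < r})
        (fun x hx => ⟨x, hx, by simpa [sdist] using hr⟩)).trans (hsb.2 r hr)
    have h2 : μ.real (partitionBoundary T ℓ) ≤ 0 := by
      refine le_of_forall_pos_le_add fun e he => ?_
      have := h1 (e / C₀) (div_pos he hsb.1)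
      rwa [mul_div_cancel₀ _ hsb.1.ne', ← zero_add e] at this
    have := le_antisymm h2 measureReal_nonneg
    rwa [measureReal_eq_zero_iff] at this
  let Bm : ℕ → Set (SigmaT T) := fun m => {x | ∃ x', win T m x' = win T m x ∧ ℓ x' ≠ ℓ x}
  have hBm : ∀ m, MeasurableSet (Bm m) := fun m =>
    ((measurable_win T m).prodMk hℓ)
      (MeasurableSet.of_discrete (s := {y : (Fin (2 * m + 1) → Fin q) × Fin k | ∃ x', win T m x' = y.1 ∧ ℓ x' ≠ y.2}))
  have hanti : Antitone Bm := by
    intro m m' h x hx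
    obtain ⟨x', h1, h2⟩ := hx
    refine ⟨x', ?_, h2⟩
    funext i
    refine win_eq T h1 (i := (i : ℕ) - (m : ℤ)) ?_
    have := i.2
    rw [abs_le]; constructor <;> omega
  have hsub : ⋂ m, Bm m ⊆ partitionBoundary T ℓ := by
    intro x hx
    refine Set.mem_iUnion.2 ⟨ℓ x, subset_closure rfl, fun hint => ?_⟩
    obtain ⟨m, hm⟩ := win_nhds T (mem_interior_iff_mem_nhds.1 hint)
    obtain ⟨x', h1, h2⟩ := Set.mem_iInter.1 hx m
    exact h2 (hm x' h1)
  have h0 : μ (⋂ m, Bm m) = 0 := measure_mono_null hsub hb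
  have hlim := tendsto_measure_iInter_atTop (μ := μ) (fun m => (hBm m).nullMeasurableSet) hanti
    ⟨0, measure_ne_top _ _⟩
  rw [h0] at hlim
  have hlim2 : Filter.Tendsto (fun m => μ.real (Bm m)) Filter.atTop (nhds 0) := by
    have := (ENNReal.tendsto_toReal ENNReal.zero_ne_top).comp hlim
    exact this
  obtain ⟨m, hm⟩ := (hlim2.eventually (gt_mem_nhds hδ)).exists
  refine ⟨m, fun y => if h : ∃ x, win T m x = y then ℓ h.choose else d0, ?_⟩
  refine (measureReal_mono fun x hx => ?_).trans hm.le
  have hex : ∃ x', win T m x' = win T m x := ⟨x, rfl⟩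
  simp only [Set.mem_setOf_eq, dif_pos hex] at hx
  exact ⟨hex.choose, hex.choose_spec, hx.symm⟩
end Conc
end VWB

namespace VWB
open Finset MeasureTheory Subshift

section Conc8
variable {q k : ℕ} (T : Fin q → Fin q → Prop)

lemma measurable_pastFuture : Measurable (pastFuture T) :=
  (measurable_pi_lambda _ fun _ => measurable_coord T _).prodMk
    (measurable_pi_lambda _ fun _ => measurable_coord T _)

lemma lw_product {A D : Type*} [Fintype A] [Fintype D] [MeasurableSpace A]
    [MeasurableSingletonClass A] [MeasurableSpace D] [MeasurableSingletonClass D]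
    (lam : Measure (SigmaT T)) {R : Set (SigmaT T)}
    (h : IsNonatomicProduct T lam R) {v : ({j : ℤ // j ≤ 0} → Fin q) → A}
    {f : ({j : ℤ // 0 ≤ j} → Fin q) → D} (hv : Measurable v) (hf : Measurable f) (a : A) (φ : D) :
    lw lam (fun x => (v (pastFuture T x).1, f (pastFuture T x).2)) (a, φ) =
      lw lam (fun x => v (pastFuture T x).1) a * lw lam (fun x => f (pastFuture T x).2) φ := by
  obtain ⟨_, _, ρ, ν, h1, h2, _, _, _, h3⟩ := h
  have hP := measurable_pastFuture T
  have hva := hv (measurableSet_singleton a)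
  have hfa := hf (measurableSet_singleton φ)
  have e1 : lam ((fun x => (v (pastFuture T x).1, f (pastFuture T x).2)) ⁻¹' {(a, φ)}) =
      ρ (v ⁻¹' {a}) * ν (f ⁻¹' {φ}) := by
    rw [← Measure.prod_prod, ← h3, Measure.map_apply hP (hva.prod hfa)]
    congr 1; ext x; simp
  have e2 : lam ((fun x => v (pastFuture T x).1) ⁻¹' {a}) = ρ (v ⁻¹' {a}) := by
    have : ρ (v ⁻¹' {a}) = (ρ.prod ν) ((v ⁻¹' {a}) ×ˢ Set.univ) := by
      rw [Measure.prod_prod]; simp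
    rw [this, ← h3, Measure.map_apply hP (hva.prod MeasurableSet.univ)]
    congr 1; ext x; simp
  have e3 : lam ((fun x => f (pastFuture T x).2) ⁻¹' {φ}) = ν (f ⁻¹' {φ}) := by
    have : ν (f ⁻¹' {φ}) = (ρ.prod ν) (Set.univ ×ˢ (f ⁻¹' {φ})) := by
      rw [Measure.prod_prod]; simp
    rw [this, ← h3, Measure.map_apply hP (MeasurableSet.univ.prod hfa)]
    congr 1; ext x; simp
  simp only [lw, Measure.real, e1, e2, e3, ENNReal.toReal_mul]

/-- truncated word -/
def tw (g : SigmaT T → Fin k) (d0 : Fin k) (m N L : ℕ) (x : SigmaT T) : Fin L → Fin k :=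
  fun r => if (r : ℕ) + m + N ≤ L then g (sh T ((m : ℤ) - L + (r : ℕ)) x) else d0

lemma measurable_tw {g : SigmaT T → Fin k} (hg : Measurable g) (d0 : Fin k) (m N L : ℕ) :
    Measurable (tw T g d0 m N L) := by
  refine measurable_pi_lambda _ fun r => ?_
  unfold tw
  by_cases h : (r : ℕ) + m + N ≤ L
  · simp only [h, if_true]; exact hg.comp (measurable_sh T _)
  · simp only [h, if_false]; exact measurable_const

lemma ham_tw (g : SigmaT T → Fin k) (d0 : Fin k) (m N L : ℕ) (x : SigmaT T) :
    ham L (wd (sh T) g ((m : ℤ) - L) L x) (tw T g d0 m N L x) ≤ ((m + N : ℕ) : ℝ) / L := by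
  unfold ham
  rw [div_eq_inv_mul]
  refine mul_le_mul_of_nonneg_left ?_ (by positivity)
  calc _ ≤ ∑ r : Fin L, if (r : ℕ) + m + N ≤ L then (0 : ℝ) else 1 := by
        refine sum_le_sum fun r _ => ?_
        by_cases h : (r : ℕ) + m + N ≤ L
        · simp [wd, tw, h]
        · simp only [h, if_false]; split_ifs <;> simp
    _ = ∑ r ∈ Finset.range L, if r + m + N ≤ L then (0 : ℝ) else 1 :=
        Fin.sum_univ_eq_sum_range (fun r : ℕ => if r + m + N ≤ L then (0 : ℝ) else 1) L
    _ = (((Finset.range L).filter (fun r => ¬ (r + m + N ≤ L))).card : ℝ) := by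
        rw [← Finset.sum_boole]; simp only [ite_not]
    _ ≤ _ := by
        have : (Finset.range L).filter (fun r => ¬ (r + m + N ≤ L)) ⊆
            (Finset.Ico (L - (m + N)) L) := by
          intro r hr
          simp only [Finset.mem_filter, Finset.mem_range, Finset.mem_Ico] at hr ⊢
          omega
        have := Finset.card_le_card this
        rw [Nat.card_Ico] at this
        exact_mod_cast this.trans (by omega)

lemma claimA3 (μ : Measure (SigmaT T)) [IsProbabilityMeasure μ] (hne : Nonempty (SigmaT T))
    (hinv : ∀ A : Set (SigmaT T), MeasurableSet A → μ (shift T ⁻¹' A) = μ A)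
    {ℓ : SigmaT T → Fin k} (hℓ : Measurable ℓ)
    {C₀ : ℝ} (hsb : SmallBoundary T μ ℓ C₀)
    (hK : KMixing T μ ℓ)
    (hcov : ∀ η : ℝ, 0 < η → η < 1 → ∀ δ' : ℝ, 0 < δ' →
      ∃ (n : ℕ) (R : Fin n → Set (SigmaT T)) (lam : Fin n → Measure (SigmaT T))
        (G : Fin n → Set (SigmaT T)),
        IsRegularCovering T μ η R lam G ∧
        (∀ i, ∀ x ∈ R i, ∀ y ∈ R i, sdist T x y < δ') ∧
        (∀ i, IsNonatomicProduct T (lam i) (R i)))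
    (ε : ℝ) (hε : 0 < ε) :
    ∃ gm : SigmaT T → Fin k, Measurable gm ∧ μ.real {x | ℓ x ≠ gm x} ≤ ε ∧
      ∃ L : ℕ, 1 ≤ L ∧ ∀ B, ∃ e : (Fin B → Fin L → Fin k) → ℝ, ∑ φ, e φ ≤ ε ∧ ∀ φ, Cl (ham L)
      (fun a => lw μ (fun x => (wd (sh T) gm 0 L x, blks (sh T) gm L L B x)) (a, φ))
      (fun a => lw μ (wd (sh T) gm 0 L) a * lw μ (blks (sh T) gm L L B) φ) (e φ) := by
  have hS := flow_sh T μ hinv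
  let d0 : Fin k := ℓ hne.some
  obtain ⟨m, Gf, hGf⟩ := approx T μ hℓ d0 hsb (δ := ε / 8) (by positivity)
  set gm : SigmaT T → Fin k := fun x => Gf (win T m x) with hgm_def
  have hgm : Measurable gm := (measurable_of_finite Gf).comp (measurable_win T m)
  have hη : 0 < min (ε / 44) (1 / 2) := by positivity
  obtain ⟨n, R, lam, Gs, hreg, -, hprod⟩ := hcov (min (ε / 44) (1 / 2)) hη
    (lt_of_le_of_lt (min_le_right _ _) (by norm_num)) 2 (by norm_num)
  have hη44 : min (ε / 44) (1 / 2) ≤ ε / 44 := min_le_left _ _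
  set η := min (ε / 44) (1 / 2)
  obtain ⟨-, hRm, hRd, hR0, hlp, -, hGm, hGR, hcover, hG1, hG2, hG3, -⟩ := hreg
  let Q : Fin (n + 1) → Set (SigmaT T) := Fin.cons (⋃ i, R i)ᶜ R
  have hUm : MeasurableSet (⋃ i, R i) := MeasurableSet.iUnion hRm
  have hQm : ∀ i, MeasurableSet (Q i) := by
    intro i
    refine Fin.cases ?_ (fun i => ?_) i
    · exact hUm.compl
    · exact hRm i
  have hQ : ∀ s, MeasurableSet s → ∑ i, μ.real (s ∩ Q i) = μ.real s := by
    intro s hs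
    rw [Fin.sum_univ_succ]
    have e1 : ∑ i : Fin n, μ.real (s ∩ Q i.succ) = μ.real (s ∩ ⋃ i, R i) := by
      have h5 := measureReal_biUnion_finset (μ := μ) (s := Finset.univ) (f := fun i => s ∩ R i)
        (fun i _ j _ hij => (hRd i j hij).mono Set.inter_subset_right Set.inter_subset_right)
        (fun i _ => hs.inter (hRm i))
      rw [Set.inter_iUnion]
      simp only [Finset.mem_univ, Set.iUnion_true] at h5
      exact h5.symm
    rw [e1, add_comm]
    exact measureReal_inter_add_diff hUm
  obtain ⟨N, hN⟩ := KM T μ hℓ hK (ε' := ε / (8 * (n + 1))) (by positivity) hQm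
  set N' := max N m with hN'
  set L := ⌈8 * ((m + N' : ℕ) : ℝ) / ε⌉₊ + 1 with hL
  have hL0 : (0 : ℝ) < L := by rw [hL]; positivity
  have hα : ((m + N' : ℕ) : ℝ) / L ≤ ε / 8 := by
    rw [div_le_iff₀ hL0]
    have : 8 * ((m + N' : ℕ) : ℝ) / ε ≤ L := (Nat.le_ceil _).trans (by rw [hL]; push_cast; linarith)
    rw [div_le_iff₀ hε] at this
    linarith
  refine ⟨gm, hgm, hGf.trans (by linarith), L, by omega, fun B => ?_⟩
  have hV := hS.measurable_wd hgm ((m : ℤ) - L) L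
  have hV' := measurable_tw T hgm d0 m N' L
  have hW' := measurable_tw T hℓ d0 m N' L
  have hΦ := hS.measurable_blks hgm L m B
  -- factorization
  let v : ({j : ℤ // j ≤ 0} → Fin q) → Fin L → Fin k := fun p r =>
    if h : (r : ℕ) + m + N' ≤ L then
      Gf (fun i => p ⟨(i : ℕ) - (L : ℤ) + (r : ℕ), by
        have := i.2; have : m ≤ N' := le_max_right _ _; omega⟩) else d0
  have hv : Measurable v := by
    refine measurable_pi_lambda _ fun r => ?_
    simp only [v]
    split_ifs with h
    · exact (measurable_of_finite Gf).comp (measurable_pi_lambda _ fun i => measurable_pi_apply _)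
    · exact measurable_const
  let f : ({j : ℤ // 0 ≤ j} → Fin q) → Fin B → Fin L → Fin k := fun u b r =>
    Gf (fun i => u ⟨(i : ℕ) + (b : ℕ) * (L : ℤ) + (r : ℕ), by positivity⟩)
  have hf : Measurable f := by
    refine measurable_pi_lambda _ fun b => measurable_pi_lambda _ fun r => ?_
    exact (measurable_of_finite Gf).comp (measurable_pi_lambda _ fun i => measurable_pi_apply _)
  have hvV : ∀ x, tw T gm d0 m N' L x = v (pastFuture T x).1 := by
    intro x; funext r
    simp only [tw, v, gm]
    split_ifs with h
    · congr 1; funext i; simp only [win, sh, pastFuture]; ring_nf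
    · rfl
  have hfΦ : ∀ x, blks (sh T) gm L m B x = f (pastFuture T x).2 := by
    intro x; funext b r
    simp only [blks, wd, f, gm]
    congr 1; funext i; simp only [win, sh, pastFuture]; ring_nf
  have h3 : ∑ i, ∑ a, ∑ φ, |lw (μ.restrict (Q i)) (fun x => (tw T gm d0 m N' L x,
      blks (sh T) gm L m B x)) (a, φ) - lw (μ.restrict (Q i)) (tw T gm d0 m N' L) a *
      (lw (μ.restrict (Q i)) (blks (sh T) gm L m B) φ / μ.real (Q i))| ≤ 11 * η := by
    rw [Fin.sum_univ_succ]
    have a1 := rest_le μ (Q 0) hV' hΦ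
    have a2 : μ.real (Q 0) ≤ η := by
      change μ.real (⋃ i, R i)ᶜ ≤ η
      rw [probReal_compl_eq_one_sub hUm]
      change 1 - η < μ.real _ at hcover
      linarith
    have a3 : ∀ i : Fin n, _ := fun i =>
      haveI := hlp i
      rect μ (lam i) hη (hRm i) (hGm i) (hGR i)
        (ENNReal.toReal_pos (hR0 i).ne' (measure_ne_top _ _)) (hG1 i) (hG2 i) (hG3 i) hV' hΦ
        (by
          rw [funext hvV, funext hfΦ]
          exact lw_product T (lam i) (hprod i) hv hf)
    have a4 := Finset.sum_le_sum fun i (_ : i ∈ Finset.univ) => a3 i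
    have a5 : ∑ i : Fin n, 9 * η * μ.real (R i) ≤ 9 * η := by
      rw [← Finset.mul_sum]
      have : ∑ i, μ.real (R i) ≤ 1 := by
        have := hQ Set.univ MeasurableSet.univ
        rw [Fin.sum_univ_succ] at this
        simp only [Set.univ_inter, probReal_univ] at this
        have h0 : 0 ≤ μ.real (Q 0) := measureReal_nonneg
        have h1 : ∑ i : Fin n, μ.real (Q i.succ) = ∑ i, μ.real (R i) := rfl
        linarith
      exact mul_le_of_le_one_right (by positivity) this
    have a6 := a4.trans a5
    change _ + ∑ i : Fin n, _ ≤ _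
    refine (add_le_add a1 a6).trans ?_
    linarith
  have h4 : ∑ i, ∑ a, |lw (μ.restrict (Q i)) (tw T ℓ d0 m N' L) a -
      lw μ (tw T ℓ d0 m N' L) a * μ.real (Q i)| ≤ ε / 4 := by
    let ψ : (↥(Finset.Icc N' (max N' L)) → Fin k) → Fin L → Fin k := fun z r =>
      if h : (r : ℕ) + m + N' ≤ L then z ⟨L - m - r, by
        rw [Finset.mem_Icc]; refine ⟨by omega, le_trans (by omega) (le_max_right _ _)⟩⟩ else d0
    have hψ : tw T ℓ d0 m N' L = fun x => ψ (Zmap T ℓ N' (max N' L) x) := by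
      funext x r
      simp only [tw, ψ, Zmap]
      split_ifs with h
      · congr 2; omega
      · rfl
    rw [hψ]
    calc _ ≤ ∑ i : Fin (n + 1), 2 * (ε / (8 * (n + 1))) := by
          refine Finset.sum_le_sum fun i _ => ?_
          exact (tv_comp μ (μ.restrict (Q i)) (μ.real (Q i)) (measurable_Zmap T hℓ _ _) ψ).trans
            (hN N' _ (le_max_left _ _) (le_max_left _ _) i)
      _ = _ := by
          rw [Finset.sum_const, Finset.card_univ, Fintype.card_fin, nsmul_eq_mul]
          push_cast; field_simp; ring
  have h2 : ∫ x, ham L (tw T gm d0 m N' L x) (tw T ℓ d0 m N' L x) ∂μ ≤ ε / 8 := by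
    refine int_ham hV' hW' (by positivity) fun r => ?_
    by_cases h : (r : ℕ) + m + N' ≤ L
    · have := hS.diff hgm hℓ ((m : ℤ) - L + (r : ℕ))
      simp only [tw, h, if_true]
      rw [this]
      simp_rw [ne_comm (a := gm _)]
      exact hGf
    · simp only [tw, h, if_false]
      simp; positivity
  obtain ⟨e, he, hcl⟩ := claimA2 μ (c := ham L) ham_nonneg ham_self ham_le_one ham_tri ham_comm
    hV hV' hW' hΦ hQ (fun x => (ham_tw T gm d0 m N' L x).trans hα) h2 h3 h4
  refine ⟨e, he.trans (by linarith), fun φ => ?_⟩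
  have e1 := hS.lw_shift ((hS.measurable_wd hgm 0 L).prodMk (hS.measurable_blks hgm L L B))
    ((m : ℤ) - L)
  have e2 := hS.lw_shift (hS.measurable_wd hgm 0 L) ((m : ℤ) - L)
  have e3 := hS.lw_shift (hS.measurable_blks hgm L L B) ((m : ℤ) - L)
  simp only [hS.wd_shift, hS.blks_shift, zero_add, add_sub_cancel] at e1 e2 e3
  rw [← e1, ← e2, ← e3]
  exact hcl φ
end Conc8
end VWB

namespace VWB
open Finset MeasureTheory Subshift

lemma lift_half {Ω A : Type*} [MeasurableSpace Ω] [Fintype A] [MeasurableSpace A]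
    [MeasurableSingletonClass A] (P : Measure Ω) [IsProbabilityMeasure P] {X : Ω → A}
    (hX : Measurable X) {π : A → A → ENNReal}
    (h1 : ∀ a, ∑ b, π a b = P (X ⁻¹' {a})) (κ : A → Measure Ω)
    (hκ : ∀ a b, π a b ≠ 0 → κ b Set.univ = 1) (U : Set Ω) :
    ∑ a, ∑ b, π a b * (ProbabilityTheory.cond P (X ⁻¹' {a}) U * κ b Set.univ) = P U := by
  have e : ∀ a, ∑ b, π a b * (ProbabilityTheory.cond P (X ⁻¹' {a}) U * κ b Set.univ) =
      P (X ⁻¹' {a}) * ProbabilityTheory.cond P (X ⁻¹' {a}) U := by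
    intro a
    rw [← h1 a, Finset.sum_mul]
    refine Finset.sum_congr rfl fun b _ => ?_
    by_cases h : π a b = 0
    · simp [h]
    · rw [hκ a b h, mul_one]
  simp_rw [e]
  conv_rhs => rw [← ProbabilityTheory.sum_meas_smul_cond_fiber hX P]
  simp

lemma cond_one {Ω A : Type*} [MeasurableSpace Ω] [MeasurableSpace A]
    [MeasurableSingletonClass A] (P : Measure Ω) [IsFiniteMeasure P] {X : Ω → A}
    (hX : Measurable X) {a : A} (h : P (X ⁻¹' {a}) ≠ 0) (a' : A) [Decidable (a = a')] :
    ProbabilityTheory.cond P (X ⁻¹' {a}) (X ⁻¹' {a'}) = if a = a' then 1 else 0 := by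
  rw [ProbabilityTheory.cond_apply (hX (measurableSet_singleton a))]
  split_ifs with hh
  · subst hh
    rw [Set.inter_self, ENNReal.inv_mul_cancel h (measure_ne_top _ _)]
  · rw [← Set.preimage_inter, Set.singleton_inter_eq_empty.2 (by simpa using hh)]
    simp

lemma lift_cpl {Ω A : Type*} [MeasurableSpace Ω] [Fintype A] [MeasurableSpace A]
    [MeasurableSingletonClass A] (P Q : Measure Ω) [IsProbabilityMeasure P]
    [IsProbabilityMeasure Q] {X : Ω → A} (hX : Measurable X) {c : A → A → ℝ} {e : ℝ}
    (h : Cl c (lw P X) (lw Q X) e) :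
    ∃ lam : Measure (Ω × Ω), IsProbabilityMeasure lam ∧ lam.map Prod.fst = P ∧
      lam.map Prod.snd = Q ∧ ∫ p, c (X p.1) (X p.2) ∂lam ≤ e := by
  classical
  obtain ⟨π, h0, h1, h2, h3⟩ := h
  let w : A → A → ENNReal := fun a b => ENNReal.ofReal (π a b)
  have w1 : ∀ a, ∑ b, w a b = P (X ⁻¹' {a}) := fun a => by
    rw [← ENNReal.ofReal_sum_of_nonneg fun b _ => h0 a b, h1, lw, ofReal_measureReal]
  have w2 : ∀ b, ∑ a, w a b = Q (X ⁻¹' {b}) := fun a => by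
    rw [← ENNReal.ofReal_sum_of_nonneg fun b _ => h0 b a, h2, lw, ofReal_measureReal]
  have p1 : ∀ a b, w a b ≠ 0 → P (X ⁻¹' {a}) ≠ 0 := fun a b hw h => by
    rw [← w1 a, Finset.sum_eq_zero_iff] at h
    exact hw (h b (Finset.mem_univ _))
  have p2 : ∀ a b, w a b ≠ 0 → Q (X ⁻¹' {b}) ≠ 0 := fun a b hw h => by
    rw [← w2 b, Finset.sum_eq_zero_iff] at h
    exact hw (h a (Finset.mem_univ _))
  let lam : Measure (Ω × Ω) := ∑ a, ∑ b, w a b •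
    ((ProbabilityTheory.cond P (X ⁻¹' {a})).prod (ProbabilityTheory.cond Q (X ⁻¹' {b})))
  have hlam : ∀ U W : Set Ω, lam (U ×ˢ W) = ∑ a, ∑ b, w a b *
      (ProbabilityTheory.cond P (X ⁻¹' {a}) U * ProbabilityTheory.cond Q (X ⁻¹' {b}) W) := by
    intro U W
    simp [lam, Measure.prod_prod]
  have m1 : lam.map Prod.fst = P := by
    ext U hU
    rw [Measure.map_apply measurable_fst hU, show Prod.fst ⁻¹' U = U ×ˢ (Set.univ : Set Ω) by
      ext; simp, hlam]
    refine lift_half P hX w1 _ (fun a b hw => ?_) U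
    have := ProbabilityTheory.cond_isProbabilityMeasure (p2 a b hw)
    exact measure_univ
  have m2 : lam.map Prod.snd = Q := by
    ext U hU
    rw [Measure.map_apply measurable_snd hU, show Prod.snd ⁻¹' U = (Set.univ : Set Ω) ×ˢ U by
      ext; simp, hlam, Finset.sum_comm]
    simp_rw [mul_comm (ProbabilityTheory.cond P _ _) _]
    refine lift_half Q hX (π := fun b a => w a b) w2 _ (fun b a hw => ?_) U
    have := ProbabilityTheory.cond_isProbabilityMeasure (p1 a b hw)
    exact measure_univ
  have hp : IsProbabilityMeasure lam := ⟨by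
    have : (lam.map Prod.fst) Set.univ = 1 := by rw [m1]; exact measure_univ
    rwa [Measure.map_apply measurable_fst MeasurableSet.univ] at this⟩
  refine ⟨lam, hp, m1, m2, ?_⟩
  have hXX : Measurable (fun p : Ω × Ω => (X p.1, X p.2)) :=
    (hX.comp measurable_fst).prodMk (hX.comp measurable_snd)
  rw [← sum_lw_mul lam hXX (fun y => c y.1 y.2), Fintype.sum_prod_type]
  refine le_trans (le_of_eq ?_) h3
  refine Finset.sum_congr rfl fun a _ => Finset.sum_congr rfl fun b _ => ?_
  congr 1
  unfold lw Measure.real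
  rw [show (fun p : Ω × Ω => (X p.1, X p.2)) ⁻¹' {(a, b)} = (X ⁻¹' {a}) ×ˢ (X ⁻¹' {b}) by
    ext; simp, hlam]
  have : ∀ a' b', w a' b' * (ProbabilityTheory.cond P (X ⁻¹' {a'}) (X ⁻¹' {a}) *
      ProbabilityTheory.cond Q (X ⁻¹' {b'}) (X ⁻¹' {b})) =
      if a' = a then (if b' = b then w a' b' else 0) else 0 := by
    intro a' b'
    by_cases hw : w a' b' = 0
    · simp [hw]
    · rw [cond_one P hX (p1 _ _ hw), cond_one Q hX (p2 _ _ hw)]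
      split_ifs <;> simp
  simp_rw [this]
  simp [w, h0 a b]

section Fin9
variable {q k : ℕ} (T : Fin q → Fin q → Prop)

lemma finalF (μ : Measure (SigmaT T)) [IsProbabilityMeasure μ]
    {ℓ : SigmaT T → Fin k} (hℓ : Measurable ℓ) {A : Type*} [Fintype A] [MeasurableSpace A]
    [MeasurableSingletonClass A] {X : SigmaT T → A} (hX : Measurable X) {c : A → A → ℝ}
    (hc : ∀ a b, 0 ≤ c a b) {m₁ m₂ n : ℕ} {ε : ℝ} (hε : 0 < ε)
    (hh : ∀ x y, hFreq ℓ (shift T) n x y ≤ c (X x) (X y) + ε / 2)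
    {e : (↥(Finset.Icc m₁ m₂) → Fin k) → ℝ} (he : ∑ z, e z ≤ ε * ε / 2)
    (hcl : ∀ z, Cl c (fun a => lw μ (fun x => (Zmap T ℓ m₁ m₂ x, X x)) (z, a))
      (fun a => lw μ (Zmap T ℓ m₁ m₂) z * lw μ X a) (e z)) :
    AeAtoms T μ ℓ m₁ m₂ ε fun E =>
          sInf {r : ℝ | ∃ lam' : Measure (SigmaT T × SigmaT T),
            IsProbabilityMeasure lam' ∧
            lam'.map Prod.fst = normRestrict μ E ∧
            lam'.map Prod.snd = μ ∧
            r = ∫ p, hFreq ℓ (shift T) n p.1 p.2 ∂lam'} ≤ ε := by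
  classical
  rw [aeAtoms_iff T μ hℓ]
  have hZ := measurable_Zmap T hℓ m₁ m₂
  have hf0 : ∀ x y, 0 ≤ hFreq ℓ (shift T) n x y := fun x y => by unfold hFreq; positivity
  have key : ∀ z, (if sInf {r : ℝ | ∃ lam' : Measure (SigmaT T × SigmaT T),
            IsProbabilityMeasure lam' ∧
            lam'.map Prod.fst = normRestrict μ (Zmap T ℓ m₁ m₂ ⁻¹' {z}) ∧
            lam'.map Prod.snd = μ ∧
            r = ∫ p, hFreq ℓ (shift T) n p.1 p.2 ∂lam'} ≤ ε then 0
          else lw μ (Zmap T ℓ m₁ m₂) z) ≤ 2 / ε * e z := by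
    intro z
    have he0 := (hcl z).nonneg hc
    split_ifs with hs
    · positivity
    · by_contra hlt
      push Not at hlt
      apply hs
      have hz : 0 < lw μ (Zmap T ℓ m₁ m₂) z := lt_of_le_of_lt (by positivity) hlt
      set E := Zmap T ℓ m₁ m₂ ⁻¹' {z} with hE
      have hEm : MeasurableSet E := hZ (measurableSet_singleton z)
      have hE0 : μ E ≠ 0 := fun h => by
        simp [lw, Measure.real, ← hE, h] at hz
      have hnr : normRestrict μ E = ProbabilityTheory.cond μ E := rfl
      have := ProbabilityTheory.cond_isProbabilityMeasure hE0
      have hcl2 : Cl c (lw (ProbabilityTheory.cond μ E) X) (lw μ X)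
          (e z / lw μ (Zmap T ℓ m₁ m₂) z) := by
        obtain ⟨π, g0, g1, g2, g3⟩ := hcl z
        beta_reduce at g1 g2
        refine ⟨fun a b => π a b / lw μ (Zmap T ℓ m₁ m₂) z,
          fun a b => div_nonneg (g0 a b) hz.le, fun a => ?_, fun b => ?_, ?_⟩
        · rw [← Finset.sum_div, g1, lw_pair_slice' μ X hX, lw_restrict μ hX]
          unfold lw Measure.real
          rw [ProbabilityTheory.cond_apply hEm, div_eq_inv_mul, Set.inter_comm,
            ENNReal.toReal_mul, ENNReal.toReal_inv]
        · rw [← Finset.sum_div, g2, mul_div_cancel_left₀ _ hz.ne']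
        · simp_rw [div_mul_eq_mul_div, ← Finset.sum_div]
          exact div_le_div_of_nonneg_right g3 hz.le
      obtain ⟨lam, l0, l1, l2, l3⟩ := lift_cpl _ μ hX hcl2
      have hle : e z / lw μ (Zmap T ℓ m₁ m₂) z ≤ ε / 2 := by
        rw [div_le_iff₀ hz]
        have := mul_le_mul_of_nonneg_left hlt.le (show 0 ≤ ε / 2 by positivity)
        rw [← mul_assoc, show ε / 2 * (2 / ε) = 1 by field_simp, one_mul] at this
        exact this
      have hi : Integrable (fun p : SigmaT T × SigmaT T => c (X p.1) (X p.2)) lam := by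
        have hm : Measurable (fun p : SigmaT T × SigmaT T => c (X p.1) (X p.2)) :=
          (measurable_of_finite (fun y : A × A => c y.1 y.2)).comp
            ((hX.comp measurable_fst).prodMk (hX.comp measurable_snd))
        refine Integrable.of_bound (C := ∑ a, ∑ b, c a b) hm.aestronglyMeasurable
          (Filter.Eventually.of_forall fun p => ?_)
        rw [Real.norm_of_nonneg (hc _ _)]
        exact (Finset.single_le_sum (f := fun b => c (X p.1) b) (fun b _ => hc _ _)
          (Finset.mem_univ (X p.2))).trans
          (Finset.single_le_sum (f := fun a => ∑ b, c a b)
            (fun a _ => Finset.sum_nonneg fun b _ => hc _ _) (Finset.mem_univ (X p.1)))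
      have hint : ∫ p, hFreq ℓ (shift T) n p.1 p.2 ∂lam ≤ ε := by
        calc _ ≤ ∫ p, (c (X p.1) (X p.2) + ε / 2) ∂lam :=
              integral_mono_of_nonneg (Filter.Eventually.of_forall fun p => hf0 _ _)
                (hi.add (integrable_const _)) (Filter.Eventually.of_forall fun p => hh _ _)
          _ = ∫ p, c (X p.1) (X p.2) ∂lam + ε / 2 := by
              rw [integral_add hi (integrable_const _)]; simp
          _ ≤ ε := by linarith
      refine le_trans (csInf_le ?_ ?_) hint
      · refine ⟨0, ?_⟩
        rintro r ⟨lam', _, _, _, rfl⟩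
        exact integral_nonneg fun p => hf0 _ _
      · exact ⟨lam, l0, by rw [l1, hnr], l2, rfl⟩
  refine (Finset.sum_le_sum fun z _ => key z).trans ?_
  rw [← Finset.mul_sum]
  calc 2 / ε * ∑ z, e z ≤ 2 / ε * (ε * ε / 2) := by gcongr
    _ = ε := by field_simp
end Fin9
end VWB

namespace VWB
open Finset MeasureTheory Subshift

section Fin10
variable {q k : ℕ} (T : Fin q → Fin q → Prop)

lemma hFreq_eq (ℓ : SigmaT T → Fin k) (n : ℕ) (x y : SigmaT T) :
    hFreq ℓ (shift T) n x y = (n : ℝ)⁻¹ * ∑ j ∈ Finset.range n,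
      if ℓ (sh T (1 + (j : ℕ)) x) = ℓ (sh T (1 + (j : ℕ)) y) then (0 : ℝ) else 1 := by
  unfold hFreq
  congr 1
  rw [← Finset.sum_boole, ← Finset.Ico_succ_right_eq_Icc, Finset.sum_Ico_eq_sum_range]
  refine Finset.sum_congr (by simp) fun j _ => ?_
  simp only [shift_eq, sh_iter]
  push_cast
  simp [ite_not]

lemma hFreq_le_one (ℓ : SigmaT T → Fin k) (n : ℕ) (x y : SigmaT T) :
    hFreq ℓ (shift T) n x y ≤ 1 := by
  rw [hFreq_eq]
  rcases Nat.eq_zero_or_pos n with rfl | h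
  · simp
  · rw [inv_mul_le_iff₀ (by exact_mod_cast h)]
    calc _ ≤ ∑ j ∈ Finset.range n, (1 : ℝ) := Finset.sum_le_sum fun r _ => by split_ifs <;> simp
      _ = _ := by simp

lemma hFreq_blks (ℓ : SigmaT T → Fin k) {n L : ℕ} (hB : 1 ≤ n / L) (x y : SigmaT T) :
    hFreq ℓ (shift T) n x y ≤ ((n / L : ℕ) : ℝ)⁻¹ * ∑ b, ham L (blks (sh T) ℓ L 1 (n / L) x b)
      (blks (sh T) ℓ L 1 (n / L) y b) + (L : ℝ) / n := by
  rw [hFreq_eq]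
  have hL : 0 < L := by
    rcases Nat.eq_zero_or_pos L with rfl | h
    · simp at hB
    · exact h
  have hmod := Nat.div_add_mod n L
  have hlt := Nat.mod_lt n hL
  set B := n / L with hBd
  have hBL : B * L ≤ n := by rw [mul_comm]; omega
  have hBL0 : 0 < B * L := by positivity
  set d : ℕ → ℝ := fun j =>
    if ℓ (sh T (1 + (j : ℕ)) x) = ℓ (sh T (1 + (j : ℕ)) y) then (0 : ℝ) else 1 with hd
  have hd0 : ∀ j, 0 ≤ d j := fun j => by simp only [hd]; split_ifs <;> simp
  have hd1 : ∀ j, d j ≤ 1 := fun j => by simp only [hd]; split_ifs <;> simp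
  have e1 : (B : ℝ)⁻¹ * ∑ b, ham L (blks (sh T) ℓ L 1 B x b) (blks (sh T) ℓ L 1 B y b) =
      ((B * L : ℕ) : ℝ)⁻¹ * ∑ j ∈ Finset.range (B * L), d j := by
    unfold ham
    rw [← Finset.mul_sum, ← mul_assoc, ← mul_inv, ← Nat.cast_mul]
    congr 1
    rw [← Fin.sum_univ_eq_sum_range d, ← Equiv.sum_comp finProdFinEquiv, Fintype.sum_prod_type]
    refine Finset.sum_congr rfl fun b _ => Finset.sum_congr rfl fun r _ => ?_
    rw [blks_eq, blks_eq]
    rfl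
  rw [e1, ← Finset.sum_range_add_sum_Ico d hBL, mul_add]
  have hn0 : (0 : ℝ) < n := by exact_mod_cast lt_of_lt_of_le hBL0 hBL
  have hBL0' : (0 : ℝ) < ((B * L : ℕ) : ℝ) := by exact_mod_cast hBL0
  refine add_le_add ?_ ?_
  · refine mul_le_mul_of_nonneg_right ?_ (Finset.sum_nonneg fun j _ => hd0 j)
    exact inv_anti₀ hBL0' (by exact_mod_cast hBL)
  · rw [div_eq_inv_mul]
    refine mul_le_mul_of_nonneg_left ?_ (by positivity)
    calc _ ≤ ∑ j ∈ Finset.Ico (B * L) n, (1 : ℝ) := Finset.sum_le_sum fun j _ => hd1 j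
      _ = ((n - B * L : ℕ) : ℝ) := by simp
      _ ≤ L := by
          have : n - B * L ≤ L := by rw [mul_comm]; omega
          exact_mod_cast this

lemma small_n (μ : Measure (SigmaT T)) [IsProbabilityMeasure μ]
    {ℓ : SigmaT T → Fin k} (hℓ : Measurable ℓ) (hK : KMixing T μ ℓ) (hS : Flow μ (sh T))
    {ε : ℝ} (hε : 0 < ε) (n₀ : ℕ) : ∃ N : ℕ, ∀ m₁ m₂ : ℕ, N ≤ m₁ → m₁ ≤ m₂ →
      ∀ n, n ≤ n₀ → AeAtoms T μ ℓ m₁ m₂ ε fun E =>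
          sInf {r : ℝ | ∃ lam' : Measure (SigmaT T × SigmaT T),
            IsProbabilityMeasure lam' ∧
            lam'.map Prod.fst = normRestrict μ E ∧
            lam'.map Prod.snd = μ ∧
            r = ∫ p, hFreq ℓ (shift T) n p.1 p.2 ∂lam'} ≤ ε := by
  classical
  have hX := hS.measurable_wd hℓ 1 n₀
  set X := wd (sh T) ℓ 1 n₀ with hXd
  let ee := (Fintype.equivFin (Fin n₀ → Fin k)).symm
  set K := Fintype.card (Fin n₀ → Fin k) with hKd
  obtain ⟨N, hN⟩ := KM T μ hℓ hK (ε' := ε * ε / (4 * (K + 1))) (by positivity)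
    (Q := fun i : Fin K => X ⁻¹' {ee i}) (fun i => hX (measurableSet_singleton _))
  refine ⟨N, fun m₁ m₂ h1 h2 n hn => ?_⟩
  have hZ := measurable_Zmap T hℓ m₁ m₂
  refine finalF T μ hℓ hX (c := fun a b => if a = b then 0 else 1)
    (fun a b => by split_ifs <;> simp) hε (fun x y => ?_)
    (e := fun z => ∑ a, |lw μ (fun x => (Zmap T ℓ m₁ m₂ x, X x)) (z, a) -
      lw μ (Zmap T ℓ m₁ m₂) z * lw μ X a|) ?_ (fun z => ?_)
  · split_ifs with hxy
    · rw [hFreq_eq, Finset.sum_eq_zero]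
      · rw [mul_zero]; positivity
      · intro j hj
        rw [Finset.mem_range] at hj
        exact if_pos (congrFun hxy ⟨j, by omega⟩)
    · have := hFreq_le_one T ℓ n x y
      linarith
  · rw [Finset.sum_comm, ← Equiv.sum_comp ee]
    calc _ ≤ ∑ i : Fin K, 2 * (ε * ε / (4 * (K + 1))) := by
          refine Finset.sum_le_sum fun i _ => le_trans (le_of_eq ?_) (hN m₁ m₂ h1 h2 i)
          refine Finset.sum_congr rfl fun z _ => ?_
          rw [lw_pair_slice μ hZ]
          rfl
      _ = (K / (K + 1)) * (ε * ε / 2) := by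
          rw [Finset.sum_const, Finset.card_univ, Fintype.card_fin, nsmul_eq_mul]
          field_simp; ring
      _ ≤ _ := mul_le_of_le_one_left (by positivity) (by rw [div_le_one (by positivity)]; linarith)
  · refine Cl.tv (fun a => lw_nonneg _ _ _)
      (fun a => mul_nonneg (lw_nonneg _ _ _) (lw_nonneg _ _ _)) ?_ (by simp)
      (fun a b => by split_ifs <;> simp)
    rw [lw_fst μ hZ hX, ← Finset.mul_sum, sum_lw μ hX]; simp

lemma final (hne : Nonempty (SigmaT T))
    (μ : Measure (SigmaT T)) [IsProbabilityMeasure μ]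
    (hinv : ∀ A : Set (SigmaT T), MeasurableSet A → μ (shift T ⁻¹' A) = μ A)
    (ℓ : SigmaT T → Fin k) (hℓ : Measurable ℓ)
    (C₀ : ℝ) (hsb : SmallBoundary T μ ℓ C₀)
    (hK : KMixing T μ ℓ)
    (hcov : ∀ η : ℝ, 0 < η → η < 1 → ∀ δ' : ℝ, 0 < δ' →
      ∃ (n : ℕ) (R : Fin n → Set (SigmaT T)) (lam : Fin n → Measure (SigmaT T))
        (G : Fin n → Set (SigmaT T)),
        IsRegularCovering T μ η R lam G ∧
        (∀ i, ∀ x ∈ R i, ∀ y ∈ R i, sdist T x y < δ') ∧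
        (∀ i, IsNonatomicProduct T (lam i) (R i))) :
    ∀ ε : ℝ, 0 < ε →
      ∃ N₀ : ℕ, ∀ m₁ m₂ : ℕ, N₀ ≤ m₁ → m₁ ≤ m₂ → ∀ n : ℕ, 1 ≤ n →
        AeAtoms T μ ℓ m₁ m₂ ε fun E =>
          sInf {r : ℝ | ∃ lam' : Measure (SigmaT T × SigmaT T),
            IsProbabilityMeasure lam' ∧
            lam'.map Prod.fst = normRestrict μ E ∧
            lam'.map Prod.snd = μ ∧
            r = ∫ p, hFreq ℓ (shift T) n p.1 p.2 ∂lam'} ≤ ε := by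
  intro ε hε
  have hS := flow_sh T μ hinv
  obtain ⟨L, hL, n₀, hlarge⟩ := hS.main_large hℓ (claimA3 T μ hne hinv hℓ hsb hK hcov)
    (ε := min (ε / 2) (ε * ε / 2)) (by positivity)
  obtain ⟨N, hN⟩ := small_n T μ hℓ hK hS hε n₀
  refine ⟨N, fun m₁ m₂ h1 h2 n _ => ?_⟩
  rcases le_total n n₀ with hn | hn
  · exact hN m₁ m₂ h1 h2 n hn
  obtain ⟨hB, hLn, hmain⟩ := hlarge n hn
  let ψ : (Fin (m₂ + 1) → Fin k) → ↥(Finset.Icc m₁ m₂) → Fin k := fun w j =>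
    w ⟨m₂ - j, by omega⟩
  obtain ⟨e, he, hcl⟩ := hmain (m₂ + 1) ψ
  have hψ : ∀ x, ψ (wd (sh T) ℓ (1 - ((m₂ + 1 : ℕ) : ℤ)) (m₂ + 1) x) = Zmap T ℓ m₁ m₂ x := by
    intro x; funext j
    simp only [ψ, wd, Zmap]
    congr 2
    have := (Finset.mem_Icc.1 j.2).2
    omega
  simp only [hψ] at hcl
  exact finalF T μ hℓ (hS.measurable_blks hℓ L 1 (n / L))
    (fun a b => mul_nonneg (by positivity) (Finset.sum_nonneg fun _ _ => ham_nonneg _ _)) hε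
    (fun x y => (hFreq_blks T ℓ hB x y).trans
      (by have := hLn.trans (min_le_left _ _); linarith))
    (he.trans (min_le_right _ _)) hcl
end Fin10
end VWB

open Subshift MeasureTheory

/-- Let `μ` be a σ-invariant Borel probability measure on `Σ_T` and `ξ` a
finite Borel partition with the small-boundary property. Assume the K-mixing hypothesis
for `ξ`, and that for every `η ∈ (0,1)` and `δ' > 0` there is a regular covering at scale
`η` by rectangles of diameter `< δ'` carrying non-atomic product measures. Then `ξ` is
Very Weak Bernoulli: for every `ε > 0` there is `N₀` such that for all `m₂ ≥ m₁ ≥ N₀` and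
every `n ≥ 1`, for `ε`-almost every atom `E` of `⋁_{j=m₁}^{m₂} σ^j ξ`, the infimum over
couplings `λ` of `(E, μ|_E)` and `(Σ_T, μ)` of `∫ h_n dλ` is at most `ε`. -/
theorem stmt13 {q k : ℕ} (hq : 1 ≤ q) (T : Fin q → Fin q → Prop)
    (hne : Nonempty (SigmaT T))
    (μ : Measure (SigmaT T)) [IsProbabilityMeasure μ]
    (hinv : ∀ A : Set (SigmaT T), MeasurableSet A → μ (shift T ⁻¹' A) = μ A)
    (ℓ : SigmaT T → Fin k) (hℓ : Measurable ℓ)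
    (C₀ : ℝ) (hsb : SmallBoundary T μ ℓ C₀)
    (hK : KMixing T μ ℓ)
    (hcov : ∀ η : ℝ, 0 < η → η < 1 → ∀ δ' : ℝ, 0 < δ' →
      ∃ (n : ℕ) (R : Fin n → Set (SigmaT T)) (lam : Fin n → Measure (SigmaT T))
        (G : Fin n → Set (SigmaT T)),
        IsRegularCovering T μ η R lam G ∧
        (∀ i, ∀ x ∈ R i, ∀ y ∈ R i, sdist T x y < δ') ∧
        (∀ i, IsNonatomicProduct T (lam i) (R i))) :
    ∀ ε : ℝ, 0 < ε →
      ∃ N₀ : ℕ, ∀ m₁ m₂ : ℕ, N₀ ≤ m₁ → m₁ ≤ m₂ → ∀ n : ℕ, 1 ≤ n →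
        AeAtoms T μ ℓ m₁ m₂ ε fun E =>
          sInf {r : ℝ | ∃ lam' : Measure (SigmaT T × SigmaT T),
            IsProbabilityMeasure lam' ∧
            lam'.map Prod.fst = normRestrict μ E ∧
            lam'.map Prod.snd = μ ∧
            r = ∫ p, hFreq ℓ (shift T) n p.1 p.2 ∂lam'} ≤ ε := by
  exact VWB.final T hne μ hinv ℓ hℓ C₀ hsb hK hcov
end
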